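/- Fix β ∈ (1, 10/9] and positive integers n ≥ 2, p, λ with m = pλ, and let γ = ‖v_β‖₁/‖v_β‖₂. Let 𝒯 be any (possibly infinite) subset of {x ∈ ℝ^n : ‖x‖₁ ≤ 1}, and fix α ∈ (0,1) and ν > 0. Then there exist constants C₁, C₂ > 0 depending only on β such that if m ≥ p ≥ C₁·γ²·(1+ν)²·log⁴(n)·max{1, ω(𝒯−𝒯)²/rad(𝒯−𝒯)²}/α², then with probability at least 1 − e^{−ν} over the draw of Φ and D_ε, the map f : 𝒯 → {±1}^m defined by f(x) = Q_β((8/9)·Φ D_ε x) satisfies, for all x, x̃ ∈ 𝒯: | ‖Ṽ_β(f(x) − f(x̃))‖₂ − ‖x − x̃‖₂ | ≤ max{√α, α}·rad(𝒯−𝒯) + C₂·β^{−λ+1}. -/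

import Mathlib

open scoped BigOperators Matrix
noncomputable section

/-- The sign `±1` associated with a boolean. -/
def rsign (b : Bool) : ℝ := if b then 1 else -1

/-- `ℓ¹` norm of a real vector. -/
def norm1 {n : ℕ} (x : Fin n → ℝ) : ℝ := ∑ j, |x j|

/-- Euclidean norm of a real vector. -/
def norm2 {n : ℕ} (x : Fin n → ℝ) : ℝ := Real.sqrt (∑ j, (x j) ^ 2)

/-- Block-diagonal matrix `I_p ⊗ v` with `p` copies of the row vector `v` on the diagonal. -/
def kronRow (p : ℕ) {lam : ℕ} (v : Fin lam → ℝ) : Matrix (Fin p) (Fin (p * lam)) ℝ :=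
  Matrix.of fun i j =>
    if (j : ℕ) / lam = (i : ℕ) then
      (if h2 : (j : ℕ) % lam < lam then v ⟨(j : ℕ) % lam, h2⟩ else 0)
    else 0

/-- The vector `v_β = (β^{-1}, …, β^{-λ})`. -/
def betaVec (β : ℝ) (lam : ℕ) : Fin lam → ℝ := fun j => β ^ (-((j : ℕ) : ℤ) - 1)

/-- The sign function used by the quantizer: `1` if `t ≥ 0`, `-1` otherwise. -/
def qsgn (t : ℝ) : ℝ := if 0 ≤ t then 1 else -1

/-- The state sequence of the one-bit distributed noise-shaping quantizer within a block. -/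
def nsU (β : ℝ) (y : ℕ → ℝ) : ℕ → ℝ
  | 0 => 0
  | s + 1 => (y s + β * nsU β y s) - qsgn (y s + β * nsU β y s)

/-- The one-bit distributed noise-shaping quantizer `Q_β : ℝ^{pλ} → {±1}^{pλ}`. -/
def Qbeta (β : ℝ) (p lam : ℕ) (y : Fin (p * lam) → ℝ) : Fin (p * lam) → ℝ :=
  fun j =>
    let yb : ℕ → ℝ := fun s =>
      if h : ((j : ℕ) / lam) * lam + s < p * lam then y ⟨((j : ℕ) / lam) * lam + s, h⟩ else 0
    qsgn (yb ((j : ℕ) % lam) + β * nsU β yb ((j : ℕ) % lam))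

/-- Probability of an event under the uniform distribution on a finite sample space. -/
def unifProb {Ω : Type*} [Fintype Ω] (P : Ω → Prop) : ℝ :=
  (Nat.card {ω : Ω // P ω} : ℝ) / (Fintype.card Ω : ℝ)

/-- The Gaussian mean width `ω(T) = E sup_{v ∈ T} ⟨v, g⟩`, `g` standard Gaussian on `ℝⁿ`. -/
def gaussWidth {n : ℕ} (T : Set (Fin n → ℝ)) : ℝ :=
  ∫ g, sSup ((fun w => ∑ t, w t * g t) '' T)
    ∂(MeasureTheory.Measure.pi fun _ : Fin n => ProbabilityTheory.gaussianReal 0 1)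

/-- The Euclidean radius `rad(T) = sup_{v ∈ T} ‖v‖₂`. -/
def srad {n : ℕ} (T : Set (Fin n → ℝ)) : ℝ := sSup (norm2 '' T)

/-- The difference set `T − T`. -/
def diffSet {n : ℕ} (T : Set (Fin n → ℝ)) : Set (Fin n → ℝ) :=
  {d | ∃ x ∈ T, ∃ x' ∈ T, d = x - x'}

/-! ### Euclidean norm and dot product on `Fin n → ℝ` -/

lemma norm2_nonneg {n : ℕ} (x : Fin n → ℝ) : 0 ≤ norm2 x := Real.sqrt_nonneg _

lemma norm2_sq {n : ℕ} (x : Fin n → ℝ) : norm2 x ^ 2 = ∑ j, x j ^ 2 :=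
  Real.sq_sqrt (Finset.sum_nonneg fun _ _ => sq_nonneg _)

lemma norm2_eq_norm {n : ℕ} (x : Fin n → ℝ) : norm2 x = ‖WithLp.toLp 2 x‖ := by
  simp [norm2, EuclideanSpace.norm_eq]

lemma norm2_zero {n : ℕ} : norm2 (0 : Fin n → ℝ) = 0 := by simp [norm2]

lemma norm2_add_le {n : ℕ} (x y : Fin n → ℝ) : norm2 (x + y) ≤ norm2 x + norm2 y := by
  simp only [norm2_eq_norm, WithLp.toLp_add]
  exact norm_add_le _ _

lemma norm2_neg {n : ℕ} (x : Fin n → ℝ) : norm2 (-x) = norm2 x := by simp [norm2]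

lemma norm2_sub_comm {n : ℕ} (x y : Fin n → ℝ) : norm2 (x - y) = norm2 (y - x) := by
  rw [← norm2_neg, neg_sub]

lemma norm2_sub_le {n : ℕ} (x y : Fin n → ℝ) : norm2 (x - y) ≤ norm2 x + norm2 y := by
  rw [sub_eq_add_neg, ← norm2_neg y]
  exact norm2_add_le _ _

lemma norm2_triangle {n : ℕ} (x y z : Fin n → ℝ) :
    norm2 (x - z) ≤ norm2 (x - y) + norm2 (y - z) := by
  simpa using norm2_add_le (x - y) (y - z)

lemma norm2_smul {n : ℕ} (c : ℝ) (x : Fin n → ℝ) : norm2 (c • x) = |c| * norm2 x := by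
  simp only [norm2_eq_norm, WithLp.toLp_smul, norm_smul, Real.norm_eq_abs]

lemma norm2_sum_le {n : ℕ} {ι : Type*} (s : Finset ι) (f : ι → Fin n → ℝ) :
    norm2 (∑ i ∈ s, f i) ≤ ∑ i ∈ s, norm2 (f i) := by
  classical
  induction s using Finset.induction_on with
  | empty => simp [norm2_zero]
  | insert a s ha ih =>
    rw [Finset.sum_insert ha, Finset.sum_insert ha]
    exact (norm2_add_le _ _).trans (by gcongr)

lemma norm2_eq_zero {n : ℕ} {x : Fin n → ℝ} : norm2 x = 0 ↔ x = 0 := by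
  simp [norm2_eq_norm]

lemma norm2_pos {n : ℕ} {x : Fin n → ℝ} (hx : x ≠ 0) : 0 < norm2 x :=
  lt_of_le_of_ne (norm2_nonneg x) fun h => hx (norm2_eq_zero.1 h.symm)

lemma dotProduct_self_eq_norm2_sq {n : ℕ} (x : Fin n → ℝ) : x ⬝ᵥ x = norm2 x ^ 2 := by
  rw [norm2_sq]
  simp [dotProduct, sq]

lemma abs_apply_le_norm2 {n : ℕ} (x : Fin n → ℝ) (j : Fin n) : |x j| ≤ norm2 x := by
  rw [norm2, ← Real.sqrt_sq_eq_abs]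
  exact Real.sqrt_le_sqrt
    (Finset.single_le_sum (f := fun j => x j ^ 2) (fun _ _ => sq_nonneg _) (Finset.mem_univ j))

lemma norm2_le_of_sq_le {n : ℕ} {x : Fin n → ℝ} {c : ℝ} (hc : 0 ≤ c) (h : ∑ j, x j ^ 2 ≤ c ^ 2) :
    norm2 x ≤ c := by
  rw [← norm2_sq] at h
  exact abs_le_of_sq_le_sq' h hc |>.2

lemma abs_dotProduct_le_norm1 {n : ℕ} {u : Fin n → ℝ} (hu : ∀ t, |u t| ≤ 1) (x : Fin n → ℝ) :
    |u ⬝ᵥ x| ≤ norm1 x := by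
  refine (Finset.abs_sum_le_sum_abs _ _).trans (Finset.sum_le_sum fun t _ => ?_)
  rw [abs_mul]
  exact mul_le_of_le_one_left (abs_nonneg _) (hu t)

lemma norm2_le_norm1 {n : ℕ} (x : Fin n → ℝ) : norm2 x ≤ norm1 x := by
  have h0 : 0 ≤ norm1 x := Finset.sum_nonneg fun _ _ => abs_nonneg _
  refine norm2_le_of_sq_le h0 ?_
  calc ∑ j, x j ^ 2 = ∑ j, |x j| * |x j| := by simp [sq]
    _ ≤ ∑ j, |x j| * norm1 x := by
        gcongr with j
        exact Finset.single_le_sum (f := fun j => |x j|) (fun _ _ => abs_nonneg _)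
          (Finset.mem_univ j)
    _ = norm1 x ^ 2 := by rw [← Finset.sum_mul, sq]; rfl

/-! ### Averages over finite types -/

lemma expect_prod_type {α κ : Type*} [Fintype α] [Fintype κ] (f : α × κ → ℝ) :
    𝔼 x, f x = 𝔼 a, 𝔼 b, f (a, b) := by
  rw [← Finset.univ_product_univ, Finset.expect_product]

lemma expect_pi_prod {ι κ : Type*} [Fintype ι] [DecidableEq ι] [Fintype κ]
    (f : ι → κ → ℝ) : 𝔼 x : ι → κ, ∏ i, f i (x i) = ∏ i, 𝔼 k, f i k := by
  simp only [Fintype.expect_eq_sum_div_card, Finset.prod_div_distrib, Finset.prod_univ_sum,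
    Fintype.piFinset_univ]
  simp

lemma expect_le_of_forall_le {α : Type*} [Fintype α] [Nonempty α] {f : α → ℝ} {c : ℝ}
    (h : ∀ a, f a ≤ c) : 𝔼 a, f a ≤ c :=
  Finset.expect_le Finset.univ_nonempty fun a _ => h a

lemma expect_mono {α : Type*} [Fintype α] {f g : α → ℝ}
    (h : ∀ a, f a ≤ g a) : 𝔼 a, f a ≤ 𝔼 a, g a :=
  Finset.expect_le_expect fun a _ => h a

lemma expect_nonneg' {α : Type*} [Fintype α] {f : α → ℝ}
    (h : ∀ a, 0 ≤ f a) : 0 ≤ 𝔼 a, f a :=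
  Finset.expect_nonneg fun a _ => h a

lemma convexOn_map_expect_le {α : Type*} [Fintype α] [Nonempty α] {φ : ℝ → ℝ} {s : Set ℝ}
    (hφ : ConvexOn ℝ s φ) {f : α → ℝ} (hf : ∀ a, f a ∈ s) :
    φ (𝔼 a, f a) ≤ 𝔼 a, φ (f a) := by
  have h := hφ.map_sum_le (t := Finset.univ) (w := fun _ : α => (Fintype.card α : ℝ)⁻¹)
    (p := f) (fun _ _ => by positivity) (by simp) (fun a _ => hf a)
  simp only [Fintype.expect_eq_sum_div_card, div_eq_inv_mul, Finset.mul_sum]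
  simpa [smul_eq_mul] using h

/-- Jensen's inequality for powers of nonnegative functions with exponent in `[0,1]`. -/
lemma expect_rpow_le {α : Type*} [Fintype α] [Nonempty α] {f : α → ℝ} (hf : ∀ a, 0 ≤ f a)
    {c : ℝ} (hc0 : 0 ≤ c) (hc1 : c ≤ 1) :
    𝔼 a, f a ^ c ≤ (𝔼 a, f a) ^ c := by
  have h := (Real.concaveOn_rpow hc0 hc1).neg
  have := convexOn_map_expect_le h (f := f) (fun a => hf a)
  simp only [Pi.neg_apply, Finset.expect_neg_distrib] at this
  linarith

/-! ### Uniform probability -/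

open Classical in
lemma unifProb_eq_expect {Ω : Type*} [Fintype Ω] (P : Ω → Prop) :
    unifProb P = 𝔼 ω, if P ω then (1 : ℝ) else 0 := by
  rw [unifProb, Fintype.expect_eq_sum_div_card, Finset.sum_boole, Nat.card_eq_fintype_card,
    Fintype.card_subtype]

lemma unifProb_mono {Ω : Type*} [Fintype Ω] {P Q : Ω → Prop} (h : ∀ ω, P ω → Q ω) :
    unifProb P ≤ unifProb Q := by
  classical
  rw [unifProb_eq_expect, unifProb_eq_expect]
  refine expect_mono fun ω => ?_
  by_cases hP : P ω
  · simp [hP, h ω hP]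
  · by_cases hQ : Q ω <;> simp [hP, hQ]

lemma unifProb_or_le {Ω : Type*} [Fintype Ω] (P Q : Ω → Prop) :
    unifProb (fun ω => P ω ∨ Q ω) ≤ unifProb P + unifProb Q := by
  classical
  rw [unifProb_eq_expect, unifProb_eq_expect, unifProb_eq_expect, ← Finset.expect_add_distrib]
  refine expect_mono fun ω => ?_
  by_cases hP : P ω <;> by_cases hQ : Q ω <;> simp [hP, hQ]

lemma unifProb_not {Ω : Type*} [Fintype Ω] [Nonempty Ω] (P : Ω → Prop) :
    unifProb P = 1 - unifProb (fun ω => ¬ P ω) := by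
  classical
  rw [unifProb_eq_expect, unifProb_eq_expect, eq_sub_iff_add_eq, ← Finset.expect_add_distrib]
  rw [← Fintype.expect_const (ι := Ω) (1 : ℝ)]
  refine Finset.expect_congr rfl fun ω _ => ?_
  by_cases hP : P ω <;> simp [hP]

lemma unifProb_exists_le {Ω ι : Type*} [Fintype Ω] (s : Finset ι) (P : ι → Ω → Prop) :
    unifProb (fun ω => ∃ i ∈ s, P i ω) ≤ ∑ i ∈ s, unifProb (P i) := by
  classical
  simp only [unifProb_eq_expect]
  rw [← Finset.expect_sum_comm]
  refine expect_mono fun ω => ?_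
  by_cases h : ∃ i ∈ s, P i ω
  · obtain ⟨i, hi, hP⟩ := h
    have h1 : (if P i ω then (1 : ℝ) else 0) ≤ ∑ i ∈ s, if P i ω then (1 : ℝ) else 0 :=
      Finset.single_le_sum (f := fun i => if P i ω then (1 : ℝ) else 0)
        (fun i _ => by split_ifs <;> norm_num) hi
    rw [if_pos hP] at h1
    rw [if_pos ⟨i, hi, hP⟩]
    exact h1
  · rw [if_neg h]
    exact Finset.sum_nonneg fun i _ => by split_ifs <;> norm_num

/-- Markov's inequality. -/
lemma unifProb_le_expect_div {Ω : Type*} [Fintype Ω] {f : Ω → ℝ} (hf : ∀ ω, 0 ≤ f ω) {c : ℝ}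
    (hc : 0 < c) {P : Ω → Prop} (hP : ∀ ω, P ω → c ≤ f ω) :
    unifProb P ≤ (𝔼 ω, f ω) / c := by
  classical
  rw [unifProb_eq_expect, Finset.expect_div]
  refine expect_mono fun ω => ?_
  split_ifs with h
  · rw [le_div_iff₀ hc, one_mul]
    exact hP ω h
  · exact div_nonneg (hf ω) hc.le

lemma unifProb_prod_le {α κ : Type*} [Fintype α] [Fintype κ] [Nonempty α] {P : α × κ → Prop} {c : ℝ}
    (h : ∀ a, unifProb (fun b => P (a, b)) ≤ c) : unifProb P ≤ c := by
  classical
  rw [unifProb_eq_expect, expect_prod_type]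
  refine expect_le_of_forall_le fun a => ?_
  simpa [unifProb_eq_expect] using h a

lemma unifProb_fst {α κ : Type*} [Fintype α] [Fintype κ] [Nonempty κ] (P : α → Prop) :
    unifProb (fun x : α × κ => P x.1) = unifProb P := by
  classical
  rw [unifProb_eq_expect, expect_prod_type, unifProb_eq_expect]
  exact Finset.expect_congr rfl fun a _ =>
    Fintype.expect_const (ι := κ) (if P a then (1 : ℝ) else 0)

lemma unifProb_equiv {α κ : Type*} [Fintype α] [Fintype κ] (e : α ≃ κ) (P : κ → Prop) :
    unifProb (fun a => P (e a)) = unifProb P := by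
  classical
  rw [unifProb_eq_expect, unifProb_eq_expect]
  exact Fintype.expect_equiv e _ _ fun _ => rfl

/-! ### Rademacher sums -/

lemma rsign_sq (b : Bool) : rsign b ^ 2 = 1 := by cases b <;> simp [rsign]

lemma rsign_mul_self (b : Bool) : rsign b * rsign b = 1 := by cases b <;> simp [rsign]

lemma abs_rsign (b : Bool) : |rsign b| = 1 := by cases b <;> simp [rsign]

lemma expect_rsign : 𝔼 b, rsign b = 0 := by
  rw [Fintype.expect_eq_sum_div_card]
  simp [rsign]

/-- Moment generating function of a Rademacher sum. -/
lemma expect_exp_rademacher_le {ι : Type*} [Fintype ι] [DecidableEq ι] (a : ι → ℝ) :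
    𝔼 ε : ι → Bool, Real.exp (∑ i, a i * rsign (ε i)) ≤ Real.exp ((∑ i, a i ^ 2) / 2) := by
  simp only [Real.exp_sum]
  rw [expect_pi_prod (fun i b => Real.exp (a i * rsign b)), Finset.sum_div, Real.exp_sum]
  refine Finset.prod_le_prod (fun i _ => expect_nonneg' fun _ => (Real.exp_pos _).le) fun i _ => ?_
  refine le_trans (le_of_eq ?_) (Real.cosh_le_exp_half_sq (a i))
  rw [Fintype.expect_eq_sum_div_card]
  simp [rsign, Real.cosh_eq]

/-- Hoeffding's inequality for Rademacher sums. -/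
lemma unifProb_abs_rademacher_gt_le {ι : Type*} [Fintype ι] [DecidableEq ι] (a : ι → ℝ)
    {σ t : ℝ} (hσ : 0 < σ) (ha : ∑ i, a i ^ 2 ≤ σ ^ 2) (ht : 0 ≤ t) :
    unifProb (fun ε : ι → Bool => t * σ < |∑ i, a i * rsign (ε i)|) ≤
      2 * Real.exp (-t ^ 2 / 2) := by
  have key : ∀ a : ι → ℝ, ∑ i, a i ^ 2 ≤ σ ^ 2 →
      unifProb (fun ε : ι → Bool => t * σ < ∑ i, a i * rsign (ε i)) ≤
        Real.exp (-t ^ 2 / 2) := by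
    intro a ha
    have hm := unifProb_le_expect_div (P := fun ε : ι → Bool => t * σ < ∑ i, a i * rsign (ε i))
      (f := fun ε => Real.exp (∑ i, (t / σ * a i) * rsign (ε i))) (c := Real.exp (t ^ 2))
      (fun _ => (Real.exp_pos _).le) (Real.exp_pos _) (by
        intro ε hε
        refine Real.exp_le_exp.2 ?_
        simp only [mul_assoc, ← Finset.mul_sum]
        calc t ^ 2 = t / σ * (t * σ) := by field_simp
          _ ≤ _ := by gcongr)
    refine hm.trans ?_
    rw [div_le_iff₀ (Real.exp_pos _), ← Real.exp_add]
    refine (expect_exp_rademacher_le _).trans (Real.exp_le_exp.2 ?_)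
    simp only [mul_pow, ← Finset.mul_sum]
    have : (t / σ) ^ 2 * ∑ i, a i ^ 2 ≤ (t / σ) ^ 2 * σ ^ 2 := by gcongr
    have h2 : (t / σ) ^ 2 * σ ^ 2 = t ^ 2 := by field_simp
    linarith
  have h1 := key a ha
  have h2 := key (fun i => - a i) (by simpa using ha)
  refine (unifProb_mono (Q := fun ε : ι → Bool => (t * σ < ∑ i, a i * rsign (ε i)) ∨
    (t * σ < ∑ i, - a i * rsign (ε i))) ?_).trans ((unifProb_or_le _ _).trans ?_)
  · intro ε hε
    rcases lt_abs.1 hε with h | h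
    · exact Or.inl h
    · right
      simpa [Finset.sum_neg_distrib] using h
  · linarith

/-! ### The noise-shaping quantizer -/

lemma kronRow_mulVec (p : ℕ) {lam : ℕ} (v : Fin lam → ℝ) (y : Fin (p * lam) → ℝ) (k : Fin p) :
    (kronRow p v).mulVec y k = ∑ s, v s * y (finProdFinEquiv (k, s)) := by
  rw [Matrix.mulVec, dotProduct, ← finProdFinEquiv.sum_comp, Fintype.sum_prod_type,
    Finset.sum_eq_single k]
  · refine Finset.sum_congr rfl fun s _ => ?_
    have hl : 0 < lam := s.pos
    simp [kronRow, Nat.add_mul_div_left _ _ hl, Nat.mod_eq_of_lt s.2, Nat.div_eq_of_lt s.2]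
  · intro k' _ hk
    refine Finset.sum_eq_zero fun s _ => ?_
    have hl : 0 < lam := s.pos
    have : (k' : ℕ) ≠ k := fun h => hk (Fin.ext h)
    simp [kronRow, Nat.add_mul_div_left _ _ hl, Nat.div_eq_of_lt s.2, this]
  · simp

lemma abs_sub_qsgn_le {w : ℝ} (hw : |w| ≤ 2) : |w - qsgn w| ≤ 1 := by
  rw [abs_le] at *
  unfold qsgn
  split_ifs <;> constructor <;> linarith

lemma abs_nsU_le {β : ℝ} (hβ0 : 0 ≤ β) (hβ : β ≤ 10 / 9) {y : ℕ → ℝ} (hy : ∀ s, |y s| ≤ 8 / 9)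
    (s : ℕ) : |nsU β y s| ≤ 1 := by
  induction s with
  | zero => simp [nsU]
  | succ s ih =>
    refine abs_sub_qsgn_le ((abs_add_le _ _).trans ?_)
    rw [abs_mul, abs_of_nonneg hβ0]
    have := hy s
    nlinarith [abs_nonneg (nsU β y s)]

lemma sum_weighted_quantization_error {β : ℝ} (hβ : 0 < β) (y : ℕ → ℝ) (l : ℕ) :
    ∑ s ∈ Finset.range l, β ^ (-(s : ℤ) - 1) * (y s - qsgn (y s + β * nsU β y s)) =
      β ^ (-(l : ℤ)) * nsU β y l := by
  induction l with
  | zero => simp [nsU]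
  | succ l ih =>
    rw [Finset.sum_range_succ, ih, nsU]
    have h1 : β ^ (-((l + 1 : ℕ) : ℤ)) = β ^ (-(l : ℤ) - 1) := by push_cast; ring_nf
    have h2 : β ^ (-(l : ℤ)) = β ^ (-(l : ℤ) - 1) * β := by
      rw [← zpow_add_one₀ hβ.ne']
      ring_nf
    rw [h1, h2]
    ring

lemma abs_betaVec_sum_quantization_error_le {β : ℝ} (hβ : 0 < β) (hβ2 : β ≤ 10 / 9) {p lam : ℕ}
    {y : Fin (p * lam) → ℝ} (hy : ∀ j, |y j| ≤ 8 / 9) (k : Fin p) :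
    |(kronRow p (betaVec β lam)).mulVec (y - Qbeta β p lam y) k| ≤ β ^ (-(lam : ℤ)) := by
  rw [kronRow_mulVec]
  set yb : ℕ → ℝ := fun s =>
    if h : (k : ℕ) * lam + s < p * lam then y ⟨(k : ℕ) * lam + s, h⟩ else 0 with hyb
  have hyb_le : ∀ s, |yb s| ≤ 8 / 9 := by
    intro s
    simp only [hyb]
    split_ifs
    · exact hy _
    · norm_num
  have hlt : ∀ s : Fin lam, (k : ℕ) * lam + s < p * lam := by
    intro s
    calc (k : ℕ) * lam + s < k * lam + lam := by have := s.2; omega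
      _ = (k + 1) * lam := by ring
      _ ≤ p * lam := Nat.mul_le_mul_right _ k.2
  have hybs : ∀ s : Fin lam, y (finProdFinEquiv (k, s)) = yb s := by
    intro s
    simp only [hyb, hlt s, dif_pos]
    congr 1
    ext
    simp
    ring
  have hQ : ∀ s : Fin lam, Qbeta β p lam y (finProdFinEquiv (k, s)) =
      qsgn (yb s + β * nsU β yb s) := by
    intro s
    have hl : 0 < lam := s.pos
    simp [Qbeta, Nat.add_mul_div_left _ _ hl, Nat.mod_eq_of_lt s.2, Nat.div_eq_of_lt s.2, hyb]
  have : ∑ s, betaVec β lam s * (y - Qbeta β p lam y) (finProdFinEquiv (k, s)) =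
      β ^ (-(lam : ℤ)) * nsU β yb lam := by
    rw [← sum_weighted_quantization_error hβ, Finset.sum_range]
    refine Finset.sum_congr rfl fun s _ => ?_
    rw [Pi.sub_apply, hybs, hQ]
    rfl
  rw [this, abs_mul, abs_of_pos (zpow_pos hβ _)]
  exact mul_le_of_le_one_right (zpow_pos hβ _).le (abs_nsU_le hβ.le hβ2 hyb_le _)

lemma norm2_le_sqrt_mul_of_abs_le {p : ℕ} {x : Fin p → ℝ} {c : ℝ} (h : ∀ k, |x k| ≤ c)
    (hc : 0 ≤ c) : norm2 x ≤ Real.sqrt p * c := by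
  refine norm2_le_of_sq_le (by positivity) ?_
  rw [mul_pow, Real.sq_sqrt (Nat.cast_nonneg _)]
  calc ∑ k, x k ^ 2 ≤ ∑ _k : Fin p, c ^ 2 :=
        Finset.sum_le_sum fun k _ => sq_le_sq.2 ((h k).trans (le_abs_self c))
    _ = p * c ^ 2 := by simp

lemma inv_le_norm2_betaVec {β : ℝ} {lam : ℕ} (hl : 0 < lam) :
    β⁻¹ ≤ norm2 (betaVec β lam) := by
  refine le_trans ?_ (abs_apply_le_norm2 (betaVec β lam) ⟨0, hl⟩)
  simp only [betaVec]
  refine le_trans (le_of_eq ?_) (le_abs_self _)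
  simp

lemma abs_norm2_sub_norm2_le {n : ℕ} (x y : Fin n → ℝ) : |norm2 x - norm2 y| ≤ norm2 (x - y) := by
  simp only [norm2_eq_norm, WithLp.toLp_sub]
  exact abs_norm_sub_norm_le _ _

/-- Replacing the measurements by their noise-shaped one-bit quantizations changes condensed
distances by at most a constant times `β ^ (1 - λ)`. -/
lemma abs_norm2_quantized_sub_le {β : ℝ} (hβ : 1 < β) (hβ2 : β ≤ 10 / 9) {p lam : ℕ}
    (hp : 0 < p) (hl : 0 < lam) {y y' : Fin (p * lam) → ℝ} (hy : ∀ j, |y j| ≤ 8 / 9)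
    (hy' : ∀ j, |y' j| ≤ 8 / 9) :
    |norm2 (((9 / (8 * norm2 (betaVec β lam) * Real.sqrt p)) •
          kronRow p (betaVec β lam)).mulVec (Qbeta β p lam y - Qbeta β p lam y')) -
      norm2 (((9 / (8 * norm2 (betaVec β lam) * Real.sqrt p)) •
          kronRow p (betaVec β lam)).mulVec (y - y'))| ≤ 9 / 4 * β ^ (-(lam : ℤ) + 1) := by
  have hβ0 : 0 < β := by linarith
  set c := 9 / (8 * norm2 (betaVec β lam) * Real.sqrt p) with hc
  have hv : 0 < norm2 (betaVec β lam) := (inv_pos.2 hβ0).trans_le (inv_le_norm2_betaVec hl)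
  have hsp : 0 < Real.sqrt p := Real.sqrt_pos.2 (Nat.cast_pos.2 hp)
  have hc0 : 0 < c := by positivity
  have hz : 0 < β ^ (-(lam : ℤ)) := zpow_pos hβ0 _
  refine (abs_norm2_sub_norm2_le _ _).trans ?_
  rw [← Matrix.mulVec_sub, Matrix.smul_mulVec, norm2_smul, abs_of_pos hc0]
  have hb : norm2 ((kronRow p (betaVec β lam)).mulVec
      (Qbeta β p lam y - Qbeta β p lam y' - (y - y'))) ≤
      Real.sqrt p * (2 * β ^ (-(lam : ℤ))) := by
    refine norm2_le_sqrt_mul_of_abs_le (fun k => ?_) (by positivity)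
    have e : Qbeta β p lam y - Qbeta β p lam y' - (y - y') =
        (y' - Qbeta β p lam y') - (y - Qbeta β p lam y) := by abel
    rw [e, Matrix.mulVec_sub, Pi.sub_apply]
    refine (abs_sub _ _).trans ?_
    have h1 := abs_betaVec_sum_quantization_error_le hβ0 hβ2 hy k
    have h2 := abs_betaVec_sum_quantization_error_le hβ0 hβ2 hy' k
    linarith
  have hinv : (norm2 (betaVec β lam))⁻¹ ≤ β := by
    rw [inv_le_comm₀ hv hβ0]
    exact inv_le_norm2_betaVec hl
  calc c * norm2 _ ≤ c * (Real.sqrt p * (2 * β ^ (-(lam : ℤ)))) := by gcongr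
    _ = 9 / 4 * (β ^ (-(lam : ℤ)) * (norm2 (betaVec β lam))⁻¹) := by
        rw [hc]
        field_simp
        norm_num
    _ ≤ 9 / 4 * (β ^ (-(lam : ℤ)) * β) := by gcongr
    _ = _ := by rw [zpow_add_one₀ hβ0.ne']

/-! ### Decoupling and exponential moments of Rademacher chaos -/

/-- Take the coordinates of `ε` where `δ` holds, and those of `ε'` elsewhere. -/
def mixSigns {ι : Type*} (δ ε ε' : ι → Bool) : ι → Bool := fun i => if δ i then ε i else ε' i

lemma expect_mixSigns {ι : Type*} [Fintype ι] [DecidableEq ι] (δ : ι → Bool)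
    (f : (ι → Bool) → ℝ) : 𝔼 ε, f ε = 𝔼 ε, 𝔼 ε', f (mixSigns δ ε ε') := by
  have h1 : 𝔼 x : (ι → Bool) × (ι → Bool), f x.1 =
      𝔼 x : (ι → Bool) × (ι → Bool), f (mixSigns δ x.1 x.2) := by
    let e : (ι → Bool) × (ι → Bool) ≃ (ι → Bool) × (ι → Bool) :=
      { toFun := fun x => (mixSigns δ x.1 x.2, mixSigns δ x.2 x.1)
        invFun := fun x => (mixSigns δ x.1 x.2, mixSigns δ x.2 x.1)
        left_inv := fun x => by
          ext i <;> by_cases h : δ i <;> simp [mixSigns, h]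
        right_inv := fun x => by
          ext i <;> by_cases h : δ i <;> simp [mixSigns, h] }
    exact (Fintype.expect_equiv e (fun x => f (mixSigns δ x.1 x.2)) (fun x => f x.1)
      fun _ => rfl).symm
  rw [expect_prod_type, expect_prod_type] at h1
  rw [← h1]
  exact (Finset.expect_congr rfl fun a _ => Fintype.expect_const (ι := ι → Bool) (f a)).symm

lemma unifProb_mixSigns_le {ι : Type*} [Fintype ι] [DecidableEq ι] (δ : ι → Bool)
    {P : (ι → Bool) → Prop} {c : ℝ}
    (h : ∀ ε, unifProb (fun ε' => P (mixSigns δ ε ε')) ≤ c) : unifProb P ≤ c := by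
  classical
  rw [unifProb_eq_expect, expect_mixSigns δ]
  refine expect_le_of_forall_le fun ε => ?_
  simpa [unifProb_eq_expect] using h ε

lemma expect_eq_zero_of_flip {ι : Type*} [Fintype ι] [DecidableEq ι] (i : ι)
    {f : (ι → Bool) → ℝ} (hf : ∀ ε, f (Function.update ε i (!ε i)) = -f ε) : 𝔼 ε, f ε = 0 := by
  let e : (ι → Bool) ≃ (ι → Bool) :=
    Function.Involutive.toPerm (fun ε => Function.update ε i (!ε i)) fun ε => by simp
  have h := Fintype.expect_equiv e (fun ε => -f ε) f fun ε => (hf ε).symm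
  rw [Finset.expect_neg_distrib] at h
  linarith

lemma rsign_not (b : Bool) : rsign (!b) = -rsign b := by cases b <;> simp [rsign]

lemma expect_rsign_apply {ι : Type*} [Fintype ι] [DecidableEq ι] (i : ι) :
    𝔼 ε : ι → Bool, rsign (ε i) = 0 :=
  expect_eq_zero_of_flip i fun ε => by simp [rsign_not]

lemma expect_rsign_mul_rsign {ι : Type*} [Fintype ι] [DecidableEq ι] (i j : ι) :
    𝔼 ε : ι → Bool, rsign (ε i) * rsign (ε j) = if i = j then 1 else 0 := by
  split_ifs with h
  · subst h
    simp only [rsign_mul_self]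
    exact Fintype.expect_const (ι := ι → Bool) (1 : ℝ)
  · refine expect_eq_zero_of_flip i fun ε => ?_
    rw [Function.update_of_ne (Ne.symm h)]
    simp [rsign_not]

/-- The indicator of a boolean as a real number. -/
def boolInd (b : Bool) : ℝ := (1 + rsign b) / 2

lemma expect_boolInd_mul {ι : Type*} [Fintype ι] [DecidableEq ι] (i j : ι) :
    𝔼 δ : ι → Bool, boolInd (δ i) * (1 - boolInd (δ j)) = if i = j then 0 else 1 / 4 := by
  have h : ∀ δ : ι → Bool, boolInd (δ i) * (1 - boolInd (δ j)) =
      1 / 4 + (1 / 4) * rsign (δ i) - (1 / 4) * rsign (δ j) -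
        (1 / 4) * (rsign (δ i) * rsign (δ j)) := by
    intro δ
    simp only [boolInd]
    ring
  simp only [h, Finset.expect_sub_distrib, Finset.expect_add_distrib, ← Finset.mul_expect,
    expect_rsign_apply, expect_rsign_mul_rsign]
  rw [Fintype.expect_const (ι := ι → Bool) (1 / 4 : ℝ)]
  split_ifs <;> norm_num

/-- Jensen's inequality: resampling the signs outside a subset increases exponential moments of
a quadratic form. -/
lemma expect_exp_sq_restrict_le {ι κ : Type*} [Fintype ι] [DecidableEq ι] [Fintype κ]
    (M : κ → ι → ℝ) {c : ℝ} (hc : 0 ≤ c) (δ : ι → Bool) :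
    𝔼 ε : ι → Bool, Real.exp (c * ∑ k, (∑ i, M k i * (boolInd (δ i) * rsign (ε i))) ^ 2) ≤
      𝔼 ε : ι → Bool, Real.exp (c * ∑ k, (∑ i, M k i * rsign (ε i)) ^ 2) := by
  rw [expect_mixSigns δ (fun ε => Real.exp (c * ∑ k, (∑ i, M k i * rsign (ε i)) ^ 2))]
  refine expect_mono fun ε => ?_
  refine le_trans (Real.exp_le_exp.2 ?_) (convexOn_map_expect_le convexOn_exp
    (fun _ => Set.mem_univ _))
  rw [← Finset.mul_expect, Finset.expect_sum_comm]
  gcongr with k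
  refine le_trans (le_of_eq ?_) (convexOn_map_expect_le (even_two.convexOn_pow)
    (fun _ => Set.mem_univ _))
  congr 1
  rw [Finset.expect_sum_comm]
  refine Finset.sum_congr rfl fun i _ => ?_
  rw [← Finset.mul_expect]
  congr 1
  by_cases h : δ i
  · simp only [mixSigns, h, if_true]
    rw [Fintype.expect_const (ι := ι → Bool) (rsign (ε i))]
    simp [boolInd, rsign]
  · simp only [mixSigns, h, Bool.false_eq_true, if_false]
    rw [expect_rsign_apply]
    simp [boolInd, rsign]

/-- Decoupling bound for the exponential moment of a Rademacher chaos. -/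
lemma expect_exp_chaos_le {ι : Type*} [Fintype ι] [DecidableEq ι] (A : ι → ι → ℝ) (θ : ℝ) :
    𝔼 ε : ι → Bool, Real.exp (θ * (∑ i, ∑ j, A i j * (rsign (ε i) * rsign (ε j)) - ∑ i, A i i)) ≤
      𝔼 ε : ι → Bool, Real.exp (8 * θ ^ 2 * ∑ j, (∑ i, A i j * rsign (ε i)) ^ 2) := by
  have key : ∀ ε : ι → Bool,
      θ * (∑ i, ∑ j, A i j * (rsign (ε i) * rsign (ε j)) - ∑ i, A i i) =
      𝔼 δ : ι → Bool, ∑ j, (4 * θ * (1 - boolInd (δ j)) *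
        ∑ i, A i j * (boolInd (δ i) * rsign (ε i))) * rsign (ε j) := by
    intro ε
    have e1 : ∀ δ : ι → Bool, ∑ j, (4 * θ * (1 - boolInd (δ j)) *
        ∑ i, A i j * (boolInd (δ i) * rsign (ε i))) * rsign (ε j) =
        ∑ j, ∑ i, (4 * θ * A i j * (rsign (ε i) * rsign (ε j))) *
          (boolInd (δ i) * (1 - boolInd (δ j))) := by
      intro δ
      refine Finset.sum_congr rfl fun j _ => ?_
      rw [Finset.mul_sum, Finset.sum_mul]
      refine Finset.sum_congr rfl fun i _ => ?_
      ring
    simp only [e1, Finset.expect_sum_comm, ← Finset.mul_expect, expect_boolInd_mul]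
    conv_rhs => rw [Finset.sum_comm]
    rw [← Finset.sum_sub_distrib, Finset.mul_sum]
    refine Finset.sum_congr rfl fun i _ => ?_
    have : A i i = ∑ j, if i = j then A i j * (rsign (ε i) * rsign (ε j)) else 0 := by
      simp [rsign_mul_self]
    rw [this, ← Finset.sum_sub_distrib, Finset.mul_sum]
    refine Finset.sum_congr rfl fun j _ => ?_
    split_ifs <;> ring
  simp only [key]
  calc _ ≤ 𝔼 ε : ι → Bool, 𝔼 δ : ι → Bool, Real.exp (∑ j, (4 * θ * (1 - boolInd (δ j)) *
        ∑ i, A i j * (boolInd (δ i) * rsign (ε i))) * rsign (ε j)) :=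
        expect_mono fun ε => convexOn_map_expect_le convexOn_exp (fun _ => Set.mem_univ _)
    _ = 𝔼 δ : ι → Bool, 𝔼 ε : ι → Bool, Real.exp (∑ j, (4 * θ * (1 - boolInd (δ j)) *
        ∑ i, A i j * (boolInd (δ i) * rsign (ε i))) * rsign (ε j)) := Finset.expect_comm _ _ _
    _ ≤ _ := expect_le_of_forall_le fun δ => ?_
  refine le_trans ?_ (expect_exp_sq_restrict_le (fun j i => A i j) (by positivity) δ)
  rw [expect_mixSigns δ]
  refine expect_mono fun ε => ?_
  have e2 : ∀ ε' : ι → Bool, ∑ j, (4 * θ * (1 - boolInd (δ j)) *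
      ∑ i, A i j * (boolInd (δ i) * rsign (mixSigns δ ε ε' i))) * rsign (mixSigns δ ε ε' j) =
      ∑ j, (4 * θ * (1 - boolInd (δ j)) *
        ∑ i, A i j * (boolInd (δ i) * rsign (ε i))) * rsign (ε' j) := by
    intro ε'
    have e3 : ∀ i, boolInd (δ i) * rsign (mixSigns δ ε ε' i) = boolInd (δ i) * rsign (ε i) := by
      intro i
      by_cases h : δ i <;> simp [mixSigns, h, boolInd, rsign]
    have e4 : ∀ j, (1 - boolInd (δ j)) * rsign (mixSigns δ ε ε' j) =
        (1 - boolInd (δ j)) * rsign (ε' j) := by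
      intro i
      by_cases h : δ i <;> simp [mixSigns, h, boolInd, rsign]
    refine Finset.sum_congr rfl fun j _ => ?_
    simp only [e3]
    linear_combination (4 * θ * ∑ i, A i j * (boolInd (δ i) * rsign (ε i))) * e4 j
  simp only [e2]
  refine (expect_exp_rademacher_le _).trans (Real.exp_le_exp.2 ?_)
  rw [Finset.sum_div, Finset.mul_sum]
  refine Finset.sum_le_sum fun j _ => ?_
  have h01 : (1 - boolInd (δ j)) ^ 2 ≤ 1 := by
    by_cases h : δ j <;> simp [h, boolInd, rsign]
  have := mul_le_mul_of_nonneg_left h01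
    (by positivity : 0 ≤ 8 * θ ^ 2 * (∑ i, A i j * (boolInd (δ i) * rsign (ε i))) ^ 2)
  linarith

/-- Exponential moment of the squared norm of a linear image of a Rademacher vector. -/
lemma expect_exp_sq_le {ι κ : Type*} [Fintype ι] [DecidableEq ι] [Fintype κ]
    (M : κ → ι → ℝ) {L μ : ℝ} (hμ : 0 ≤ μ)
    (hL : ∀ y : κ → ℝ, ∑ i, (∑ k, M k i * y k) ^ 2 ≤ L ^ 2 * ∑ k, y k ^ 2)
    (hμL : 16 * μ * L ^ 2 ≤ 1) :
    𝔼 ε : ι → Bool, Real.exp (μ * ∑ k, (∑ i, M k i * rsign (ε i)) ^ 2) ≤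
      Real.exp (2 * μ * ∑ k, ∑ i, M k i ^ 2) := by
  set Z := 𝔼 ε : ι → Bool, Real.exp (μ * ∑ k, (∑ i, M k i * rsign (ε i)) ^ 2) with hZ
  set A : ι → ι → ℝ := fun i j => ∑ k, M k i * M k j with hA
  have hZ1 : 1 ≤ Z := by
    rw [← Fintype.expect_const (ι := ι → Bool) (1 : ℝ)]
    exact expect_mono fun ε => Real.one_le_exp (by positivity)
  have htr : ∑ i, A i i = ∑ k, ∑ i, M k i ^ 2 := by
    rw [Finset.sum_comm]
    simp only [sq]
  have hq : ∀ ε : ι → Bool, ∑ i, ∑ j, A i j * (rsign (ε i) * rsign (ε j)) =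
      ∑ k, (∑ i, M k i * rsign (ε i)) ^ 2 := by
    intro ε
    simp only [hA, sq, Finset.sum_mul]
    have hcomm : ∀ i, ∑ j, ∑ k, M k i * M k j * (rsign (ε i) * rsign (ε j)) =
        ∑ k, ∑ j, M k i * M k j * (rsign (ε i) * rsign (ε j)) := fun i => Finset.sum_comm
    simp only [hcomm]
    rw [Finset.sum_comm]
    refine Finset.sum_congr rfl fun k _ => Finset.sum_congr rfl fun i _ => ?_
    rw [Finset.mul_sum]
    exact Finset.sum_congr rfl fun j _ => by ring
  have h1 : Z * Real.exp (-(μ * ∑ k, ∑ i, M k i ^ 2)) ≤ Z ^ (8 * μ * L ^ 2) := by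
    calc Z * Real.exp (-(μ * ∑ k, ∑ i, M k i ^ 2))
        = 𝔼 ε : ι → Bool, Real.exp (μ * (∑ i, ∑ j, A i j * (rsign (ε i) * rsign (ε j)) -
            ∑ i, A i i)) := by
          rw [hZ, Finset.expect_mul]
          refine Finset.expect_congr rfl fun ε _ => ?_
          rw [← Real.exp_add, hq, htr]
          ring_nf
      _ ≤ _ := expect_exp_chaos_le A μ
      _ ≤ 𝔼 ε : ι → Bool, (Real.exp (μ * ∑ k, (∑ i, M k i * rsign (ε i)) ^ 2)) ^
            (8 * μ * L ^ 2) := by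
          refine expect_mono fun ε => ?_
          rw [← Real.exp_mul]
          refine Real.exp_le_exp.2 ?_
          have h2 : ∑ j, (∑ i, A i j * rsign (ε i)) ^ 2 ≤
              L ^ 2 * ∑ k, (∑ i, M k i * rsign (ε i)) ^ 2 := by
            refine le_trans (le_of_eq ?_) (hL fun k => ∑ i, M k i * rsign (ε i))
            refine Finset.sum_congr rfl fun j _ => ?_
            congr 1
            simp only [hA, Finset.sum_mul, Finset.mul_sum]
            rw [Finset.sum_comm]
            refine Finset.sum_congr rfl fun k _ => Finset.sum_congr rfl fun i _ => by ring
          calc _ ≤ 8 * μ ^ 2 * (L ^ 2 * ∑ k, (∑ i, M k i * rsign (ε i)) ^ 2) := by gcongr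
            _ = _ := by ring
      _ ≤ Z ^ (8 * μ * L ^ 2) :=
          expect_rpow_le (fun _ => (Real.exp_pos _).le) (by positivity) (by linarith)
  have h2 : Z ^ (8 * μ * L ^ 2) ≤ Z ^ (1 / 2 : ℝ) :=
    Real.rpow_le_rpow_of_exponent_le hZ1 (by linarith)
  rw [← Real.sqrt_eq_rpow] at h2
  have h3 := h1.trans h2
  have hs : Real.sqrt Z * Real.sqrt Z = Z := Real.mul_self_sqrt (by linarith)
  have hsp : 0 < Real.sqrt Z := Real.sqrt_pos.2 (by linarith)
  have h4 : Real.sqrt Z ≤ Real.exp (μ * ∑ k, ∑ i, M k i ^ 2) := by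
    rw [Real.exp_neg, ← div_eq_mul_inv, div_le_iff₀ (Real.exp_pos _)] at h3
    nlinarith
  calc Z = Real.sqrt Z * Real.sqrt Z := hs.symm
    _ ≤ Real.exp (μ * ∑ k, ∑ i, M k i ^ 2) * Real.exp (μ * ∑ k, ∑ i, M k i ^ 2) := by gcongr
    _ = _ := by rw [← Real.exp_add]; ring_nf

/-- Hanson–Wright inequality at a single scale. -/
lemma unifProb_chaos_gt_le {ι : Type*} [Fintype ι] [DecidableEq ι] (A : ι → ι → ℝ) {h s : ℝ}
    (hh : 0 < h) (hs : 0 < s)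
    (hop : ∀ y : ι → ℝ, ∑ i, (∑ j, A i j * y j) ^ 2 ≤ (h / s) ^ 2 * ∑ j, y j ^ 2)
    (hF : ∑ i, ∑ j, A i j ^ 2 ≤ h ^ 2 / s) :
    unifProb (fun ε : ι → Bool =>
      9 * h < ∑ i, ∑ j, A i j * (rsign (ε i) * rsign (ε j)) - ∑ i, A i i) ≤
      Real.exp (-s / 2) := by
  set θ := s / (16 * h) with hθ
  have hθ0 : 0 < θ := by positivity
  refine (unifProb_le_expect_div (f := fun ε : ι → Bool => Real.exp (θ *
    (∑ i, ∑ j, A i j * (rsign (ε i) * rsign (ε j)) - ∑ i, A i i))) (c := Real.exp (θ * (9 * h)))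
    (fun _ => (Real.exp_pos _).le) (Real.exp_pos _) (fun ε hε => ?_)).trans ?_
  · exact Real.exp_le_exp.2 (by gcongr)
  · rw [div_le_iff₀ (Real.exp_pos _), ← Real.exp_add]
    refine (expect_exp_chaos_le A θ).trans ((expect_exp_sq_le (fun j i => A i j) (L := h / s)
      (by positivity) hop ?_).trans (Real.exp_le_exp.2 ?_))
    · rw [hθ]
      field_simp
      norm_num
    · rw [Finset.sum_comm]
      calc 2 * (8 * θ ^ 2) * ∑ i, ∑ j, A i j ^ 2 ≤ 2 * (8 * θ ^ 2) * (h ^ 2 / s) := by gcongr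
        _ = -s / 2 + θ * (9 * h) := by
          rw [hθ]
          field_simp
          norm_num

/-! ### Randomized signs: from sparse vectors to a fixed vector -/

/-- A vector with at most `s` nonzero coordinates. -/
def IsSparse {n : ℕ} (s : ℕ) (x : Fin n → ℝ) : Prop :=
  (Finset.univ.filter fun t => x t ≠ 0).card ≤ s

lemma IsSparse.of_support {n s : ℕ} {x : Fin n → ℝ} (S : Finset (Fin n)) (hS : S.card ≤ s)
    (h : ∀ t, t ∉ S → x t = 0) : IsSparse s x := by
  refine (Finset.card_le_card fun t ht => ?_).trans hS
  by_contra hn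
  exact (Finset.mem_filter.1 ht).2 (h t hn)

/-- Grouping the coordinates of a vector into blocks of size `s` by decreasing modulus. -/
lemma exists_block_map {n : ℕ} (x : Fin n → ℝ) {s : ℕ} (hs : 0 < s) :
    ∃ b : Fin n → ℕ, (∀ t, b t ≤ n) ∧
      (∀ i, (Finset.univ.filter fun t => b t = i).card ≤ s) ∧
      ∀ t i, b t = i + 1 → s * x t ^ 2 ≤ ∑ t' ∈ Finset.univ.filter (fun t' => b t' = i), x t' ^ 2 := by
  set f : Fin n → ℝ := fun t => -x t ^ 2 with hf
  set σ := Tuple.sort f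
  have hmono : Monotone (f ∘ σ) := Tuple.monotone_sort f
  refine ⟨fun t => (σ.symm t : ℕ) / s, fun t => ?_, fun i => ?_, fun t i hti => ?_⟩
  · exact (Nat.div_le_self _ _).trans (σ.symm t).2.le
  · have : (Finset.univ.filter fun t => (σ.symm t : ℕ) / s = i).card ≤
        (Finset.Ico (i * s) (i * s + s)).card := by
      refine Finset.card_le_card_of_injOn (fun t => (σ.symm t : ℕ)) (fun t ht => ?_)
        (fun a _ c _ h => σ.symm.injective (Fin.ext h))
      have ht' : (σ.symm t : ℕ) / s = i := by simpa using ht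
      have h1 := Nat.div_add_mod (σ.symm t : ℕ) s
      have h2 := Nat.mod_lt (σ.symm t : ℕ) hs
      rw [ht', mul_comm] at h1
      simp only [Finset.coe_Ico, Set.mem_Ico]
      omega
    simpa using this
  · have ht1 : i * s + s ≤ (σ.symm t : ℕ) := by
      have h1 := Nat.div_add_mod (σ.symm t : ℕ) s
      simp only at hti
      rw [hti, mul_add, mul_one, mul_comm] at h1
      omega
    have hlt : ∀ k : Fin s, i * s + k < n := fun k => by
      have := (σ.symm t).2
      have := k.2
      omega
    have hcard : s ≤ (Finset.univ.filter fun t => (σ.symm t : ℕ) / s = i).card := by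
      conv_lhs => rw [← Fintype.card_fin s, ← Finset.card_univ]
      refine Finset.card_le_card_of_injOn (fun k => σ ⟨i * s + k, hlt k⟩) (fun k _ => ?_)
        (fun a _ c _ h => ?_)
      · simp only [Finset.coe_filter, Finset.mem_univ, true_and, Set.mem_ofPred_eq,
          Equiv.symm_apply_apply]
        rw [mul_comm, Nat.mul_add_div hs, Nat.div_eq_of_lt k.2, add_zero]
      · have := congrArg Fin.val (σ.injective h)
        simp only [add_right_inj] at this
        exact Fin.ext this
    calc (s : ℝ) * x t ^ 2
        ≤ (Finset.univ.filter fun t => (σ.symm t : ℕ) / s = i).card * x t ^ 2 := by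
          gcongr
      _ = ∑ t' ∈ Finset.univ.filter (fun t' => (σ.symm t' : ℕ) / s = i), x t ^ 2 := by simp
      _ ≤ _ := by
          refine Finset.sum_le_sum fun t' ht' => ?_
          have ht'' : (σ.symm t' : ℕ) / s = i := by simpa using ht'
          have hle : σ.symm t' ≤ σ.symm t := by
            have h1 := Nat.div_add_mod (σ.symm t' : ℕ) s
            have h2 := Nat.mod_lt (σ.symm t' : ℕ) hs
            rw [ht'', mul_comm] at h1
            exact Fin.le_def.2 (by omega)
          have := hmono hle
          simp only [Function.comp, Equiv.apply_symm_apply, hf] at this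
          linarith

/-- A vector restricted to the coordinates in block `i`. -/
def blockPart {n : ℕ} (b : Fin n → ℕ) (i : ℕ) (x : Fin n → ℝ) : Fin n → ℝ :=
  fun t => if b t = i then x t else 0

lemma sum_blockPart {n : ℕ} {b : Fin n → ℕ} (hb : ∀ t, b t ≤ n) (x : Fin n → ℝ) :
    ∑ i ∈ Finset.range (n + 1), blockPart b i x = x := by
  ext t
  simp only [Finset.sum_apply, blockPart]
  rw [Finset.sum_ite_eq, if_pos (Finset.mem_range.2 (Nat.lt_succ_of_le (hb t)))]

lemma norm2_blockPart_sq {n : ℕ} (b : Fin n → ℕ) (i : ℕ) (x : Fin n → ℝ) :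
    norm2 (blockPart b i x) ^ 2 = ∑ t ∈ Finset.univ.filter (fun t => b t = i), x t ^ 2 := by
  rw [norm2_sq, Finset.sum_filter]
  refine Finset.sum_congr rfl fun t _ => ?_
  unfold blockPart
  split_ifs <;> simp

lemma sum_norm2_blockPart_sq {n : ℕ} {b : Fin n → ℕ} (hb : ∀ t, b t ≤ n) (x : Fin n → ℝ) :
    ∑ i ∈ Finset.range (n + 1), norm2 (blockPart b i x) ^ 2 = norm2 x ^ 2 := by
  simp only [norm2_blockPart_sq]
  rw [norm2_sq]
  exact Finset.sum_fiberwise_of_maps_to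
    (fun t _ => Finset.mem_range.2 (Nat.lt_succ_of_le (hb t))) _

lemma isSparse_blockPart {n s : ℕ} {b : Fin n → ℕ}
    (hb : ∀ i, (Finset.univ.filter fun t => b t = i).card ≤ s) (i : ℕ) (x : Fin n → ℝ) :
    IsSparse s (blockPart b i x) :=
  IsSparse.of_support _ (hb i) fun t ht => by
    simp only [Finset.mem_filter, Finset.mem_univ, true_and] at ht
    simp [blockPart, ht]

/-- The part of a vector outside block `0`. -/
def tailPart {n : ℕ} (b : Fin n → ℕ) (x : Fin n → ℝ) : Fin n → ℝ :=
  fun t => if b t = 0 then 0 else x t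

lemma abs_tailPart_le {n : ℕ} (b : Fin n → ℕ) (x : Fin n → ℝ) (t : Fin n) :
    tailPart b x t ^ 2 ≤ x t ^ 2 := by
  unfold tailPart
  split_ifs
  · simpa using sq_nonneg (x t)
  · exact le_rfl

lemma sum_norm2_blockPart_tail_le {n s : ℕ} (hs : 0 < s) {x : Fin n → ℝ} {b : Fin n → ℕ}
    (hbn : ∀ t, b t ≤ n)
    (hb : ∀ t i, b t = i + 1 →
      s * x t ^ 2 ≤ ∑ t' ∈ Finset.univ.filter (fun t' => b t' = i), x t' ^ 2)
    (w : Fin n → ℝ) :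
    ∑ i ∈ Finset.range (n + 1), norm2 (blockPart b i (tailPart b x * w)) ≤
      norm2 x / Real.sqrt s * norm2 w := by
  have hs' : (0 : ℝ) < s := Nat.cast_pos.2 hs
  have h0 : norm2 (blockPart b 0 (tailPart b x * w)) = 0 := by
    rw [norm2_eq_zero]
    ext t
    simp only [blockPart, tailPart, Pi.mul_apply, Pi.zero_apply]
    split_ifs <;> simp
  have h1 : ∀ i, norm2 (blockPart b (i + 1) (tailPart b x * w)) ≤
      norm2 (blockPart b i x) / Real.sqrt s * norm2 (blockPart b (i + 1) w) := by
    intro i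
    refine norm2_le_of_sq_le
      (mul_nonneg (div_nonneg (norm2_nonneg _) (Real.sqrt_nonneg _)) (norm2_nonneg _)) ?_
    rw [← norm2_sq, norm2_blockPart_sq, mul_pow, div_pow, Real.sq_sqrt hs'.le,
      norm2_blockPart_sq b (i + 1) w, Finset.mul_sum]
    refine Finset.sum_le_sum fun t ht => ?_
    have hbt : b t = i + 1 := by simpa using ht
    rw [Pi.mul_apply, mul_pow]
    gcongr
    refine (abs_tailPart_le b x t).trans ?_
    rw [le_div_iff₀ hs', norm2_blockPart_sq, mul_comm]
    exact hb t i hbt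
  rw [Finset.sum_range_succ', h0, add_zero]
  have hx : ∑ i ∈ Finset.range n, norm2 (blockPart b i x) ^ 2 ≤ norm2 x ^ 2 := by
    rw [← sum_norm2_blockPart_sq hbn x]
    exact Finset.sum_le_sum_of_subset_of_nonneg (Finset.range_mono (Nat.le_succ n))
      fun _ _ _ => sq_nonneg _
  have hw : ∑ i ∈ Finset.range n, norm2 (blockPart b (i + 1) w) ^ 2 ≤ norm2 w ^ 2 := by
    rw [← sum_norm2_blockPart_sq hbn w, Finset.sum_range_succ']
    exact le_add_of_nonneg_right (sq_nonneg _)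
  have hcs := Finset.sum_mul_sq_le_sq_mul_sq (Finset.range n)
    (fun i => norm2 (blockPart b i x)) (fun i => norm2 (blockPart b (i + 1) w))
  have hcs2 : ∑ i ∈ Finset.range n, norm2 (blockPart b i x) * norm2 (blockPart b (i + 1) w) ≤
      norm2 x * norm2 w := by
    have h5 := hcs.trans (mul_le_mul hx hw (Finset.sum_nonneg fun _ _ => sq_nonneg _)
      (sq_nonneg _))
    rw [← mul_pow] at h5
    exact (abs_le_of_sq_le_sq' h5 (mul_nonneg (norm2_nonneg _) (norm2_nonneg _))).2
  calc _ ≤ ∑ i ∈ Finset.range n,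
        norm2 (blockPart b i x) / Real.sqrt s * norm2 (blockPart b (i + 1) w) :=
        Finset.sum_le_sum fun i _ => h1 i
    _ = (∑ i ∈ Finset.range n, norm2 (blockPart b i x) * norm2 (blockPart b (i + 1) w)) /
          Real.sqrt s := by
        rw [Finset.sum_div]
        exact Finset.sum_congr rfl fun i _ => by ring
    _ ≤ norm2 x * norm2 w / Real.sqrt s := by gcongr
    _ = _ := by ring

lemma norm2_le_of_forall_dotProduct_le {n : ℕ} {z : Fin n → ℝ} {c : ℝ} (hc : 0 ≤ c)
    (h : ∀ w, z ⬝ᵥ w ≤ c * norm2 w) : norm2 z ≤ c := by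
  have h1 := h z
  rw [dotProduct_self_eq_norm2_sq, sq] at h1
  rcases (norm2_nonneg z).eq_or_lt with h0 | h0
  · rw [← h0]; exact hc
  · exact le_of_mul_le_mul_right h1 h0

lemma mulVec_dotProduct_symm {n : ℕ} {N : Matrix (Fin n) (Fin n) ℝ} (hN : Nᵀ = N)
    (x y : Fin n → ℝ) : x ⬝ᵥ N *ᵥ y = y ⬝ᵥ N *ᵥ x := by
  rw [Matrix.dotProduct_mulVec, ← Matrix.mulVec_transpose, hN, dotProduct_comm]

/-- If a symmetric matrix is small on pairs of `s`-sparse vectors, then after randomizing the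
signs of a fixed vector its quadratic form is small with high probability. -/
lemma unifProb_signed_quadratic_le {n s : ℕ} (hs : 0 < s) {N : Matrix (Fin n) (Fin n) ℝ}
    (hsymm : Nᵀ = N) {η : ℝ} (hη : 0 < η)
    (hN : ∀ x y, IsSparse s x → IsSparse s y → |x ⬝ᵥ N *ᵥ y| ≤ η * norm2 x * norm2 y)
    (x : Fin n → ℝ) :
    unifProb (fun ε : Fin n → Bool => 13 * (η * norm2 x ^ 2) <
      |(fun t => rsign (ε t) * x t) ⬝ᵥ N *ᵥ (fun t => rsign (ε t) * x t)|) ≤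
      4 * Real.exp (-(s : ℝ) / 2) := by
  by_cases hx0 : x = 0
  · subst hx0
    refine (unifProb_mono (Q := fun _ => False) fun ε hε => ?_).trans ?_
    · have : (fun t => rsign (ε t) * (0 : Fin n → ℝ) t) = 0 := by ext; simp
      rw [this] at hε
      simp [norm2_zero] at hε
    · have h0 : unifProb (fun _ : Fin n → Bool => False) = 0 := by simp [unifProb]
      rw [h0]
      positivity
  have hxp := norm2_pos hx0
  have hs' : (0 : ℝ) < s := Nat.cast_pos.2 hs
  obtain ⟨b, hbn, hbs, hb⟩ := exists_block_map x hs
  set xs := tailPart b x with hxs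
  set h := η * norm2 x ^ 2 with hh
  have hhp : 0 < h := by positivity
  have htail := sum_norm2_blockPart_tail_le hs hbn hb
  have hdouble : ∀ y w, |(xs * y) ⬝ᵥ N *ᵥ (xs * w)| ≤ h / s * norm2 y * norm2 w := by
    intro y w
    calc |(xs * y) ⬝ᵥ N *ᵥ (xs * w)|
        = |∑ i ∈ Finset.range (n + 1), ∑ j ∈ Finset.range (n + 1),
            blockPart b i (xs * y) ⬝ᵥ N *ᵥ blockPart b j (xs * w)| := by
          conv_lhs => rw [← sum_blockPart hbn (xs * y), ← sum_blockPart hbn (xs * w)]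
          simp only [sum_dotProduct, Matrix.mulVec_sum, dotProduct_sum]
          rw [Finset.sum_comm]
      _ ≤ ∑ i ∈ Finset.range (n + 1), ∑ j ∈ Finset.range (n + 1),
            |blockPart b i (xs * y) ⬝ᵥ N *ᵥ blockPart b j (xs * w)| :=
          (Finset.abs_sum_le_sum_abs _ _).trans
            (Finset.sum_le_sum fun i _ => Finset.abs_sum_le_sum_abs _ _)
      _ ≤ ∑ i ∈ Finset.range (n + 1), ∑ j ∈ Finset.range (n + 1),
            η * norm2 (blockPart b i (xs * y)) * norm2 (blockPart b j (xs * w)) :=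
          Finset.sum_le_sum fun i _ => Finset.sum_le_sum fun j _ =>
            hN _ _ (isSparse_blockPart hbs _ _) (isSparse_blockPart hbs _ _)
      _ = η * ((∑ i ∈ Finset.range (n + 1), norm2 (blockPart b i (xs * y))) *
            ∑ j ∈ Finset.range (n + 1), norm2 (blockPart b j (xs * w))) := by
          rw [Finset.sum_mul_sum, Finset.mul_sum]
          refine Finset.sum_congr rfl fun i _ => ?_
          rw [Finset.mul_sum]
          exact Finset.sum_congr rfl fun j _ => by ring
      _ ≤ η * ((norm2 x / Real.sqrt s * norm2 y) * (norm2 x / Real.sqrt s * norm2 w)) := by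
          have h1 := htail y
          have h2 := htail w
          have := norm2_nonneg y
          gcongr
          exact Finset.sum_nonneg fun _ _ => norm2_nonneg _
      _ = h / s * norm2 y * norm2 w := by
          rw [hh]
          field_simp
          rw [Real.sq_sqrt hs'.le]
          ring
  have hsingle : ∀ z, IsSparse s z →
      norm2 (xs * (N *ᵥ z)) ≤ η * norm2 z * (norm2 x / Real.sqrt s) := by
    intro z hz
    have hc : 0 ≤ η * norm2 z * (norm2 x / Real.sqrt s) := by
      have := norm2_nonneg z
      positivity
    refine norm2_le_of_forall_dotProduct_le hc fun w => ?_
    have e : (xs * (N *ᵥ z)) ⬝ᵥ w = ∑ i ∈ Finset.range (n + 1),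
        blockPart b i (xs * w) ⬝ᵥ N *ᵥ z := by
      rw [← sum_dotProduct, sum_blockPart hbn]
      simp only [dotProduct, Pi.mul_apply]
      exact Finset.sum_congr rfl fun t _ => by ring
    rw [e]
    calc _ ≤ ∑ i ∈ Finset.range (n + 1), η * norm2 (blockPart b i (xs * w)) * norm2 z :=
          Finset.sum_le_sum fun i _ => (le_abs_self _).trans
            (hN _ _ (isSparse_blockPart hbs _ _) hz)
      _ = η * norm2 z * ∑ i ∈ Finset.range (n + 1), norm2 (blockPart b i (xs * w)) := by
          rw [Finset.mul_sum]
          exact Finset.sum_congr rfl fun i _ => by ring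
      _ ≤ η * norm2 z * (norm2 x / Real.sqrt s * norm2 w) := by
          have := norm2_nonneg z
          gcongr
          exact htail w
      _ = _ := by ring
  set A : Fin n → Fin n → ℝ := fun i j => xs i * N i j * xs j with hA
  have hsp1 : ∀ t : Fin n, IsSparse s (Pi.single t (1 : ℝ)) := fun t =>
    IsSparse.of_support {t} (by rw [Finset.card_singleton]; exact hs) fun t' ht' => by
      simp only [Finset.mem_singleton] at ht'
      simp [ht']
  have hn1 : ∀ t : Fin n, norm2 (Pi.single t (1 : ℝ)) = 1 := fun t => by
    simp [norm2, Pi.single_apply]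
  have hxs2 : ∑ t, xs t ^ 2 ≤ norm2 x ^ 2 := by
    rw [norm2_sq]
    exact Finset.sum_le_sum fun t _ => abs_tailPart_le b x t
  have hop : ∀ y : Fin n → ℝ, ∑ i, (∑ j, A i j * y j) ^ 2 ≤ (h / s) ^ 2 * ∑ j, y j ^ 2 := by
    intro y
    rw [← norm2_sq y, ← norm2_sq (fun i => ∑ j, A i j * y j), ← mul_pow]
    refine pow_le_pow_left₀ (norm2_nonneg _) ?_ 2
    have hc : 0 ≤ h / s * norm2 y := mul_nonneg (by positivity) (norm2_nonneg y)
    refine norm2_le_of_forall_dotProduct_le hc fun w => ?_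
    have e : (fun i => ∑ j, A i j * y j) ⬝ᵥ w = (xs * w) ⬝ᵥ N *ᵥ (xs * y) := by
      simp only [dotProduct, Matrix.mulVec, Pi.mul_apply, hA]
      refine Finset.sum_congr rfl fun i _ => ?_
      rw [Finset.sum_mul, Finset.mul_sum]
      exact Finset.sum_congr rfl fun j _ => by ring
    rw [e]
    refine (le_abs_self _).trans ((hdouble w y).trans (le_of_eq (by ring)))
  have hF : ∑ i, ∑ j, A i j ^ 2 ≤ h ^ 2 / s := by
    rw [Finset.sum_comm]
    calc ∑ j, ∑ i, A i j ^ 2 = ∑ j, xs j ^ 2 * norm2 (xs * (N *ᵥ Pi.single j 1)) ^ 2 := by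
          refine Finset.sum_congr rfl fun j _ => ?_
          rw [norm2_sq, Finset.mul_sum]
          refine Finset.sum_congr rfl fun i _ => ?_
          simp [hA]
          ring
      _ ≤ ∑ j, xs j ^ 2 * (η * 1 * (norm2 x / Real.sqrt s)) ^ 2 := by
          gcongr with j
          · exact norm2_nonneg _
          · have := hsingle _ (hsp1 j)
            rwa [hn1] at this
      _ = (∑ j, xs j ^ 2) * (η ^ 2 * norm2 x ^ 2 / s) := by
          rw [Finset.sum_mul]
          refine Finset.sum_congr rfl fun j _ => ?_
          rw [mul_pow, div_pow, Real.sq_sqrt hs'.le]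
          ring
      _ ≤ norm2 x ^ 2 * (η ^ 2 * norm2 x ^ 2 / s) := by gcongr
      _ = h ^ 2 / s := by rw [hh]; ring
  have htr : |∑ i, A i i| ≤ h := by
    calc |∑ i, A i i| ≤ ∑ i, |A i i| := Finset.abs_sum_le_sum_abs _ _
      _ ≤ ∑ i, xs i ^ 2 * η := by
          refine Finset.sum_le_sum fun i _ => ?_
          have := hN _ _ (hsp1 i) (hsp1 i)
          rw [hn1] at this
          simp at this
          have e : A i i = xs i ^ 2 * N i i := by simp only [hA]; ring
          rw [e, abs_mul, abs_of_nonneg (sq_nonneg _)]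
          gcongr
      _ ≤ h := by
          rw [← Finset.sum_mul, hh, mul_comm]
          gcongr
  -- the three pieces
  have hpos := unifProb_chaos_gt_le A hhp hs' hop hF
  have hneg := unifProb_chaos_gt_le (fun i j => -A i j) hhp hs'
    (by simpa [Finset.sum_neg_distrib] using hop) (by simpa using hF)
  have hcross : unifProb (fun ε : Fin n → Bool => h <
      |∑ t, rsign (ε t) * (xs * (N *ᵥ blockPart b 0 (fun t => rsign (ε t) * x t))) t|) ≤
      2 * Real.exp (-(s : ℝ) / 2) := by
    refine unifProb_mixSigns_le (fun t => decide (b t = 0)) fun ε => ?_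
    set z := blockPart b 0 (fun t => rsign (ε t) * x t) with hz
    have hzx : norm2 z ≤ norm2 x := by
      refine norm2_le_of_sq_le (norm2_nonneg _) ?_
      rw [norm2_sq]
      refine Finset.sum_le_sum fun t _ => ?_
      simp only [hz, blockPart]
      split_ifs
      · rw [mul_pow, rsign_sq, one_mul]
      · simpa using sq_nonneg (x t)
    have hσ : 0 < h / Real.sqrt s := by positivity
    have hvar : ∑ t, (xs * (N *ᵥ z)) t ^ 2 ≤ (h / Real.sqrt s) ^ 2 := by
      rw [← norm2_sq]
      refine pow_le_pow_left₀ (norm2_nonneg _) ((hsingle z (isSparse_blockPart hbs _ _)).trans ?_) 2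
      calc η * norm2 z * (norm2 x / Real.sqrt s) ≤ η * norm2 x * (norm2 x / Real.sqrt s) := by
            gcongr
        _ = h / Real.sqrt s := by rw [hh]; ring
    have hH := unifProb_abs_rademacher_gt_le (xs * (N *ᵥ z)) hσ hvar (Real.sqrt_nonneg s)
    rw [Real.sq_sqrt hs'.le] at hH
    refine (unifProb_mono fun ε' hε' => ?_).trans hH
    have e1 : blockPart b 0
        (fun t => rsign (mixSigns (fun t => decide (b t = 0)) ε ε' t) * x t) = z := by
      ext t
      by_cases hbt : b t = 0 <;> simp [hz, blockPart, mixSigns, hbt]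
    rw [e1] at hε'
    have e2 : ∀ t, rsign (mixSigns (fun t => decide (b t = 0)) ε ε' t) * (xs * (N *ᵥ z)) t =
        (xs * (N *ᵥ z)) t * rsign (ε' t) := by
      intro t
      by_cases hbt : b t = 0 <;> simp [hxs, tailPart, mixSigns, hbt]
      ring
    simp only [e2] at hε'
    have e3 : Real.sqrt s * (h / Real.sqrt s) = h := by field_simp
    rwa [e3]
  refine (unifProb_mono (Q := fun ε => (9 * h < ∑ i, ∑ j, A i j * (rsign (ε i) * rsign (ε j)) -
      ∑ i, A i i ∨ 9 * h < ∑ i, ∑ j, -A i j * (rsign (ε i) * rsign (ε j)) - ∑ i, -A i i) ∨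
      h < |∑ t, rsign (ε t) * (xs * (N *ᵥ blockPart b 0 (fun t => rsign (ε t) * x t))) t|)
      fun ε hε => ?_).trans ?_
  · by_contra hcon
    push Not at hcon
    obtain ⟨⟨hc1, hc2⟩, hc3⟩ := hcon
    set z := fun t => rsign (ε t) * x t with hz
    set z0 := blockPart b 0 z with hz0
    set r : Fin n → ℝ := fun t => rsign (ε t) with hr
    have hzdec : z = z0 + xs * r := by
      ext t
      simp only [hz, hz0, hxs, hr, blockPart, tailPart, Pi.add_apply, Pi.mul_apply]
      split_ifs
      · simp
      · ring
    have hz0x : norm2 z0 ^ 2 ≤ norm2 x ^ 2 := by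
      rw [norm2_sq, norm2_sq]
      refine Finset.sum_le_sum fun t _ => ?_
      simp only [hz0, hz, blockPart]
      split_ifs
      · rw [mul_pow, rsign_sq, one_mul]
      · simpa using sq_nonneg (x t)
    have hq0 : |z0 ⬝ᵥ N *ᵥ z0| ≤ h := by
      refine (hN _ _ (isSparse_blockPart hbs _ _) (isSparse_blockPart hbs _ _)).trans ?_
      rw [hh, mul_assoc, ← sq]
      gcongr
    have hqA : (xs * r) ⬝ᵥ N *ᵥ (xs * r) = ∑ i, ∑ j, A i j * (rsign (ε i) * rsign (ε j)) := by
      simp only [dotProduct, Matrix.mulVec, Pi.mul_apply, hA, hr]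
      refine Finset.sum_congr rfl fun i _ => ?_
      rw [Finset.mul_sum]
      exact Finset.sum_congr rfl fun j _ => by ring
    have hqc : (xs * r) ⬝ᵥ N *ᵥ z0 = ∑ t, rsign (ε t) * (xs * (N *ᵥ z0)) t := by
      simp only [dotProduct, Pi.mul_apply, hr]
      exact Finset.sum_congr rfl fun t _ => by ring
    have hqc2 : |(xs * r) ⬝ᵥ N *ᵥ z0| ≤ h := by
      rw [hqc]
      exact hc3
    have htot : z ⬝ᵥ N *ᵥ z = z0 ⬝ᵥ N *ᵥ z0 + 2 * ((xs * r) ⬝ᵥ N *ᵥ z0) +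
        (xs * r) ⬝ᵥ N *ᵥ (xs * r) := by
      rw [hzdec, Matrix.mulVec_add, dotProduct_add, add_dotProduct, add_dotProduct,
        mulVec_dotProduct_symm hsymm z0 (xs * r)]
      ring
    simp only [neg_mul, Finset.sum_neg_distrib] at hc2
    rw [← hqA] at hc1 hc2
    rw [abs_le] at hq0 hqc2 htr
    have : |z ⬝ᵥ N *ᵥ z| ≤ 13 * h := by
      rw [htot, abs_le]
      constructor <;> linarith
    linarith
  · refine (unifProb_or_le _ _).trans ?_
    have := unifProb_or_le (Ω := Fin n → Bool)
      (fun ε => 9 * h < ∑ i, ∑ j, A i j * (rsign (ε i) * rsign (ε j)) - ∑ i, A i i)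
      (fun ε => 9 * h < ∑ i, ∑ j, -A i j * (rsign (ε i) * rsign (ε j)) - ∑ i, -A i i)
    linarith

/-! ### Maurey's empirical method -/

/-- The vectors `± e_t`. -/
def signedBasis {n : ℕ} (c : Fin n × Bool) : Fin n → ℝ := Pi.single c.1 (rsign c.2)

lemma dotProduct_signedBasis {n : ℕ} (u : Fin n → ℝ) (c : Fin n × Bool) :
    u ⬝ᵥ signedBasis c = u c.1 * rsign c.2 := by
  simp [signedBasis]

/-- Every point of the unit `ℓ¹` ball is a convex combination of signed basis vectors. -/
lemma exists_weights_signedBasis {n : ℕ} (hn : 0 < n) {x : Fin n → ℝ} (hx : norm1 x ≤ 1) :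
    ∃ w : Fin n × Bool → ℝ, (∀ c, 0 ≤ w c) ∧ ∑ c, w c = 1 ∧
      ∀ u : Fin n → ℝ, ∑ c, w c * (u ⬝ᵥ signedBasis c) = u ⬝ᵥ x := by
  have hn' : (0 : ℝ) < n := Nat.cast_pos.2 hn
  refine ⟨fun c => (|x c.1| + rsign c.2 * x c.1) / 2 + (1 - norm1 x) / (2 * n), fun c => ?_, ?_,
    fun u => ?_⟩
  · have h1 : -(rsign c.2 * x c.1) ≤ |x c.1| := by
      refine (neg_le_abs _).trans ?_
      rw [abs_mul, abs_rsign, one_mul]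
    have h2 : 0 ≤ (1 - norm1 x) / (2 * n) := div_nonneg (by linarith) (by linarith)
    linarith
  · rw [Fintype.sum_prod_type]
    have : ∀ t : Fin n, ∑ b : Bool, ((|x t| + rsign b * x t) / 2 + (1 - norm1 x) / (2 * n)) =
        |x t| + (1 - norm1 x) / n := by
      intro t
      simp [rsign]
      field_simp
      ring
    simp only [this, Finset.sum_add_distrib]
    simp only [Finset.sum_const, Finset.card_univ, Fintype.card_fin, nsmul_eq_mul]
    rw [mul_div_cancel₀ _ hn'.ne']
    simp [norm1]
  · rw [Fintype.sum_prod_type]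
    refine Finset.sum_congr rfl fun t _ => ?_
    simp [dotProduct_signedBasis, rsign]
    ring

lemma sum_weighted_exp_le {ι : Type*} [Fintype ι] {w a : ι → ℝ} (hw : ∀ c, 0 ≤ w c)
    (hw1 : ∑ c, w c = 1) {τ : ℝ} (ha : ∀ c, |a c| ≤ τ) (hτ : τ ≤ 1) (hmean : ∑ c, w c * a c = 0) :
    ∑ c, w c * Real.exp (a c) ≤ Real.exp (τ ^ 2) := by
  calc ∑ c, w c * Real.exp (a c) ≤ ∑ c, w c * (1 + a c + τ ^ 2) := by
        refine Finset.sum_le_sum fun c _ => mul_le_mul_of_nonneg_left ?_ (hw c)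
        have h1 := Real.abs_exp_sub_one_sub_id_le ((ha c).trans hτ)
        have h2 : a c ^ 2 ≤ τ ^ 2 := sq_le_sq.2 ((ha c).trans (le_abs_self τ))
        have := (abs_le.1 h1).2
        linarith
    _ = (1 + τ ^ 2) * ∑ c, w c + ∑ c, w c * a c := by
        rw [Finset.mul_sum, ← Finset.sum_add_distrib]
        exact Finset.sum_congr rfl fun c _ => by ring
    _ = 1 + τ ^ 2 := by rw [hw1, hmean]; ring
    _ ≤ _ := by linarith [Real.add_one_le_exp (τ ^ 2)]

lemma exists_le_of_weighted_sum_le {ι : Type*} [Fintype ι] {w f : ι → ℝ} {B : ℝ}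
    (hw : ∀ c, 0 ≤ w c) (hw1 : ∑ c, w c = 1) (h : ∑ c, w c * f c ≤ B) : ∃ c, f c ≤ B := by
  by_contra hcon
  push Not at hcon
  have h1 : ∑ c, w c * (f c - B) ≤ 0 := by
    simp only [mul_sub, Finset.sum_sub_distrib, ← Finset.sum_mul, hw1]
    linarith
  have h2 : ∀ c ∈ Finset.univ, w c * (f c - B) = 0 := by
    refine (Finset.sum_eq_zero_iff_of_nonneg fun c _ =>
      mul_nonneg (hw c) (sub_nonneg.2 (hcon c).le)).1 (le_antisymm h1 ?_)
    exact Finset.sum_nonneg fun c _ => mul_nonneg (hw c) (sub_nonneg.2 (hcon c).le)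
  have h3 : ∑ c, w c = 0 := Finset.sum_eq_zero fun c hc =>
    (mul_eq_zero.1 (h2 c hc)).resolve_right (sub_pos.2 (hcon c)).ne'
  linarith

/-- Greedy selection of signed basis vectors whose average approximates `x`. -/
lemma exists_greedy_selection {n : ℕ} (hn : 0 < n) {U : Fin n → Fin n → ℝ}
    (hU : ∀ i j, |U i j| ≤ 1) {x : Fin n → ℝ} (hx : norm1 x ≤ 1) {θ : ℝ} (hθ0 : 0 ≤ θ)
    (hθ : 2 * θ ≤ 1) (m : ℕ) :
    ∃ f : Fin m → Fin n × Bool,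
      ∑ i, Real.cosh (θ * ∑ k, (U i ⬝ᵥ signedBasis (f k) - U i ⬝ᵥ x)) ≤
        n * Real.exp (4 * θ ^ 2 * m) := by
  induction m with
  | zero => exact ⟨Fin.elim0, by simp⟩
  | succ m ih =>
    obtain ⟨f, hf⟩ := ih
    obtain ⟨w, hw0, hw1, hw⟩ := exists_weights_signedBasis hn hx
    set Y : Fin n → ℝ := fun i => ∑ k, (U i ⬝ᵥ signedBasis (f k) - U i ⬝ᵥ x) with hY
    set a : Fin n → Fin n × Bool → ℝ := fun i c => U i ⬝ᵥ signedBasis c - U i ⬝ᵥ x with ha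
    have habs : ∀ i c, |a i c| ≤ 2 := by
      intro i c
      have h1 : |U i ⬝ᵥ signedBasis c| ≤ 1 := by
        rw [dotProduct_signedBasis, abs_mul, abs_rsign, mul_one]
        exact hU _ _
      have h2 := (abs_dotProduct_le_norm1 (hU i) x).trans hx
      have := abs_sub (U i ⬝ᵥ signedBasis c) (U i ⬝ᵥ x)
      simp only [ha]
      linarith
    have hmean : ∀ i, ∑ c, w c * a i c = 0 := by
      intro i
      simp only [ha, mul_sub, Finset.sum_sub_distrib, ← Finset.sum_mul, hw1, hw]
      ring
    have hexp : ∀ (κ : ℝ), |κ| = θ → ∀ i,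
        ∑ c, w c * Real.exp (κ * a i c) ≤ Real.exp ((2 * θ) ^ 2) := by
      intro κ hκ i
      refine sum_weighted_exp_le hw0 hw1 (fun c => ?_) hθ ?_
      · rw [abs_mul, hκ, mul_comm]
        exact mul_le_mul_of_nonneg_right (habs i c) hθ0
      · have : ∀ c, w c * (κ * a i c) = κ * (w c * a i c) := fun c => by ring
        simp only [this, ← Finset.mul_sum, hmean, mul_zero]
    have havg : ∑ c, w c * ∑ i, Real.cosh (θ * (Y i + a i c)) ≤
        n * Real.exp (4 * θ ^ 2 * (m + 1 : ℕ)) := by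
      calc ∑ c, w c * ∑ i, Real.cosh (θ * (Y i + a i c))
          = ∑ i, (Real.exp (θ * Y i) / 2 * ∑ c, w c * Real.exp (θ * a i c) +
              Real.exp (-(θ * Y i)) / 2 * ∑ c, w c * Real.exp (-θ * a i c)) := by
            simp only [Finset.mul_sum]
            rw [Finset.sum_comm]
            refine Finset.sum_congr rfl fun i _ => ?_
            rw [← Finset.sum_add_distrib]
            refine Finset.sum_congr rfl fun c _ => ?_
            rw [Real.cosh_eq, mul_add, neg_add, Real.exp_add, Real.exp_add, neg_mul]
            ring
        _ ≤ ∑ i, (Real.exp (θ * Y i) / 2 * Real.exp ((2 * θ) ^ 2) +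
              Real.exp (-(θ * Y i)) / 2 * Real.exp ((2 * θ) ^ 2)) := by
            gcongr with i
            · exact hexp θ (abs_of_nonneg hθ0) i
            · exact hexp (-θ) (by rw [abs_neg, abs_of_nonneg hθ0]) i
        _ = (∑ i, Real.cosh (θ * Y i)) * Real.exp ((2 * θ) ^ 2) := by
            rw [Finset.sum_mul]
            refine Finset.sum_congr rfl fun i _ => ?_
            rw [Real.cosh_eq]
            ring
        _ ≤ (n * Real.exp (4 * θ ^ 2 * m)) * Real.exp ((2 * θ) ^ 2) := by gcongr
        _ = _ := by
            rw [mul_assoc, ← Real.exp_add]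
            push_cast
            ring_nf
    obtain ⟨c, hc⟩ := exists_le_of_weighted_sum_le hw0 hw1 havg
    refine ⟨Fin.snoc (α := fun _ => Fin n × Bool) f c, ?_⟩
    refine le_trans (le_of_eq (Finset.sum_congr rfl fun i _ => ?_)) hc
    rw [Fin.sum_univ_castSucc]
    simp only [Fin.snoc_castSucc, Fin.snoc_last, hY, ha]

/-- Approximation of points of an `ℓ¹` ball by averages of `m` signed basis vectors. -/
lemma exists_maurey_approx {n : ℕ} (hn : 0 < n) {U : Fin n → Fin n → ℝ}
    (hU : ∀ i j, |U i j| ≤ 1) {ρ : ℝ} (hρ : 0 < ρ) {x : Fin n → ℝ} (hx : norm1 x ≤ ρ) {m : ℕ}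
    (hm : 0 < m) :
    ∃ f : Fin m → Fin n × Bool, ∀ i,
      |U i ⬝ᵥ (x - (ρ / m) • ∑ k, signedBasis (f k))| ≤
        4 * ρ * Real.sqrt (Real.log (2 * n)) / Real.sqrt m := by
  have hn' : (0 : ℝ) < n := Nat.cast_pos.2 hn
  have hm' : (0 : ℝ) < m := Nat.cast_pos.2 hm
  have hsm : 0 < Real.sqrt m := Real.sqrt_pos.2 hm'
  have hlog : 0 < Real.log (2 * n) := Real.log_pos (by
    have : (1 : ℝ) ≤ n := Nat.one_le_cast.2 hn
    linarith)
  set l := Real.sqrt (Real.log (2 * n)) with hl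
  have hl0 : 0 < l := Real.sqrt_pos.2 hlog
  have hl2 : l ^ 2 = Real.log (2 * n) := Real.sq_sqrt hlog.le
  set y : Fin n → ℝ := ρ⁻¹ • x with hy
  have hxy : x = ρ • y := by rw [hy, smul_smul, mul_inv_cancel₀ hρ.ne', one_smul]
  have hy1 : norm1 y ≤ 1 := by
    have : norm1 y = ρ⁻¹ * norm1 x := by
      simp [norm1, hy, abs_mul, Finset.mul_sum, abs_of_pos hρ]
    rw [this, inv_mul_le_iff₀ hρ, mul_one]
    exact hx
  have hrepr : ∀ (f : Fin m → Fin n × Bool) i, U i ⬝ᵥ (x - (ρ / m) • ∑ k, signedBasis (f k)) =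
      -(ρ / m * ∑ k, (U i ⬝ᵥ signedBasis (f k) - U i ⬝ᵥ y)) := by
    intro f i
    have hux : U i ⬝ᵥ x = ρ * (U i ⬝ᵥ y) := by
      rw [← smul_eq_mul, ← dotProduct_smul, ← hxy]
    rw [dotProduct_sub, dotProduct_smul, dotProduct_sum, hux, Finset.sum_sub_distrib]
    simp only [smul_eq_mul, Finset.sum_const, Finset.card_univ, Fintype.card_fin, nsmul_eq_mul]
    field_simp
    ring
  by_cases hlm : l ≤ Real.sqrt m
  · set θ := l / (2 * Real.sqrt m) with hθ
    have hθ0 : 0 < θ := by positivity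
    have hθ1 : 2 * θ ≤ 1 := by
      rw [hθ, ← mul_div_assoc, mul_div_mul_left _ _ two_ne_zero, div_le_one hsm]
      exact hlm
    obtain ⟨f, hf⟩ := exists_greedy_selection hn hU hy1 hθ0.le hθ1 m
    refine ⟨f, fun i => ?_⟩
    set S := ∑ k, (U i ⬝ᵥ signedBasis (f k) - U i ⬝ᵥ y) with hS
    have h1 : Real.cosh (θ * S) ≤ n * Real.exp (4 * θ ^ 2 * m) :=
      le_trans (Finset.single_le_sum
        (f := fun i => Real.cosh (θ * ∑ k, (U i ⬝ᵥ signedBasis (f k) - U i ⬝ᵥ y)))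
        (fun i _ => (Real.cosh_pos _).le) (Finset.mem_univ i)) hf
    have h2 : Real.exp |θ * S| ≤ 2 * Real.cosh (θ * S) := by
      rw [← Real.cosh_abs, Real.cosh_eq]
      linarith [Real.exp_pos (-|θ * S|)]
    have h3 : 4 * θ ^ 2 * m = l ^ 2 := by
      rw [hθ, div_pow, mul_pow, Real.sq_sqrt hm'.le]
      field_simp
      norm_num
    have h4 : Real.exp |θ * S| ≤ Real.exp (2 * l ^ 2) := by
      calc Real.exp |θ * S| ≤ 2 * n * Real.exp (l ^ 2) := by rw [h3] at h1; linarith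
        _ = Real.exp (2 * l ^ 2) := by
          rw [two_mul (l ^ 2), Real.exp_add, hl2, Real.exp_log (by positivity)]
    have h5 : θ * |S| ≤ 2 * l ^ 2 := by
      rw [← abs_of_pos hθ0, ← abs_mul]
      exact Real.exp_le_exp.1 h4
    have h6 : |S| ≤ 4 * l * Real.sqrt m := by
      rw [hθ, div_mul_eq_mul_div, div_le_iff₀ (by positivity)] at h5
      have : l * |S| ≤ l * (4 * l * Real.sqrt m) := by linarith
      exact le_of_mul_le_mul_left this hl0
    rw [hrepr, abs_neg, abs_mul, abs_of_pos (by positivity : 0 < ρ / m)]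
    calc ρ / m * |S| ≤ ρ / m * (4 * l * Real.sqrt m) := by gcongr
      _ = 4 * ρ * l / Real.sqrt m := by
        have : (m : ℝ) = Real.sqrt m * Real.sqrt m := (Real.mul_self_sqrt hm'.le).symm
        rw [div_mul_eq_mul_div, div_eq_div_iff hm'.ne' hsm.ne']
        linear_combination (-(4 * ρ * l)) * this
  · push Not at hlm
    obtain ⟨f⟩ : Nonempty (Fin m → Fin n × Bool) := ⟨fun _ => (⟨0, hn⟩, true)⟩
    refine ⟨f, fun i => ?_⟩
    rw [hrepr, abs_neg, abs_mul, abs_of_pos (by positivity : 0 < ρ / m)]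
    have h1 : |∑ k, (U i ⬝ᵥ signedBasis (f k) - U i ⬝ᵥ y)| ≤ m * 2 := by
      refine (Finset.abs_sum_le_sum_abs _ _).trans ?_
      refine (Finset.sum_le_sum (g := fun _ => (2 : ℝ)) fun k _ => ?_).trans (by simp)
      have h1 : |U i ⬝ᵥ signedBasis (f k)| ≤ 1 := by
        rw [dotProduct_signedBasis, abs_mul, abs_rsign, mul_one]
        exact hU _ _
      have h2 := (abs_dotProduct_le_norm1 (hU i) y).trans hy1
      have := abs_sub (U i ⬝ᵥ signedBasis (f k)) (U i ⬝ᵥ y)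
      linarith
    calc ρ / m * _ ≤ ρ / m * (m * 2) := by gcongr
      _ = 2 * ρ := by field_simp
      _ ≤ 4 * ρ * 1 := by linarith
      _ ≤ 4 * ρ * (l / Real.sqrt m) := by
          gcongr
          rw [le_div_iff₀ hsm]
          linarith
      _ = _ := by ring

/-- The intersection of the `ℓ¹` ball of radius `√s` with the Euclidean unit ball. -/
def sparseHull (n s : ℕ) : Set (Fin n → ℝ) := {x | norm1 x ≤ Real.sqrt s ∧ norm2 x ≤ 1}

/-- Nets of `sparseHull n s` in the norm `max_i |⟨U i, ·⟩|`, with points in `sparseHull n s`. -/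
lemma exists_net_sparseHull {n s : ℕ} (hn : 0 < n) (hs : 0 < s) {U : Fin n → Fin n → ℝ}
    (hU : ∀ i j, |U i j| ≤ 1) {m : ℕ} (hm : 0 < m) :
    ∃ (P : Finset (Fin n → ℝ)) (π : (Fin n → ℝ) → Fin n → ℝ), P.card ≤ (2 * n) ^ m ∧
      ∀ x ∈ sparseHull n s, π x ∈ P ∧ π x ∈ sparseHull n s ∧
        ∀ i, |U i ⬝ᵥ (x - π x)| ≤
          8 * Real.sqrt s * Real.sqrt (Real.log (2 * n)) / Real.sqrt m := by
  classical
  have hs' : 0 < Real.sqrt s := Real.sqrt_pos.2 (Nat.cast_pos.2 hs)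
  have : Nonempty (Fin m → Fin n × Bool) := ⟨fun _ => (⟨0, hn⟩, true)⟩
  choose! F hF using fun x (hx : x ∈ sparseHull n s) => exists_maurey_approx hn hU hs' hx.1 hm
  have hrep : ∀ f : Fin m → Fin n × Bool, ∃ z : Fin n → ℝ,
      (∃ x ∈ sparseHull n s, F x = f) → z ∈ sparseHull n s ∧ F z = f := by
    intro f
    by_cases h : ∃ x ∈ sparseHull n s, F x = f
    · obtain ⟨x, hx, hxf⟩ := h
      exact ⟨x, fun _ => ⟨hx, hxf⟩⟩
    · exact ⟨0, fun h' => absurd h' h⟩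
  choose R hR using hrep
  refine ⟨Finset.univ.image R, fun x => R (F x), ?_, fun x hx => ?_⟩
  · refine Finset.card_image_le.trans (le_of_eq ?_)
    simp [mul_comm]
  · obtain ⟨h1, h2⟩ := hR (F x) ⟨x, hx, rfl⟩
    refine ⟨Finset.mem_image_of_mem _ (Finset.mem_univ _), h1, fun i => ?_⟩
    have e : x - R (F x) = (x - (Real.sqrt s / m) • ∑ k, signedBasis (F x k)) -
        (R (F x) - (Real.sqrt s / m) • ∑ k, signedBasis (F (R (F x)) k)) := by
      rw [h2]
      abel
    rw [e, dotProduct_sub]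
    refine (abs_sub _ _).trans ?_
    have h3 := hF x hx i
    have h4 := hF _ h1 i
    calc _ ≤ _ := add_le_add h3 h4
      _ = _ := by ring

/-! ### The empirical quadratic form -/

/-- The deviation of the empirical second-moment form of `b` from the inner product. -/
def devBilin {n p : ℕ} (b : Fin p → Fin n → ℝ) (x y : Fin n → ℝ) : ℝ :=
  (∑ k, (b k ⬝ᵥ x) * (b k ⬝ᵥ y)) / p - x ⬝ᵥ y

section devBilin

variable {n p : ℕ} (b : Fin p → Fin n → ℝ)

lemma devBilin_comm (x y : Fin n → ℝ) : devBilin b x y = devBilin b y x := by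
  simp only [devBilin, dotProduct_comm x y, mul_comm]

lemma devBilin_add_left (x y z : Fin n → ℝ) :
    devBilin b (x + y) z = devBilin b x z + devBilin b y z := by
  simp only [devBilin, dotProduct_add, add_dotProduct, add_mul, Finset.sum_add_distrib]
  ring

lemma devBilin_smul_left (c : ℝ) (x z : Fin n → ℝ) :
    devBilin b (c • x) z = c * devBilin b x z := by
  simp only [devBilin, dotProduct_smul, smul_dotProduct, smul_eq_mul, mul_assoc,
    ← Finset.mul_sum]
  ring

lemma devBilin_add_right (x y z : Fin n → ℝ) :
    devBilin b x (y + z) = devBilin b x y + devBilin b x z := by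
  rw [devBilin_comm, devBilin_add_left, devBilin_comm b y, devBilin_comm b z]

lemma devBilin_smul_right (c : ℝ) (x z : Fin n → ℝ) :
    devBilin b x (c • z) = c * devBilin b x z := by
  rw [devBilin_comm, devBilin_smul_left, devBilin_comm]

lemma devBilin_sub_left (x y z : Fin n → ℝ) :
    devBilin b (x - y) z = devBilin b x z - devBilin b y z := by
  rw [sub_eq_add_neg, ← neg_one_smul ℝ y, devBilin_add_left, devBilin_smul_left]
  ring

lemma devBilin_sub_right (x y z : Fin n → ℝ) :
    devBilin b x (y - z) = devBilin b x y - devBilin b x z := by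
  rw [devBilin_comm, devBilin_sub_left, devBilin_comm b y, devBilin_comm b z]

lemma devBilin_sub_add (x z : Fin n → ℝ) :
    devBilin b (x - z) (x + z) = devBilin b x x - devBilin b z z := by
  rw [devBilin_sub_left, devBilin_add_right, devBilin_add_right, devBilin_comm b z x]
  ring

lemma norm2_add_sq_add_norm2_sub_sq (x y : Fin n → ℝ) :
    norm2 (x + y) ^ 2 + norm2 (x - y) ^ 2 = 2 * norm2 x ^ 2 + 2 * norm2 y ^ 2 := by
  simp only [norm2_sq, Finset.mul_sum, ← Finset.sum_add_distrib, Pi.add_apply, Pi.sub_apply]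
  exact Finset.sum_congr rfl fun j _ => by ring

lemma norm2_inv_smul {x : Fin n → ℝ} (hx : x ≠ 0) : norm2 ((norm2 x)⁻¹ • x) = 1 := by
  rw [norm2_smul, abs_of_nonneg (inv_nonneg.2 (norm2_nonneg x)),
    inv_mul_cancel₀ (norm2_pos hx).ne']

/-- Polarization on a set of vectors stable under sums and differences of unit vectors. -/
lemma abs_devBilin_le_of_diag {c : ℝ} {x y : Fin n → ℝ}
    (h : ∀ s t : ℝ, |devBilin b (s • x + t • y) (s • x + t • y)| ≤ c * norm2 (s • x + t • y) ^ 2) :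
    |devBilin b x y| ≤ c * norm2 x * norm2 y := by
  rcases eq_or_ne x 0 with rfl | hx
  · simp [devBilin, norm2_zero]
  rcases eq_or_ne y 0 with rfl | hy
  · simp [devBilin, norm2_zero]
  set u := (norm2 x)⁻¹ • x with hu
  set v := (norm2 y)⁻¹ • y with hv
  have h1 := h (norm2 x)⁻¹ (norm2 y)⁻¹
  have h2 := h (norm2 x)⁻¹ (-(norm2 y)⁻¹)
  rw [neg_smul, ← sub_eq_add_neg] at h2
  rw [← hu, ← hv] at h1 h2
  have h3 : 4 * devBilin b u v = devBilin b (u + v) (u + v) - devBilin b (u - v) (u - v) := by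
    simp only [devBilin_add_left, devBilin_add_right, devBilin_sub_left, devBilin_sub_right,
      devBilin_comm b v u]
    ring
  have h4 := norm2_add_sq_add_norm2_sub_sq u v
  rw [hu, hv, norm2_inv_smul hx, norm2_inv_smul hy, ← hu, ← hv] at h4
  have h5 : |devBilin b u v| ≤ c := by
    have := abs_sub (devBilin b (u + v) (u + v)) (devBilin b (u - v) (u - v))
    rw [← h3, abs_mul, abs_of_pos (by norm_num : (0 : ℝ) < 4)] at this
    have h7 : c * norm2 (u + v) ^ 2 + c * norm2 (u - v) ^ 2 = c * 4 := by
      rw [← mul_add, h4]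
      norm_num
    linarith
  have h6 : devBilin b x y = norm2 x * norm2 y * devBilin b u v := by
    rw [hu, hv, devBilin_smul_left, devBilin_smul_right]
    have := (norm2_pos hx).ne'
    have := (norm2_pos hy).ne'
    field_simp
  rw [h6, abs_mul, abs_of_nonneg (mul_nonneg (norm2_nonneg x) (norm2_nonneg y)), mul_comm,
    mul_assoc]
  exact mul_le_mul_of_nonneg_right h5 (mul_nonneg (norm2_nonneg x) (norm2_nonneg y))

lemma norm1_le_sqrt_mul_norm2 (x : Fin n → ℝ) : norm1 x ≤ Real.sqrt n * norm2 x := by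
  have h := Finset.sum_mul_sq_le_sq_mul_sq Finset.univ (fun j => |x j|) (fun _ => (1 : ℝ))
  simp only [mul_one, sq_abs, one_pow, Finset.sum_const, Finset.card_univ, Fintype.card_fin,
    nsmul_eq_mul] at h
  rw [← norm2_sq] at h
  refine abs_le_of_sq_le_sq' ?_ (by positivity [norm2_nonneg x]) |>.2
  rw [mul_pow, Real.sq_sqrt (Nat.cast_nonneg n), norm1]
  linarith

lemma norm1_smul (c : ℝ) (x : Fin n → ℝ) : norm1 (c • x) = |c| * norm1 x := by
  simp [norm1, abs_mul, Finset.mul_sum]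

/-- The quadratic form on `sparseHull n s` is controlled by its values on a fine enough net. -/
lemma abs_devBilin_le_two_mul_of_net {s : ℕ} (hn : 0 < n) (hs : 0 < s) {A B : ℝ}
    (hbdd : ∀ x ∈ sparseHull n s, |devBilin b x x| ≤ A)
    (hnet : ∀ x ∈ sparseHull n s, ∃ z ∈ sparseHull n s,
      norm2 (x - z) ≤ 1 / (4 * n) ∧ |devBilin b z z| ≤ B) :
    ∀ x ∈ sparseHull n s, |devBilin b x x| ≤ 2 * B := by
  have hn' : (0 : ℝ) < n := Nat.cast_pos.2 hn
  have hs' : (1 : ℝ) ≤ Real.sqrt s := Real.one_le_sqrt.2 (Nat.one_le_cast.2 hs)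
  set S := sSup ((fun x => |devBilin b x x|) '' sparseHull n s) with hS
  have hB : BddAbove ((fun x => |devBilin b x x|) '' sparseHull n s) := by
    refine ⟨A, ?_⟩
    rintro _ ⟨x, hx, rfl⟩
    exact hbdd x hx
  have hle : ∀ x ∈ sparseHull n s, |devBilin b x x| ≤ S := fun x hx =>
    le_csSup hB ⟨x, hx, rfl⟩
  have h0mem : (0 : Fin n → ℝ) ∈ sparseHull n s := by
    simp [sparseHull, norm1, norm2]
  have hS0 : 0 ≤ S := (abs_nonneg _).trans (hle 0 h0mem)
  have hdiag : ∀ y : Fin n → ℝ, |devBilin b y y| ≤ n * S * norm2 y ^ 2 := by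
    intro y
    rcases eq_or_ne y 0 with rfl | hy
    · simp [devBilin, norm2_zero]
    have hy0 := norm2_pos hy
    set c := (Real.sqrt n * norm2 y)⁻¹ with hc
    have hsn : 0 < Real.sqrt n := Real.sqrt_pos.2 hn'
    have hc0 : 0 < c := by positivity
    have hmem : c • y ∈ sparseHull n s := by
      constructor
      · refine le_trans ?_ hs'
        rw [norm1_smul, abs_of_pos hc0, hc, inv_mul_le_iff₀ (by positivity), mul_one]
        exact norm1_le_sqrt_mul_norm2 y
      · rw [norm2_smul, abs_of_pos hc0, hc, inv_mul_le_iff₀ (by positivity), mul_one]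
        have : 1 ≤ Real.sqrt n := Real.one_le_sqrt.2 (Nat.one_le_cast.2 hn)
        nlinarith
    have h := hle _ hmem
    rw [devBilin_smul_left, devBilin_smul_right, ← mul_assoc, abs_mul, abs_of_pos (by positivity)]
      at h
    have hcc : c * c * (n * norm2 y ^ 2) = 1 := by
      rw [hc, ← Real.sq_sqrt hn'.le, Real.sqrt_sq hsn.le]
      field_simp
    calc |devBilin b y y| = (c * c * |devBilin b y y|) * (n * norm2 y ^ 2) := by
          rw [mul_right_comm, hcc, one_mul]
      _ ≤ S * (n * norm2 y ^ 2) := by gcongr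
      _ = _ := by ring
  have hSB : S ≤ B + S / 2 := by
    refine csSup_le ⟨_, ⟨0, h0mem, rfl⟩⟩ ?_
    rintro _ ⟨x, hx, rfl⟩
    obtain ⟨z, hz, hxz, hzB⟩ := hnet x hx
    have h1 := abs_devBilin_le_of_diag b (x := x - z) (y := x + z) (c := n * S)
      fun _ _ => hdiag _
    rw [devBilin_sub_add] at h1
    have h2 : norm2 (x + z) ≤ 2 := by linarith [norm2_add_le x z, hx.2, hz.2]
    have h3 : n * S * norm2 (x - z) * norm2 (x + z) ≤ S / 2 := by
      calc n * S * norm2 (x - z) * norm2 (x + z) ≤ n * S * (1 / (4 * n)) * 2 := by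
            gcongr
            exact norm2_nonneg _
        _ = S / 2 := by field_simp; norm_num
    have h4 := abs_sub_abs_le_abs_sub (devBilin b x x) (devBilin b z z)
    simp only
    linarith
  intro x hx
  linarith [hle x hx]

end devBilin

/-! ### Moments of maxima of Rademacher sums and symmetrization -/

lemma pow_le_one_add_exp {t q' : ℝ} {q : ℕ} (ht : 0 ≤ t) (hq : (q : ℝ) ≤ q') :
    t ^ q ≤ 1 + Real.exp (2 * q' * t - 2 * q') := by
  rcases le_or_gt t 1 with h | h
  · have := pow_le_one₀ (n := q) ht h
    linarith [Real.exp_pos (2 * q' * t - 2 * q')]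
  · have h1 : t ≤ Real.exp (t - 1) := by linarith [Real.add_one_le_exp (t - 1)]
    have h0 : (0 : ℝ) ≤ q := Nat.cast_nonneg q
    calc t ^ q ≤ Real.exp (t - 1) ^ q := by gcongr
      _ = Real.exp (q * (t - 1)) := (Real.exp_nat_mul _ _).symm
      _ ≤ Real.exp (2 * q' * t - 2 * q') := by
          apply Real.exp_le_exp.2
          nlinarith
      _ ≤ _ := by linarith

/-- Moments of a quantity dominated by the maximum of finitely many Rademacher sums. -/
lemma expect_pow_max_rademacher_le {ι κ : Type*} [Fintype ι] [DecidableEq ι] (P : Finset κ)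
    (a : κ → ι → ℝ) {σ q' : ℝ} {q : ℕ} (hσ : 0 < σ) (ha : ∀ x ∈ P, ∑ i, a x i ^ 2 ≤ σ ^ 2)
    (hq0 : 0 < q') (hq : (q : ℝ) ≤ q') (hP : (P.card : ℝ) ≤ Real.exp q')
    {M : (ι → Bool) → ℝ} (hM0 : ∀ η, 0 ≤ M η)
    (hM : ∀ η, ∃ x ∈ P, M η ≤ |∑ i, a x i * rsign (η i)|) :
    𝔼 η, M η ^ q ≤ 3 * (2 * Real.sqrt q' * σ) ^ q := by
  set θ := Real.sqrt q' / σ with hθ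
  have hsq : 0 < Real.sqrt q' := Real.sqrt_pos.2 hq0
  have hθ0 : 0 < θ := by positivity
  set B := 2 * Real.sqrt q' * σ with hB
  have hB0 : 0 < B := by positivity
  have hθB : θ * B = 2 * q' := by
    rw [hθ, hB]
    field_simp
    rw [Real.sq_sqrt hq0.le]
  have hsingle : ∀ x ∈ P, ∀ κ : ℝ, κ ^ 2 = 1 →
      𝔼 η : ι → Bool, Real.exp (κ * θ * ∑ i, a x i * rsign (η i)) ≤ Real.exp (q' / 2) := by
    intro x hx κ hκ
    have h := expect_exp_rademacher_le (fun i => κ * θ * a x i)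
    simp only [mul_assoc, ← Finset.mul_sum] at h ⊢
    refine h.trans (Real.exp_le_exp.2 ?_)
    have h1 : ∑ i, (κ * (θ * a x i)) ^ 2 = θ ^ 2 * ∑ i, a x i ^ 2 := by
      rw [Finset.mul_sum]
      refine Finset.sum_congr rfl fun i _ => ?_
      rw [mul_pow, hκ]
      ring
    rw [h1]
    have h2 : θ ^ 2 * σ ^ 2 = q' := by
      rw [hθ, div_pow, div_mul_cancel₀ _ (by positivity), Real.sq_sqrt hq0.le]
    have h3 : θ ^ 2 * ∑ i, a x i ^ 2 ≤ θ ^ 2 * σ ^ 2 := by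
      gcongr
      exact ha x hx
    linarith
  have hmgf : 𝔼 η, Real.exp (θ * M η) ≤ 2 * Real.exp (q' + q' / 2) := by
    calc 𝔼 η, Real.exp (θ * M η)
        ≤ 𝔼 η : ι → Bool, ∑ x ∈ P, (Real.exp (1 * θ * ∑ i, a x i * rsign (η i)) +
            Real.exp (-1 * θ * ∑ i, a x i * rsign (η i))) := by
          refine expect_mono fun η => ?_
          obtain ⟨x, hx, hle⟩ := hM η
          refine le_trans ?_ (Finset.single_le_sum (f := fun x =>
            Real.exp (1 * θ * ∑ i, a x i * rsign (η i)) +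
            Real.exp (-1 * θ * ∑ i, a x i * rsign (η i))) (fun y _ => by positivity) hx)
          have h1 : Real.exp (θ * M η) ≤ Real.exp (θ * |∑ i, a x i * rsign (η i)|) := by gcongr
          refine h1.trans ?_
          rcases abs_cases (∑ i, a x i * rsign (η i)) with ⟨h, _⟩ | ⟨h, _⟩
          · rw [h, one_mul]
            linarith [Real.exp_pos (-1 * θ * ∑ i, a x i * rsign (η i))]
          · rw [h]
            have : θ * -∑ i, a x i * rsign (η i) = -1 * θ * ∑ i, a x i * rsign (η i) := by ring
            rw [this]
            linarith [Real.exp_pos (1 * θ * ∑ i, a x i * rsign (η i))]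
      _ = ∑ x ∈ P, (𝔼 η : ι → Bool, Real.exp (1 * θ * ∑ i, a x i * rsign (η i)) +
            𝔼 η : ι → Bool, Real.exp (-1 * θ * ∑ i, a x i * rsign (η i))) := by
          rw [Finset.expect_sum_comm]
          simp only [Finset.expect_add_distrib]
      _ ≤ ∑ x ∈ P, (Real.exp (q' / 2) + Real.exp (q' / 2)) :=
          Finset.sum_le_sum fun x hx =>
            add_le_add (hsingle x hx 1 (by norm_num)) (hsingle x hx (-1) (by norm_num))
      _ = P.card * (2 * Real.exp (q' / 2)) := by
          rw [Finset.sum_const, nsmul_eq_mul]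
          ring
      _ ≤ Real.exp q' * (2 * Real.exp (q' / 2)) := by gcongr
      _ = _ := by
          rw [Real.exp_add]
          ring
  calc 𝔼 η, M η ^ q ≤ 𝔼 η, B ^ q * (1 + Real.exp (-(2 * q')) * Real.exp (θ * M η)) := by
        refine expect_mono fun η => ?_
        have h := pow_le_one_add_exp (div_nonneg (hM0 η) hB0.le) hq
        have e : 2 * q' * (M η / B) - 2 * q' = -(2 * q') + θ * M η := by
          rw [← hθB]
          field_simp
          ring
        rw [e, Real.exp_add, div_pow, div_le_iff₀ (by positivity)] at h
        linarith
    _ = B ^ q * (1 + Real.exp (-(2 * q')) * 𝔼 η, Real.exp (θ * M η)) := by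
        rw [← Finset.mul_expect, Finset.expect_add_distrib, ← Finset.mul_expect,
          Fintype.expect_const]
    _ ≤ B ^ q * (1 + Real.exp (-(2 * q')) * (2 * Real.exp (q' + q' / 2))) := by gcongr
    _ ≤ B ^ q * 3 := by
        gcongr
        have : Real.exp (-(2 * q')) * (2 * Real.exp (q' + q' / 2)) =
            2 * Real.exp (-(q' / 2)) := by
          rw [mul_left_comm, ← Real.exp_add]
          ring_nf
        rw [this]
        have : Real.exp (-(q' / 2)) ≤ 1 := Real.exp_le_one_iff.2 (by linarith)
        linarith
    _ = _ := mul_comm _ _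

lemma expect_pow_le {α : Type*} [Fintype α] [Nonempty α] {f : α → ℝ} (hf : ∀ a, 0 ≤ f a) (q : ℕ) :
    (𝔼 a, f a) ^ q ≤ 𝔼 a, f a ^ q :=
  convexOn_map_expect_le (convexOn_pow q) hf

lemma abs_expect_le {α : Type*} [Fintype α] (f : α → ℝ) : |𝔼 a, f a| ≤ 𝔼 a, |f a| := by
  rw [abs_le]
  constructor
  · rw [← Finset.expect_neg_distrib]
    exact expect_mono fun a => neg_abs_le _
  · exact expect_mono fun a => le_abs_self _

/-- Exchange the entries of a pair of samples where the sign is `false`. -/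
def swapPair {ι Ω₀ : Type*} (η : ι → Bool) : (ι → Ω₀) × (ι → Ω₀) ≃ (ι → Ω₀) × (ι → Ω₀) where
  toFun o := (fun k => if η k then o.1 k else o.2 k, fun k => if η k then o.2 k else o.1 k)
  invFun o := (fun k => if η k then o.1 k else o.2 k, fun k => if η k then o.2 k else o.1 k)
  left_inv o := by ext k <;> simp <;> split_ifs <;> rfl
  right_inv o := by ext k <;> simp <;> split_ifs <;> rfl

/-- Symmetrization for moments of the supremum of a centered empirical process. -/
lemma expect_pow_sup_empirical_le {Ω₀ κ : Type*} [Fintype Ω₀] [Nonempty Ω₀] {p : ℕ}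
    {P : Finset κ} (hP : P.Nonempty) (X : κ → Ω₀ → ℝ) (q : ℕ) (hq : 1 ≤ q) :
    𝔼 o : Fin p → Ω₀, (P.sup' hP fun x => |∑ k, (X x (o k) - 𝔼 a, X x a)|) ^ q ≤
      2 ^ q * 𝔼 o : Fin p → Ω₀, 𝔼 η : Fin p → Bool,
        (P.sup' hP fun x => |∑ k, rsign (η k) * X x (o k)|) ^ q := by
  classical
  set Z : (Fin p → Bool) → (Fin p → Ω₀) → ℝ := fun η o =>
    P.sup' hP fun x => |∑ k, rsign (η k) * X x (o k)| with hZ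
  set W : (Fin p → Ω₀) × (Fin p → Ω₀) → ℝ := fun o =>
    P.sup' hP fun x => |∑ k, (X x (o.1 k) - X x (o.2 k))| with hW
  have hsup0 : ∀ f : κ → ℝ, 0 ≤ P.sup' hP fun x => |f x| := by
    intro f
    obtain ⟨x, hx⟩ := hP
    exact (abs_nonneg (f x)).trans (Finset.le_sup' (fun x => |f x|) hx)
  have hmarg : ∀ (x : κ) (k : Fin p), 𝔼 o' : Fin p → Ω₀, X x (o' k) = 𝔼 a, X x a := by
    intro x k
    have h := expect_pi_prod (ι := Fin p) (κ := Ω₀) (fun i a => if i = k then X x a else 1)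
    simp only [Finset.prod_ite_eq', Finset.mem_univ, if_true] at h
    rw [h]
    rw [← Finset.mul_prod_erase _ _ (Finset.mem_univ k)]
    rw [Finset.prod_eq_one, mul_one]
    · simp
    · intro i hi
      simp [Finset.ne_of_mem_erase hi]
  have h1 : 𝔼 o : Fin p → Ω₀, (P.sup' hP fun x => |∑ k, (X x (o k) - 𝔼 a, X x a)|) ^ q ≤
      𝔼 o, W o ^ q := by
    rw [expect_prod_type]
    refine expect_mono fun o => ?_
    refine le_trans ?_ (expect_pow_le (fun o' => hsup0 _) q)
    refine pow_le_pow_left₀ (hsup0 _) (Finset.sup'_le _ _ fun x hx => ?_) q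
    have e : ∑ k, (X x (o k) - 𝔼 a, X x a) =
        𝔼 o' : Fin p → Ω₀, ∑ k, (X x (o k) - X x (o' k)) := by
      rw [Finset.expect_sum_comm]
      refine Finset.sum_congr rfl fun k _ => ?_
      rw [Finset.expect_sub_distrib, Fintype.expect_const, hmarg]
    rw [e]
    refine (abs_expect_le _).trans (expect_mono fun o' => ?_)
    exact Finset.le_sup' (fun x => |∑ k, (X x (o k) - X x (o' k))|) hx
  have h2 : ∀ η : Fin p → Bool, 𝔼 o, W o ^ q ≤ 2 ^ q * 𝔼 o, Z η o ^ q := by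
    intro η
    have e : 𝔼 o, W o ^ q = 𝔼 o, W (swapPair η o) ^ q :=
      (Fintype.expect_equiv (swapPair η) _ _ fun o => rfl).symm
    rw [e]
    calc 𝔼 o, W (swapPair η o) ^ q
        ≤ 𝔼 o : (Fin p → Ω₀) × (Fin p → Ω₀), 2 ^ (q - 1) * (Z η o.1 ^ q + Z η o.2 ^ q) := by
          refine expect_mono fun o => ?_
          refine le_trans (pow_le_pow_left₀ (hsup0 _) ?_ q)
            (add_pow_le (hsup0 _) (hsup0 _) q)
          refine Finset.sup'_le _ _ fun x hx => ?_
          have e : ∑ k, (X x ((swapPair η o).1 k) - X x ((swapPair η o).2 k)) =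
              ∑ k, rsign (η k) * X x (o.1 k) - ∑ k, rsign (η k) * X x (o.2 k) := by
            rw [← Finset.sum_sub_distrib]
            refine Finset.sum_congr rfl fun k _ => ?_
            cases h : η k <;> simp [swapPair, rsign, h]
            ring
          rw [e]
          refine (abs_sub _ _).trans (add_le_add ?_ ?_)
          · exact Finset.le_sup' (fun x => |∑ k, rsign (η k) * X x (o.1 k)|) hx
          · exact Finset.le_sup' (fun x => |∑ k, rsign (η k) * X x (o.2 k)|) hx
      _ = 2 ^ (q - 1) * (2 * 𝔼 o, Z η o ^ q) := by
          rw [← Finset.mul_expect, Finset.expect_add_distrib, expect_prod_type, expect_prod_type]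
          simp only [Fintype.expect_const]
          ring
      _ = _ := by
          rw [← mul_assoc, ← pow_succ, Nat.sub_add_cancel hq]
  refine h1.trans ?_
  have h3 : 𝔼 o, W o ^ q = 𝔼 η : Fin p → Bool, 𝔼 o, W o ^ q := by rw [Fintype.expect_const]
  have h4 : 𝔼 o : Fin p → Ω₀, 𝔼 η : Fin p → Bool, Z η o ^ q = 𝔼 η, 𝔼 o, Z η o ^ q :=
    Finset.expect_comm ..
  rw [h3]
  refine (expect_mono h2).trans_eq ?_
  rw [← Finset.mul_expect, ← h4]

/-! ### Chaining for the symmetrized quadratic process -/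

lemma zero_mem_sparseHull (n s : ℕ) : (0 : Fin n → ℝ) ∈ sparseHull n s := by
  simp [sparseHull, norm1, norm2]

lemma one_le_log_two_mul {n : ℕ} (hn : 2 ≤ n) : 1 ≤ Real.log (2 * n) := by
  rw [Real.le_log_iff_exp_le (by positivity)]
  have h1 := Real.exp_one_lt_d9
  have h2 : (2 : ℝ) ≤ n := by exact_mod_cast hn
  linarith

lemma log_two_mul_le {n : ℕ} (hn : 2 ≤ n) : Real.log (2 * n) ≤ 2 * Real.log n := by
  have h2 : (2 : ℝ) ≤ n := by exact_mod_cast hn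
  rw [Real.log_mul (by norm_num) (by positivity), two_mul]
  gcongr

/-- A sequence of nets of `sparseHull n s` of geometrically decreasing mesh. -/
lemma exists_nets_sparseHull {n s : ℕ} (hn : 2 ≤ n) (hs : 0 < s) {U : Fin n → Fin n → ℝ}
    (hU : ∀ i j, |U i j| ≤ 1) :
    ∃ (P : ℕ → Finset (Fin n → ℝ)) (π : ℕ → (Fin n → ℝ) → Fin n → ℝ), (∀ x, π 0 x = 0) ∧
      ∀ j, (P j).card ≤ (2 * n) ^ 4 ^ j ∧ (∀ x ∈ P j, x ∈ sparseHull n s) ∧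
        ∀ x ∈ sparseHull n s, π j x ∈ P j ∧
          ∀ i, |U i ⬝ᵥ (x - π j x)| ≤
            8 * Real.sqrt s * Real.sqrt (Real.log (2 * n)) / 2 ^ j := by
  classical
  have hn0 : 0 < n := by omega
  choose P π hcard hnet using fun j : ℕ =>
    exists_net_sparseHull hn0 hs hU (m := 4 ^ j) (pow_pos (by norm_num) j)
  refine ⟨fun j => if j = 0 then {0} else (P j).filter (· ∈ sparseHull n s),
    fun j x => if j = 0 then 0 else π j x, fun x => if_pos rfl, fun j => ?_⟩
  rcases eq_or_ne j 0 with rfl | hj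
  · simp only [if_true]
    refine ⟨?_, ?_, fun x hx => ⟨Finset.mem_singleton_self _, fun i => ?_⟩⟩
    · simp; omega
    · simp [zero_mem_sparseHull]
    · rw [sub_zero, pow_zero, div_one]
      refine ((abs_dotProduct_le_norm1 (hU i) x).trans hx.1).trans ?_
      have h1 : 1 ≤ Real.sqrt (Real.log (2 * n)) := Real.one_le_sqrt.2 (one_le_log_two_mul hn)
      have h2 := Real.sqrt_nonneg (s : ℝ)
      nlinarith
  · simp only [if_neg hj]
    refine ⟨(Finset.card_filter_le _ _).trans (hcard j), fun x hx => (Finset.mem_filter.1 hx).2,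
      fun x hx => ?_⟩
    obtain ⟨h1, h2, h3⟩ := hnet j x hx
    refine ⟨Finset.mem_filter.2 ⟨h1, h2⟩, fun i => (h3 i).trans_eq ?_⟩
    have : Real.sqrt ((4 ^ j : ℕ) : ℝ) = 2 ^ j := by
      rw [Real.sqrt_eq_iff_mul_self_eq (by positivity) (by positivity), ← mul_pow]
      norm_num
    rw [this]

/-- Moment bound for the Rademacher average of squares over a net, for a fixed sample. -/
lemma expect_pow_sup_rademacher_sq_le {n s p : ℕ} (hn : 2 ≤ n) (hs : 0 < s) (hp : 0 < p)
    {U : Fin n → Fin n → ℝ} {b : Fin p → Fin n → ℝ} {K : ℝ} (hK : 0 < K)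
    (hb : ∀ k x e, (∀ i, |U i ⬝ᵥ x| ≤ e) → |b k ⬝ᵥ x| ≤ K * e)
    {P : ℕ → Finset (Fin n → ℝ)} {π : ℕ → (Fin n → ℝ) → Fin n → ℝ} (hπ0 : ∀ x, π 0 x = 0)
    (hP : ∀ j, (P j).card ≤ (2 * n) ^ 4 ^ j ∧ (∀ x ∈ P j, x ∈ sparseHull n s) ∧
        ∀ x ∈ sparseHull n s, π j x ∈ P j ∧
          ∀ i, |U i ⬝ᵥ (x - π j x)| ≤
            8 * Real.sqrt s * Real.sqrt (Real.log (2 * n)) / 2 ^ j)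
    {R : ℝ} (hR0 : 0 < R) (hR : ∀ x ∈ sparseHull n s, (∑ k, (b k ⬝ᵥ x) ^ 2) / p ≤ R)
    {J q : ℕ} (hJ : 0 < J) (hq : 0 < q) (hne : (P J).Nonempty) :
    𝔼 η : Fin p → Bool, ((P J).sup' hne fun x => |∑ k, rsign (η k) * (b k ⬝ᵥ x) ^ 2|) ^ q ≤
      3 * (J * (64 * K * Real.sqrt s * Real.sqrt (Real.log (2 * n)) *
        Real.sqrt (q + 10 * Real.log n) * Real.sqrt (p * R))) ^ q := by
  classical
  have hp' : (0 : ℝ) < p := Nat.cast_pos.2 hp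
  have hn' : (0 : ℝ) < n := by positivity
  have hL0 : 0 < Real.log n := Real.log_pos (by exact_mod_cast hn)
  set l := Real.sqrt (Real.log (2 * n)) with hl
  have hl0 : 0 < l := Real.sqrt_pos.2 (by linarith [one_le_log_two_mul hn])
  have hs0 : 0 < Real.sqrt s := Real.sqrt_pos.2 (Nat.cast_pos.2 hs)
  set e : ℕ → ℝ := fun j => 8 * Real.sqrt s * l / 2 ^ j with he
  have he0 : ∀ j, 0 < e j := fun j => by simp only [he]; positivity
  set A := 64 * K * Real.sqrt s * l * Real.sqrt (q + 10 * Real.log n) * Real.sqrt (p * R) with hA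
  set c : (Fin n → ℝ) → ℕ → Fin n → ℝ := fun x j => if j = J then x else π j x with hc
  have hcP : ∀ x ∈ P J, ∀ j, c x j ∈ P j := by
    intro x hx j
    by_cases h : j = J
    · simpa [hc, h] using hx
    · simpa [hc, h] using ((hP j).2.2 x ((hP J).2.1 x hx)).1
  have hce : ∀ x ∈ P J, ∀ j i, |U i ⬝ᵥ (x - c x j)| ≤ e j := by
    intro x hx j i
    by_cases h : j = J
    · simpa [hc, h] using (he0 J).le
    · simpa [hc, h] using ((hP j).2.2 x ((hP J).2.1 x hx)).2 i
  choose X hXmem hXeq using fun η : Fin p → Bool =>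
    Finset.exists_mem_eq_sup' hne fun x => |∑ k, rsign (η k) * (b k ⬝ᵥ x) ^ 2|
  set G : (Fin p → Bool) → (Fin n → ℝ) → ℝ := fun η x => ∑ k, rsign (η k) * (b k ⬝ᵥ x) ^ 2
    with hG
  set M : ℕ → (Fin p → Bool) → ℝ := fun j η => |G η (c (X η) (j + 1)) - G η (c (X η) j)| with hM
  have htel : ∀ η, (P J).sup' hne (fun x => |G η x|) ≤ ∑ j ∈ Finset.range J, M j η := by
    intro η
    have h1 : G η (X η) = ∑ j ∈ Finset.range J, (G η (c (X η) (j + 1)) - G η (c (X η) j)) := by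
      rw [Finset.sum_range_sub (fun j => G η (c (X η) j))]
      simp [hc, hJ.ne, hπ0, hG]
    rw [hXeq η]
    change |G η (X η)| ≤ _
    rw [h1]
    exact Finset.abs_sum_le_sum_abs _ _
  have hmom : ∀ j, 𝔼 η, M j η ^ q ≤ 3 * A ^ q := by
    intro j
    set Q : Finset ((Fin n → ℝ) × (Fin n → ℝ)) := (P (j + 1) ×ˢ P j).filter
      fun zw => ∀ i, |U i ⬝ᵥ (zw.1 - zw.2)| ≤ 2 * e j with hQ
    set q' : ℝ := q + 10 * 4 ^ j * Real.log n with hq'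
    have hq'0 : 0 < q' := by positivity
    set σ : ℝ := 4 * K * e j * Real.sqrt (p * R) with hσ
    have hσ0 : 0 < σ := by
      have := he0 j
      positivity
    have h := expect_pow_max_rademacher_le (ι := Fin p) Q
      (fun zw k => (b k ⬝ᵥ (zw.1 - zw.2)) * (b k ⬝ᵥ (zw.1 + zw.2))) (σ := σ) (q' := q') (q := q)
      hσ0 ?_ hq'0 ?_ ?_ (M := M j) (fun η => abs_nonneg _) ?_
    · refine h.trans ?_
      have h1 : Real.sqrt q' ≤ 2 ^ j * Real.sqrt (q + 10 * Real.log n) := by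
        rw [Real.sqrt_le_left (by positivity), mul_pow, Real.sq_sqrt (by positivity), ← pow_mul,
          mul_comm j 2, pow_mul, hq']
        have h4 : (1 : ℝ) ≤ 4 ^ j := one_le_pow₀ (by norm_num)
        have : (q : ℝ) ≤ 4 ^ j * q := le_mul_of_one_le_left (Nat.cast_nonneg q) h4
        norm_num
        linarith
      have h2 : 2 * Real.sqrt q' * σ ≤ A := by
        calc 2 * Real.sqrt q' * σ ≤ 2 * (2 ^ j * Real.sqrt (q + 10 * Real.log n)) * σ := by gcongr
          _ = A := by
            simp only [hσ, hA, he]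
            field_simp
            norm_num
      gcongr
    · rintro ⟨z, w⟩ hzw
      simp only [hQ, Finset.mem_filter, Finset.mem_product] at hzw
      obtain ⟨⟨hz, hw⟩, hd⟩ := hzw
      have h1 : ∀ k, (b k ⬝ᵥ (z - w)) ^ 2 ≤ (K * (2 * e j)) ^ 2 := by
        intro k
        have := hb k (z - w) (2 * e j) hd
        exact sq_le_sq' (neg_le_of_abs_le this) (le_of_abs_le this)
      have h2 : ∑ k, (b k ⬝ᵥ (z + w)) ^ 2 ≤ 4 * (p * R) := by
        have hz' := hR z ((hP _).2.1 z hz)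
        have hw' := hR w ((hP _).2.1 w hw)
        rw [div_le_iff₀ hp'] at hz' hw'
        calc ∑ k, (b k ⬝ᵥ (z + w)) ^ 2 ≤ ∑ k, (2 * (b k ⬝ᵥ z) ^ 2 + 2 * (b k ⬝ᵥ w) ^ 2) := by
              refine Finset.sum_le_sum fun k _ => ?_
              rw [dotProduct_add]
              nlinarith [sq_nonneg (b k ⬝ᵥ z - b k ⬝ᵥ w)]
          _ = 2 * ∑ k, (b k ⬝ᵥ z) ^ 2 + 2 * ∑ k, (b k ⬝ᵥ w) ^ 2 := by
              rw [Finset.sum_add_distrib, Finset.mul_sum, Finset.mul_sum]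
          _ ≤ _ := by linarith
      calc ∑ k, ((b k ⬝ᵥ (z - w)) * (b k ⬝ᵥ (z + w))) ^ 2
          ≤ ∑ k, (K * (2 * e j)) ^ 2 * (b k ⬝ᵥ (z + w)) ^ 2 := by
            refine Finset.sum_le_sum fun k _ => ?_
            rw [mul_pow (b k ⬝ᵥ (z - w))]
            exact mul_le_mul_of_nonneg_right (h1 k) (sq_nonneg _)
        _ = (K * (2 * e j)) ^ 2 * ∑ k, (b k ⬝ᵥ (z + w)) ^ 2 := by rw [Finset.mul_sum]
        _ ≤ (K * (2 * e j)) ^ 2 * (4 * (p * R)) := by gcongr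
        _ = σ ^ 2 := by
            rw [hσ, mul_pow _ (Real.sqrt _), Real.sq_sqrt (by positivity)]
            ring
    · have : 0 ≤ 10 * 4 ^ j * Real.log n := by positivity
      linarith
    · have h1 : (Q.card : ℝ) ≤ ((2 * n : ℕ) : ℝ) ^ (5 * 4 ^ j) := by
        have : Q.card ≤ (2 * n) ^ (5 * 4 ^ j) := by
          refine (Finset.card_filter_le _ _).trans ?_
          rw [Finset.card_product]
          refine (Nat.mul_le_mul (hP (j + 1)).1 (hP j).1).trans_eq ?_
          rw [← pow_add]
          congr 1
          ring
        exact_mod_cast this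
      refine h1.trans ?_
      have h2n : (0 : ℝ) < (2 * n : ℕ) := by positivity
      rw [← Real.exp_log h2n, ← Real.exp_nat_mul]
      apply Real.exp_le_exp.2
      have h3 := log_two_mul_le hn
      have h4 : (0 : ℝ) ≤ 5 * 4 ^ j := by positivity
      push_cast
      have := mul_le_mul_of_nonneg_left h3 h4
      have hq0 : (0 : ℝ) ≤ q := Nat.cast_nonneg q
      rw [hq']
      linarith
    · intro η
      refine ⟨(c (X η) (j + 1), c (X η) j), ?_, le_of_eq ?_⟩
      · simp only [hQ, Finset.mem_filter, Finset.mem_product]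
        refine ⟨⟨hcP _ (hXmem η) _, hcP _ (hXmem η) _⟩, fun i => ?_⟩
        have h1 := hce _ (hXmem η) (j + 1) i
        have h2 := hce _ (hXmem η) j i
        have e1 : c (X η) (j + 1) - c (X η) j = (X η - c (X η) j) - (X η - c (X η) (j + 1)) := by
          abel
        rw [e1, dotProduct_sub]
        have h3 : e (j + 1) ≤ e j := by
          simp only [he]
          gcongr <;> norm_num
        linarith [abs_sub (U i ⬝ᵥ (X η - c (X η) j)) (U i ⬝ᵥ (X η - c (X η) (j + 1)))]
      · simp only [hM, hG]
        rw [← Finset.sum_sub_distrib]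
        congr 1
        refine Finset.sum_congr rfl fun k _ => ?_
        rw [dotProduct_sub, dotProduct_add]
        ring
  obtain ⟨r, rfl⟩ : ∃ r, q = r + 1 := ⟨q - 1, by omega⟩
  have hJ' : (0 : ℝ) < J := Nat.cast_pos.2 hJ
  calc 𝔼 η : Fin p → Bool, ((P J).sup' hne fun x => |G η x|) ^ (r + 1)
      ≤ 𝔼 η, (J : ℝ) ^ r * ∑ j ∈ Finset.range J, M j η ^ (r + 1) := by
        refine expect_mono fun η => ?_
        have h1 := pow_sum_div_card_le_sum_pow (s := Finset.range J) (f := fun j => M j η)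
          (fun j _ => abs_nonneg _) r
        rw [Finset.card_range, div_le_iff₀ (by positivity), mul_comm] at h1
        refine le_trans (pow_le_pow_left₀ ?_ (htel η) _) h1
        rw [hXeq η]
        exact abs_nonneg _
    _ = (J : ℝ) ^ r * ∑ j ∈ Finset.range J, 𝔼 η, M j η ^ (r + 1) := by
        rw [← Finset.mul_expect, Finset.expect_sum_comm]
    _ ≤ (J : ℝ) ^ r * ∑ j ∈ Finset.range J, 3 * A ^ (r + 1) := by
        gcongr with j
        exact hmom j
    _ = 3 * (J * A) ^ (r + 1) := by
        rw [Finset.sum_const, Finset.card_range, nsmul_eq_mul, mul_pow]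
        ring

/-! ### Restricted isometry of the empirical quadratic form -/

/-- The number of chaining levels. -/
def chainLevels (n : ℕ) : ℕ := 6 + 3 * Nat.clog 2 n

lemma mesh_chainLevels_le {n s : ℕ} (hn : 2 ≤ n) (hsn : s ≤ n) :
    8 * Real.sqrt s * Real.sqrt (Real.log (2 * n)) / 2 ^ chainLevels n ≤ 1 / (4 * n) := by
  have hn' : (2 : ℝ) ≤ n := by exact_mod_cast hn
  have h1 : (n : ℝ) ≤ 2 ^ Nat.clog 2 n := by exact_mod_cast Nat.le_pow_clog (by norm_num) n
  have h2 : (64 : ℝ) * n ^ 3 ≤ 2 ^ chainLevels n := by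
    rw [chainLevels, pow_add, mul_comm 3, pow_mul]
    norm_num
    gcongr
  have h3 : Real.sqrt s ≤ n := by
    rw [Real.sqrt_le_left (by positivity)]
    have : (s : ℝ) ≤ n := by exact_mod_cast hsn
    nlinarith
  have h4 : Real.sqrt (Real.log (2 * n)) ≤ n := by
    rw [Real.sqrt_le_left (by positivity)]
    have := Real.log_le_sub_one_of_pos (by positivity : (0 : ℝ) < 2 * n)
    nlinarith
  rw [div_le_div_iff₀ (by positivity) (by positivity), one_mul]
  calc 8 * Real.sqrt s * Real.sqrt (Real.log (2 * n)) * (4 * n) ≤ 8 * n * n * (4 * n) := by gcongr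
    _ ≤ 64 * n ^ 3 := by nlinarith [pow_pos (by linarith : (0 : ℝ) < n) 3]
    _ ≤ _ := h2

lemma chainLevels_le {n : ℕ} (hn : 2 ≤ n) : (chainLevels n : ℝ) ≤ 18 * Real.log n := by
  have h2 : (0.6931471803 : ℝ) < Real.log 2 := Real.log_two_gt_d9
  have hn' : (2 : ℝ) ≤ n := by exact_mod_cast hn
  have hL : Real.log 2 ≤ Real.log n := Real.log_le_log (by norm_num) hn'
  have h1 : (Nat.clog 2 n : ℝ) * Real.log 2 ≤ Real.log n + Real.log 2 := by
    have hlt : 2 ^ (Nat.clog 2 n - 1) < n := Nat.pow_pred_clog_lt_self (by norm_num) (by omega)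
    have hpos : 0 < Nat.clog 2 n := Nat.clog_pos (by norm_num) hn
    have h3 : ((Nat.clog 2 n - 1 : ℕ) : ℝ) * Real.log 2 ≤ Real.log n := by
      rw [← Real.log_pow]
      exact Real.log_le_log (by positivity) (by exact_mod_cast hlt.le)
    rw [Nat.cast_sub hpos] at h3
    push_cast at h3
    linarith
  rw [chainLevels]
  push_cast
  nlinarith

/-- A self-bounding moment inequality. -/
lemma expect_pow_le_of_self_bounding {α : Type*} [Fintype α] [Nonempty α] {D : α → ℝ}
    (hD : ∀ o, 0 ≤ D o) {a : ℝ} (ha : 0 ≤ a) {q : ℕ} (hq : 0 < q)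
    (h : 𝔼 o, D o ^ q ≤ 𝔼 o, (a * Real.sqrt (1 + D o)) ^ q) :
    𝔼 o, D o ^ q ≤ (2 * (a + 2 * a ^ 2)) ^ q := by
  obtain ⟨r, rfl⟩ : ∃ r, q = r + 1 := ⟨q - 1, by omega⟩
  set B := a + 2 * a ^ 2 with hB
  have hB0 : 0 ≤ B := by positivity
  have h1 : ∀ o, a * Real.sqrt (1 + D o) ≤ B + D o / 4 := by
    intro o
    have hDo := hD o
    refine abs_le_of_sq_le_sq' ?_ (by positivity) |>.2
    rw [mul_pow, Real.sq_sqrt (by linarith)]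
    have : 0 ≤ a * D o := mul_nonneg ha hDo
    have : 0 ≤ a ^ 3 := by positivity
    nlinarith [sq_nonneg (D o), sq_nonneg (a ^ 2)]
  have h2 : 𝔼 o, (a * Real.sqrt (1 + D o)) ^ (r + 1) ≤
      𝔼 o, (2 ^ r * B ^ (r + 1) + (1 / 2) * D o ^ (r + 1)) := by
    refine expect_mono fun o => ?_
    have hDo := hD o
    calc (a * Real.sqrt (1 + D o)) ^ (r + 1) ≤ (B + D o / 4) ^ (r + 1) :=
          pow_le_pow_left₀ (by positivity) (h1 o) _
      _ ≤ 2 ^ r * (B ^ (r + 1) + (D o / 4) ^ (r + 1)) := add_pow_le hB0 (by positivity) _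
      _ = 2 ^ r * B ^ (r + 1) + 2 ^ r / 4 ^ (r + 1) * D o ^ (r + 1) := by
          rw [div_pow]
          ring
      _ ≤ _ := by
          refine add_le_add le_rfl (mul_le_mul_of_nonneg_right ?_ (by positivity))
          rw [div_le_iff₀ (by positivity)]
          have : (2 : ℝ) ^ r ≤ 4 ^ r := by gcongr; norm_num
          have h4 : (0 : ℝ) < 4 ^ r := by positivity
          rw [pow_succ]
          linarith
  have h3 := h.trans h2
  rw [Finset.expect_add_distrib, Fintype.expect_const, ← Finset.mul_expect] at h3
  calc 𝔼 o, D o ^ (r + 1) ≤ 2 * (2 ^ r * B ^ (r + 1)) := by linarith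
    _ = _ := by
      rw [mul_pow, pow_succ 2 r]
      ring

section rip

variable {Ω₀ : Type*} [Fintype Ω₀] [Nonempty Ω₀] {n p : ℕ} {U : Fin n → Fin n → ℝ}
  {b : Ω₀ → Fin n → ℝ} {K : ℝ}

/-- Tail bound for the empirical quadratic form over `sparseHull n s`. -/
lemma unifProb_devBilin_sparseHull_le (hn : 2 ≤ n) (hp : 0 < p) (hK : 0 < K)
    (hU : ∀ i j, |U i j| ≤ 1)
    (hb : ∀ o x e, (∀ i, |U i ⬝ᵥ x| ≤ e) → |b o ⬝ᵥ x| ≤ K * e)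
    (hiso : ∀ x, 𝔼 o, (b o ⬝ᵥ x) ^ 2 = norm2 x ^ 2)
    (hU2 : ∀ x e, (∀ i, |U i ⬝ᵥ x| ≤ e) → norm2 x ≤ e)
    {s q : ℕ} (hs : 0 < s) (hsn : s ≤ n) (hq : 0 < q) {a : ℝ}
    (ha : a = 12 * (chainLevels n * (64 * K * Real.sqrt s * Real.sqrt (Real.log (2 * n)) *
        Real.sqrt (q + 10 * Real.log n))) / Real.sqrt p) :
    unifProb (fun o : Fin p → Ω₀ => ∃ x ∈ sparseHull n s,
      6 * (a + 2 * a ^ 2) < |devBilin (fun k => b (o k)) x x|) ≤ Real.exp (-(q : ℝ)) := by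
  have hp' : (0 : ℝ) < p := Nat.cast_pos.2 hp
  have hsp : 0 < Real.sqrt p := Real.sqrt_pos.2 hp'
  have hn0 : 0 < n := by omega
  have hL0 : 0 < Real.log n := Real.log_pos (by exact_mod_cast hn)
  have hJ : 0 < chainLevels n := by rw [chainLevels]; omega
  have hs0 : 0 < Real.sqrt s := Real.sqrt_pos.2 (Nat.cast_pos.2 hs)
  have hl0 : 0 < Real.sqrt (Real.log (2 * n)) :=
    Real.sqrt_pos.2 (by linarith [one_le_log_two_mul hn])
  have ha0 : 0 < a := by
    have : (0 : ℝ) < chainLevels n := Nat.cast_pos.2 hJ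
    rw [ha]
    positivity
  obtain ⟨P, π, hπ0, hP⟩ := exists_nets_sparseHull hn hs hU
  set J := chainLevels n with hJdef
  have hne : (P J).Nonempty := ⟨_, ((hP J).2.2 0 (zero_mem_sparseHull n s)).1⟩
  set H : (Fin p → Ω₀) → ℝ := fun o =>
    (P J).sup' hne fun x => |∑ k, ((b (o k) ⬝ᵥ x) ^ 2 - 𝔼 a, (b a ⬝ᵥ x) ^ 2)| with hH
  set D : (Fin p → Ω₀) → ℝ := fun o => 2 * (H o / p) with hD
  have hdev : ∀ (o : Fin p → Ω₀) x, devBilin (fun k => b (o k)) x x =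
      (∑ k, ((b (o k) ⬝ᵥ x) ^ 2 - 𝔼 a, (b a ⬝ᵥ x) ^ 2)) / p := by
    intro o x
    simp only [devBilin, hiso, dotProduct_self_eq_norm2_sq, ← sq, Finset.sum_sub_distrib,
      Finset.sum_const, Finset.card_univ, Fintype.card_fin, nsmul_eq_mul]
    field_simp
  have hH0 : ∀ o, 0 ≤ H o := by
    intro o
    obtain ⟨x, hx⟩ := hne
    exact (abs_nonneg _).trans (Finset.le_sup' (fun x =>
      |∑ k, ((b (o k) ⬝ᵥ x) ^ 2 - 𝔼 a, (b a ⬝ᵥ x) ^ 2)|) hx)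
  have hD0 : ∀ o, 0 ≤ D o := fun o => by
    have := hH0 o
    simp only [hD]
    positivity
  have hsup : ∀ o, ∀ x ∈ sparseHull n s, |devBilin (fun k => b (o k)) x x| ≤ D o := by
    intro o
    refine abs_devBilin_le_two_mul_of_net (fun k => b (o k)) hn0 hs
      (A := (K * Real.sqrt s) ^ 2 + 1) ?_ ?_
    · intro x hx
      have h1 : ∀ k, (b (o k) ⬝ᵥ x) * (b (o k) ⬝ᵥ x) ≤ (K * Real.sqrt s) ^ 2 := by
        intro k
        have := hb (o k) x (Real.sqrt s) fun i =>
          (abs_dotProduct_le_norm1 (hU i) x).trans hx.1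
        rw [← sq]
        exact sq_le_sq' (neg_le_of_abs_le this) (le_of_abs_le this)
      have h2 : (∑ k, (b (o k) ⬝ᵥ x) * (b (o k) ⬝ᵥ x)) / p ≤ (K * Real.sqrt s) ^ 2 := by
        rw [div_le_iff₀ hp']
        refine (Finset.sum_le_sum fun k _ => h1 k).trans_eq ?_
        simp [mul_comm]
      have h3 : 0 ≤ (∑ k, (b (o k) ⬝ᵥ x) * (b (o k) ⬝ᵥ x)) / p :=
        div_nonneg (Finset.sum_nonneg fun k _ => mul_self_nonneg _) hp'.le
      have h4 : norm2 x ^ 2 ≤ 1 := pow_le_one₀ (norm2_nonneg x) hx.2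
      rw [devBilin, dotProduct_self_eq_norm2_sq, abs_le]
      constructor <;> nlinarith [sq_nonneg (norm2 x), sq_nonneg (K * Real.sqrt s)]
    · intro x hx
      obtain ⟨h1, h2⟩ := (hP J).2.2 x hx
      refine ⟨π J x, (hP J).2.1 _ h1, (hU2 _ _ h2).trans (mesh_chainLevels_le hn hsn), ?_⟩
      rw [hdev, abs_div, abs_of_pos hp']
      gcongr
      exact Finset.le_sup' (fun x => |∑ k, ((b (o k) ⬝ᵥ x) ^ 2 - 𝔼 a, (b a ⬝ᵥ x) ^ 2)|) h1
  have hself : 𝔼 o, D o ^ q ≤ 𝔼 o, (a * Real.sqrt (1 + D o)) ^ q := by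
    have h1 := expect_pow_sup_empirical_le (p := p) hne (fun x (o : Ω₀) => (b o ⬝ᵥ x) ^ 2) q hq
    have h2 : ∀ o : Fin p → Ω₀, 𝔼 η : Fin p → Bool,
        ((P J).sup' hne fun x => |∑ k, rsign (η k) * (b (o k) ⬝ᵥ x) ^ 2|) ^ q ≤
        (p / 4 * (a * Real.sqrt (1 + D o))) ^ q := by
      intro o
      have hR0 : 0 < 1 + D o := by linarith [hD0 o]
      refine (expect_pow_sup_rademacher_sq_le hn hs hp hK (fun k => hb (o k)) hπ0 hP hR0 ?_ hJ hq
        hne).trans ?_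
      · intro x hx
        have h3 := le_of_abs_le (hsup o x hx)
        have h4 : norm2 x ^ 2 ≤ 1 := pow_le_one₀ (norm2_nonneg x) hx.2
        rw [devBilin, dotProduct_self_eq_norm2_sq] at h3
        simp only [sq] at h3 h4 ⊢
        linarith
      · have h3 : (3 : ℝ) ≤ 3 ^ q := le_self_pow₀ (by norm_num) hq.ne'
        refine (mul_le_mul_of_nonneg_right h3 (by positivity)).trans_eq ?_
        rw [← mul_pow]
        congr 1
        rw [ha, Real.sqrt_mul hp'.le]
        field_simp
        rw [Real.sq_sqrt hp'.le]
        ring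
    have h3 : ∀ o, D o ^ q = (2 / p) ^ q * H o ^ q := by
      intro o
      rw [← mul_pow]
      simp only [hD]
      ring
    simp only [h3, ← Finset.mul_expect]
    calc (2 / p : ℝ) ^ q * 𝔼 o, H o ^ q ≤
        (2 / p) ^ q * (2 ^ q * 𝔼 o : Fin p → Ω₀, (p / 4 * (a * Real.sqrt (1 + D o))) ^ q) := by
          gcongr
          refine h1.trans ?_
          gcongr
          exact h2 _
      _ = _ := by
          simp only [mul_pow (p / 4 : ℝ), ← Finset.mul_expect]
          rw [← mul_assoc, ← mul_assoc, ← mul_pow, ← mul_pow]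
          have : (2 / p * 2 * (p / 4) : ℝ) = 1 := by field_simp; norm_num
          rw [this, one_pow, one_mul]
  have hmom := expect_pow_le_of_self_bounding hD0 ha0.le hq hself
  set B := 2 * (a + 2 * a ^ 2) with hB
  have hB0 : 0 < B := by positivity
  refine (unifProb_le_expect_div (f := fun o => D o ^ q) (fun o => pow_nonneg (hD0 o) q)
    (c := (Real.exp 1 * B) ^ q) (by positivity) ?_).trans ?_
  · rintro o ⟨x, hx, hlt⟩
    refine pow_le_pow_left₀ (by positivity) ?_ q
    have h3 := hsup o x hx
    have h4 : Real.exp 1 ≤ 3 := by linarith [Real.exp_one_lt_d9]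
    have : Real.exp 1 * B ≤ 3 * B := by gcongr
    linarith
  · rw [div_le_iff₀ (by positivity), mul_pow, ← mul_assoc, ← Real.exp_nat_mul, ← Real.exp_add]
    simpa using hmom

end rip

lemma half_le_log {n : ℕ} (hn : 2 ≤ n) : 1 / 2 ≤ Real.log n := by
  have h2 : (0.6931471803 : ℝ) < Real.log 2 := Real.log_two_gt_d9
  have hn' : (2 : ℝ) ≤ n := by exact_mod_cast hn
  have hL : Real.log 2 ≤ Real.log n := Real.log_le_log (by norm_num) hn'
  linarith

lemma IsSparse.norm1_le {n s : ℕ} {x : Fin n → ℝ} (hx : IsSparse s x) :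
    norm1 x ≤ Real.sqrt s * norm2 x := by
  classical
  set S := Finset.univ.filter fun t => x t ≠ 0 with hS
  have h1 : norm1 x = ∑ t ∈ S, |x t| * 1 := by
    rw [norm1, hS, Finset.sum_filter]
    refine Finset.sum_congr rfl fun t _ => ?_
    by_cases h : x t = 0 <;> simp [h]
  have h2 := Finset.sum_mul_sq_le_sq_mul_sq S (fun t => |x t|) (fun _ => (1 : ℝ))
  rw [← h1] at h2
  simp only [sq_abs, one_pow, Finset.sum_const, nsmul_eq_mul, mul_one] at h2
  have h3 : ∑ t ∈ S, x t ^ 2 ≤ norm2 x ^ 2 := by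
    rw [norm2_sq]
    exact Finset.sum_le_sum_of_subset_of_nonneg (Finset.subset_univ _) fun _ _ _ => sq_nonneg _
  have h4 : (S.card : ℝ) ≤ s := by
    have : S.card ≤ s := by
      simpa [IsSparse, hS] using hx
    exact_mod_cast this
  refine abs_le_of_sq_le_sq' ?_ (by positivity [norm2_nonneg x]) |>.2
  rw [mul_pow, Real.sq_sqrt (Nat.cast_nonneg s)]
  calc norm1 x ^ 2 ≤ (∑ t ∈ S, x t ^ 2) * S.card := h2
    _ ≤ norm2 x ^ 2 * s := by gcongr
    _ = _ := mul_comm _ _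

lemma IsSparse.linear_comb {n s : ℕ} {x y : Fin n → ℝ} (hx : IsSparse s x) (hy : IsSparse s y)
    (c d : ℝ) : IsSparse (2 * s) (c • x + d • y) := by
  refine IsSparse.of_support ((Finset.univ.filter fun t => x t ≠ 0) ∪
    Finset.univ.filter fun t => y t ≠ 0) ?_ fun t ht => ?_
  · rw [two_mul]
    exact (Finset.card_union_le _ _).trans (add_le_add hx hy)
  · simp only [Finset.mem_union, Finset.mem_filter, Finset.mem_univ, true_and] at ht
    push Not at ht
    simp [ht.1, ht.2]

section rip

variable {Ω₀ : Type*} [Fintype Ω₀] [Nonempty Ω₀] {n p : ℕ} {U : Fin n → Fin n → ℝ}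
  {b : Ω₀ → Fin n → ℝ} {K : ℝ}

lemma chain_constant_le (hn : 2 ≤ n) (hp : 0 < p) (hK : 0 < K) {ν : ℝ} (hν : 0 < ν) (s : ℕ) :
    12 * (chainLevels n * (64 * K * Real.sqrt s * Real.sqrt (Real.log (2 * n)) *
        Real.sqrt ((⌈ν + 2 * Real.log n⌉₊ : ℕ) + 10 * Real.log n))) / Real.sqrt p ≤
      82944 * (K * Real.log n ^ 2 * Real.sqrt (1 + ν) / Real.sqrt p * Real.sqrt s) := by
  have hL := half_le_log hn
  set L := Real.log n with hLdef
  have hL0 : 0 < L := by linarith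
  have h1 := chainLevels_le hn
  have h2 := log_two_mul_le hn
  have h3 : ((⌈ν + 2 * L⌉₊ : ℕ) : ℝ) + 10 * L ≤ 16 * (1 + ν) * L := by
    have := (Nat.ceil_lt_add_one (by positivity : 0 ≤ ν + 2 * L)).le
    nlinarith
  have hp' : 0 < Real.sqrt p := Real.sqrt_pos.2 (Nat.cast_pos.2 hp)
  have h4 : Real.sqrt (Real.log (2 * n)) * Real.sqrt ((⌈ν + 2 * L⌉₊ : ℕ) + 10 * L) ≤
      6 * L * Real.sqrt (1 + ν) := by
    rw [← Real.sqrt_mul (by linarith [one_le_log_two_mul hn]), Real.sqrt_le_left (by positivity),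
      mul_pow, Real.sq_sqrt (by positivity)]
    calc Real.log (2 * n) * ((⌈ν + 2 * L⌉₊ : ℕ) + 10 * L) ≤ (2 * L) * (16 * (1 + ν) * L) := by
          gcongr
      _ ≤ _ := by nlinarith [mul_pos hν (mul_pos hL0 hL0), mul_pos hL0 hL0]
  calc _ = 768 * K * Real.sqrt s / Real.sqrt p * (chainLevels n * (Real.sqrt (Real.log (2 * n)) *
        Real.sqrt ((⌈ν + 2 * L⌉₊ : ℕ) + 10 * L))) := by ring
    _ ≤ 768 * K * Real.sqrt s / Real.sqrt p * ((18 * L) * (6 * L * Real.sqrt (1 + ν))) := by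
        gcongr
    _ = _ := by ring

/-- Restricted isometry of the empirical quadratic form, simultaneously at all sparsity levels. -/
lemma unifProb_not_rip_le (hn : 2 ≤ n) (hp : 0 < p) (hK : 0 < K)
    (hU : ∀ i j, |U i j| ≤ 1)
    (hb : ∀ o x e, (∀ i, |U i ⬝ᵥ x| ≤ e) → |b o ⬝ᵥ x| ≤ K * e)
    (hiso : ∀ x, 𝔼 o, (b o ⬝ᵥ x) ^ 2 = norm2 x ^ 2)
    (hU2 : ∀ x e, (∀ i, |U i ⬝ᵥ x| ≤ e) → norm2 x ≤ e) {ν : ℝ} (hν : 0 < ν) {δ : ℝ}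
    (hδ : δ = K * Real.log n ^ 2 * Real.sqrt (1 + ν) / Real.sqrt p) :
    unifProb (fun o : Fin p → Ω₀ => ¬ ∀ s : ℕ, 0 < s → ∀ x y, IsSparse s x → IsSparse s y →
      |devBilin (fun k => b (o k)) x y| ≤
        24 * 82944 ^ 2 * (δ * Real.sqrt s + δ ^ 2 * s) * norm2 x * norm2 y) ≤
      Real.exp (-ν) / 2 := by
  have hn' : (2 : ℝ) ≤ n := by exact_mod_cast hn
  have hp' : 0 < Real.sqrt p := Real.sqrt_pos.2 (Nat.cast_pos.2 hp)
  have hL := half_le_log hn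
  have hδ0 : 0 < δ := by rw [hδ]; positivity
  set q := ⌈ν + 2 * Real.log n⌉₊ with hq
  have hq0 : 0 < q := Nat.ceil_pos.2 (by linarith)
  set a : ℕ → ℝ := fun s => 12 * (chainLevels n * (64 * K * Real.sqrt s *
    Real.sqrt (Real.log (2 * n)) * Real.sqrt (q + 10 * Real.log n))) / Real.sqrt p with ha
  have ha0 : ∀ s, 0 ≤ a s := fun s => by simp only [ha]; positivity
  have hale : ∀ s : ℕ, a s ≤ 82944 * (δ * Real.sqrt s) := fun s => by
    rw [hδ]
    exact chain_constant_le hn hp hK hν s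
  have hlevel : ∀ s ∈ Finset.Icc 1 n, unifProb (fun o : Fin p → Ω₀ => ∃ x ∈ sparseHull n s,
      6 * (a s + 2 * a s ^ 2) < |devBilin (fun k => b (o k)) x x|) ≤ Real.exp (-(q : ℝ)) := by
    intro s hs
    obtain ⟨hs1, hs2⟩ := Finset.mem_Icc.1 hs
    exact unifProb_devBilin_sparseHull_le hn hp hK hU hb hiso hU2 hs1 hs2 hq0 rfl
  have hunion := (unifProb_exists_le (Finset.Icc 1 n) fun s (o : Fin p → Ω₀) =>
    ∃ x ∈ sparseHull n s, 6 * (a s + 2 * a s ^ 2) < |devBilin (fun k => b (o k)) x x|).trans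
    (Finset.sum_le_sum hlevel)
  refine le_trans (unifProb_mono fun o ho => ?_) (hunion.trans ?_)
  · by_contra hcon
    push Not at hcon
    refine ho fun s hs x y hx hy => ?_
    refine abs_devBilin_le_of_diag _ fun c d => ?_
    set v := c • x + d • y with hv
    rcases eq_or_ne v 0 with h0 | h0
    · rw [h0]
      simp [devBilin, norm2_zero]
    have hv0 := norm2_pos h0
    have hsp : IsSparse (2 * s) v := hx.linear_comb hy c d
    set s' := min (2 * s) n with hs'
    have hs'1 : s' ∈ Finset.Icc 1 n :=
      Finset.mem_Icc.2 ⟨le_min (by omega) (by omega), min_le_right _ _⟩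
    have hmem : (norm2 v)⁻¹ • v ∈ sparseHull n s' := by
      refine ⟨?_, (norm2_inv_smul h0).le⟩
      rw [norm1_smul, abs_of_pos (inv_pos.2 hv0), inv_mul_le_iff₀ hv0, mul_comm]
      rcases min_choice (2 * s) n with h | h
      · rw [hs', h]
        exact hsp.norm1_le
      · rw [hs', h]
        exact norm1_le_sqrt_mul_norm2 v
    have h1 := hcon s' hs'1 _ hmem
    rw [devBilin_smul_left, devBilin_smul_right, ← mul_assoc, abs_mul,
      abs_of_pos (by positivity)] at h1
    have h2 : |devBilin (fun k => b (o k)) v v| ≤ 6 * (a s' + 2 * a s' ^ 2) * norm2 v ^ 2 := by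
      calc _ = ((norm2 v)⁻¹ * (norm2 v)⁻¹ * |devBilin (fun k => b (o k)) v v|) * norm2 v ^ 2 := by
            field_simp
        _ ≤ _ := by gcongr
    refine h2.trans (mul_le_mul_of_nonneg_right ?_ (sq_nonneg _))
    have h3 : Real.sqrt s' ≤ 2 * Real.sqrt s := by
      rw [Real.sqrt_le_left (by positivity), mul_pow, Real.sq_sqrt (Nat.cast_nonneg s)]
      have : (s' : ℝ) ≤ 2 * s := by exact_mod_cast min_le_left (2 * s) n
      have h0 : (0 : ℝ) ≤ s := Nat.cast_nonneg s
      linarith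
    have h4 : a s' ^ 2 ≤ 82944 ^ 2 * δ ^ 2 * (2 * s) := by
      calc a s' ^ 2 ≤ (82944 * (δ * Real.sqrt s')) ^ 2 :=
            pow_le_pow_left₀ (ha0 s') (hale s') 2
        _ = 82944 ^ 2 * δ ^ 2 * s' := by
            rw [mul_pow, mul_pow, Real.sq_sqrt (Nat.cast_nonneg s')]
            ring
        _ ≤ _ := by
            gcongr
            exact_mod_cast min_le_left (2 * s) n
    have h5 : a s' ≤ 82944 * (δ * (2 * Real.sqrt s)) := by
      refine (hale s').trans ?_
      gcongr
    have h6 : 0 ≤ δ * Real.sqrt s := by positivity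
    have h7 : 0 ≤ δ ^ 2 * s := by positivity
    nlinarith
  · rw [Finset.sum_const, Nat.card_Icc, nsmul_eq_mul]
    have h1 : Real.exp (-(q : ℝ)) ≤ Real.exp (-ν) * (n ^ 2 : ℝ)⁻¹ := by
      rw [← Real.exp_log (by positivity : (0 : ℝ) < n ^ 2), ← Real.exp_neg, ← Real.exp_add,
        Real.log_pow]
      apply Real.exp_le_exp.2
      have := Nat.le_ceil (ν + 2 * Real.log n)
      push_cast
      linarith
    calc ((n + 1 - 1 : ℕ) : ℝ) * Real.exp (-(q : ℝ)) ≤ n * (Real.exp (-ν) * (n ^ 2 : ℝ)⁻¹) := by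
          simp only [Nat.add_sub_cancel]
          gcongr
      _ = Real.exp (-ν) * (n : ℝ)⁻¹ := by field_simp
      _ ≤ Real.exp (-ν) * (2 : ℝ)⁻¹ := by gcongr
      _ = _ := by ring

end rip

/-- The soft maximum `log ∑ exp xᵢ`. -/
def lse {ι : Type*} [Fintype ι] (x : ι → ℝ) : ℝ := Real.log (∑ i, Real.exp (x i))

lemma sum_exp_pos {ι : Type*} [Fintype ι] [Nonempty ι] (x : ι → ℝ) :
    0 < ∑ i, Real.exp (x i) :=
  Finset.sum_pos (fun _ _ => Real.exp_pos _) Finset.univ_nonempty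

lemma le_lse {ι : Type*} [Fintype ι] [Nonempty ι] (x : ι → ℝ) (i : ι) : x i ≤ lse x := by
  rw [lse, Real.le_log_iff_exp_le (sum_exp_pos x)]
  exact Finset.single_le_sum (f := fun i => Real.exp (x i)) (fun j _ => (Real.exp_pos _).le)
    (Finset.mem_univ i)

lemma lse_le_of_forall_le {ι : Type*} [Fintype ι] [Nonempty ι] {x : ι → ℝ} {c : ℝ}
    (h : ∀ i, x i ≤ c) : lse x ≤ c + Real.log (Fintype.card ι) := by
  have hc : (0 : ℝ) < Fintype.card ι := by exact_mod_cast Fintype.card_pos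
  rw [lse, Real.log_le_iff_le_exp (sum_exp_pos x), Real.exp_add, Real.exp_log hc]
  calc ∑ i, Real.exp (x i) ≤ ∑ _i : ι, Real.exp c := by gcongr with i; exact h i
    _ = Real.exp c * Fintype.card ι := by simp [mul_comm]

lemma lse_le_add_norm {ι : Type*} [Fintype ι] [Nonempty ι] (x y : ι → ℝ) :
    lse x ≤ lse y + ‖x - y‖ := by
  rw [lse, Real.log_le_iff_le_exp (sum_exp_pos x), Real.exp_add, lse,
    Real.exp_log (sum_exp_pos y), Finset.sum_mul]
  gcongr with i
  rw [← Real.exp_add]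
  gcongr
  have := (le_abs_self _).trans (norm_le_pi_norm (x - y) i)
  simp only [Pi.sub_apply] at this
  linarith

lemma lipschitzWith_lse {ι : Type*} [Fintype ι] [Nonempty ι] :
    LipschitzWith 1 (lse : (ι → ℝ) → ℝ) := by
  refine LipschitzWith.of_le_add fun x y => ?_
  rw [dist_eq_norm]
  exact lse_le_add_norm x y

lemma abs_log_sum_mul_exp_sub_le {ι : Type*} [Fintype ι] {p x : ι → ℝ} {M : ℝ}
    (hp : ∀ i, 0 ≤ p i) (hp1 : ∑ i, p i = 1) (hx : ∀ i, |x i| ≤ M) :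
    |Real.log (∑ i, p i * Real.exp (x i)) - ∑ i, p i * x i
      - (∑ i, p i * x i ^ 2 - (∑ i, p i * x i) ^ 2) / 2| ≤ 36 * M ^ 3 := by
  have avg (f : ι → ℝ) (B : ℝ) (hf : ∀ i, |f i| ≤ B) : |∑ i, p i * f i| ≤ B := by
    calc |∑ i, p i * f i| ≤ ∑ i, |p i * f i| := Finset.abs_sum_le_sum_abs _ _
      _ ≤ ∑ i, p i * B := by
          gcongr with i
          rw [abs_mul, abs_of_nonneg (hp i)]
          exact mul_le_mul_of_nonneg_left (hf i) (hp i)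
      _ = B := by rw [← Finset.sum_mul, hp1, one_mul]
  have hM : 0 ≤ M := by
    have : Nonempty ι := by
      by_contra h
      rw [not_nonempty_iff] at h
      simp at hp1
    exact (abs_nonneg _).trans (hx (Classical.arbitrary ι))
  have hm := avg x M hx
  have hs := avg (fun i => x i ^ 2) (M ^ 2) (fun i => by
    rw [abs_pow]; exact pow_le_pow_left₀ (abs_nonneg _) (hx i) 2)
  set m := ∑ i, p i * x i
  set s := ∑ i, p i * x i ^ 2
  have hm2 : m ^ 2 ≤ M ^ 2 := by rw [← sq_abs]; exact pow_le_pow_left₀ (abs_nonneg _) hm 2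
  rw [abs_le] at hm hs
  rcases le_or_gt (1 / 4) M with h4 | h4
  · have hpos : 0 < ∑ i, p i * Real.exp (x i) := by
      have : Real.exp (-M) ≤ ∑ i, p i * Real.exp (x i) := by
        calc Real.exp (-M) = ∑ i, p i * Real.exp (-M) := by rw [← Finset.sum_mul, hp1, one_mul]
          _ ≤ _ := by
            gcongr with i
            · exact hp i
            · exact (abs_le.mp (hx i)).1
      exact (Real.exp_pos _).trans_le this
    have h1 : Real.log (∑ i, p i * Real.exp (x i)) ≤ M := by
      rw [Real.log_le_iff_le_exp hpos]
      calc _ ≤ ∑ i, p i * Real.exp M := by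
            gcongr with i
            · exact hp i
            · exact (abs_le.mp (hx i)).2
        _ = Real.exp M := by rw [← Finset.sum_mul, hp1, one_mul]
    have h2 : -M ≤ Real.log (∑ i, p i * Real.exp (x i)) := by
      rw [Real.le_log_iff_exp_le hpos]
      calc Real.exp (-M) = ∑ i, p i * Real.exp (-M) := by rw [← Finset.sum_mul, hp1, one_mul]
          _ ≤ _ := by
            gcongr with i
            · exact hp i
            · exact (abs_le.mp (hx i)).1
    have h3 : M ≤ 16 * M ^ 3 := by
      nlinarith [mul_nonneg hM (sub_nonneg.2 h4),
        mul_nonneg (mul_nonneg hM hM) (sub_nonneg.2 h4)]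
    have h5 : M ^ 2 ≤ 4 * M ^ 3 := by nlinarith [mul_nonneg (mul_nonneg hM hM) (sub_nonneg.2 h4)]
    rw [abs_le]
    constructor <;> nlinarith [sq_nonneg m]
  · have hexp := avg (fun i => Real.exp (x i) - 1 - x i - x i ^ 2 / 2) (M ^ 3) (fun i => by
      have h1 : |x i| ≤ 1 := (hx i).trans (by linarith)
      have := Real.exp_bound h1 (n := 3) (by norm_num)
      simp only [Finset.sum_range_succ, Finset.sum_range_zero, Nat.factorial] at this
      norm_num at this
      have h3 : |x i| ^ 3 ≤ M ^ 3 := pow_le_pow_left₀ (abs_nonneg _) (hx i) 3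
      have h4 : Real.exp (x i) - 1 - x i - x i ^ 2 / 2 = Real.exp (x i) - (1 + x i + x i ^ 2 / 2) := by
        ring
      rw [h4]
      refine this.trans ?_
      have : 0 ≤ |x i| ^ 3 := by positivity
      linarith)
    set z := ∑ i, p i * Real.exp (x i) - 1 with hz
    have hr : ∑ i, p i * (Real.exp (x i) - 1 - x i - x i ^ 2 / 2) = z - m - s / 2 := by
      simp only [mul_sub, Finset.sum_sub_distrib, mul_one, hp1, hz, m, s]
      rw [Finset.sum_div]
      simp [mul_div_assoc]
    rw [hr, abs_le] at hexp
    have hM2 : M ^ 2 ≤ M / 4 := by nlinarith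
    have hM3 : M ^ 3 ≤ M ^ 2 / 4 := by nlinarith [sq_nonneg M]
    have hz1 : |z| ≤ 6 / 5 * M := by rw [abs_le]; constructor <;> linarith
    have hz2 : |z| ≤ 3 / 10 := by linarith
    have hlog := Real.abs_log_sub_add_sum_range_le (x := -z) (by rw [abs_neg]; linarith) 2
    simp only [Finset.sum_range_succ, Finset.sum_range_zero, abs_neg] at hlog
    norm_num at hlog
    have hzz : (1 : ℝ) + z = ∑ i, p i * Real.exp (x i) := by rw [hz]; ring
    rw [hzz] at hlog
    have hz3 : |z| ^ 3 / (1 - |z|) ≤ 3 * M ^ 3 := by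
      rw [div_le_iff₀ (by linarith)]
      have : |z| ^ 3 ≤ (6 / 5 * M) ^ 3 := pow_le_pow_left₀ (abs_nonneg _) hz1 3
      have h0 : 0 ≤ M ^ 3 := by positivity
      nlinarith
    have hlog := abs_le.mp (hlog.trans hz3)
    have hq : |(z - m) * (z + m)| ≤ 2 * M ^ 3 := by
      rw [abs_mul]
      have h1 : |z - m| ≤ 3 / 4 * M ^ 2 := by rw [abs_le]; constructor <;> linarith
      have h2 : |z + m| ≤ 11 / 5 * M := by
        rw [abs_le] at hz1 ⊢; constructor <;> linarith
      calc |z - m| * |z + m| ≤ (3 / 4 * M ^ 2) * (11 / 5 * M) := by gcongr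
        _ ≤ 2 * M ^ 3 := by nlinarith [pow_nonneg hM 3]
    have hq := abs_le.mp hq
    have h0 : 0 ≤ M ^ 3 := by positivity
    rw [abs_le]
    constructor <;> nlinarith

/-- Second order expansion of the soft maximum. -/
lemma exists_lse_expansion {ι : Type*} [Fintype ι] [Nonempty ι] (w : ι → ℝ) :
    ∃ p : ι → ℝ, (∀ i, 0 ≤ p i) ∧ ∀ x : ι → ℝ,
      |lse (w + x) - lse w - ∑ i, p i * x i
        - (∑ i, ∑ j, p i * p j * (x i - x j) ^ 2) / 4| ≤ 36 * ‖x‖ ^ 3 := by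
  have hS := sum_exp_pos w
  refine ⟨fun i => Real.exp (w i) / ∑ j, Real.exp (w j), fun i => by positivity, fun x => ?_⟩
  set p : ι → ℝ := fun i => Real.exp (w i) / ∑ j, Real.exp (w j)
  have hp1 : ∑ i, p i = 1 := by
    rw [← Finset.sum_div, div_self hS.ne']
  have h := abs_log_sum_mul_exp_sub_le (p := p) (x := x) (M := ‖x‖) (fun i => by positivity) hp1
    (fun i => norm_le_pi_norm x i)
  have h1 : lse (w + x) - lse w = Real.log (∑ i, p i * Real.exp (x i)) := by
    rw [lse, lse, ← Real.log_div (sum_exp_pos _).ne' hS.ne', Finset.sum_div]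
    congr 1
    refine Finset.sum_congr rfl fun i _ => ?_
    simp only [p, Pi.add_apply, Real.exp_add]
    ring
  have h2 : ∑ i, ∑ j, p i * p j * (x i - x j) ^ 2
      = 2 * (∑ i, p i * x i ^ 2 - (∑ i, p i * x i) ^ 2) := by
    have e (i j : ι) : p i * p j * (x i - x j) ^ 2
        = (p i * x i ^ 2) * p j + p i * (p j * x j ^ 2) - 2 * ((p i * x i) * (p j * x j)) := by ring
    simp only [e, Finset.sum_sub_distrib, Finset.sum_add_distrib, ← Finset.mul_sum,
      ← Finset.sum_mul, hp1]
    ring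
  rw [h1, h2]
  convert h using 2
  ring

section

open MeasureTheory ProbabilityTheory

set_option linter.unusedSectionVars false

/-- Average of `φ` around `w` with respect to the dilation of `P` by `a`. -/
def smoothing {E : Type*} [NormedAddCommGroup E] [NormedSpace ℝ E] [MeasurableSpace E]
    (P : Measure E) (a : ℝ) (φ : E → ℝ) (w : E) : ℝ := ∫ x, φ (w + a • x) ∂P

section Smoothing

variable {E : Type*} [NormedAddCommGroup E] [NormedSpace ℝ E] [MeasurableSpace E] [BorelSpace E]
  [SecondCountableTopology E] [CompleteSpace E]

lemma integrable_norm_of_isGaussian (P : Measure E) [IsGaussian P] :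
    Integrable (fun x => ‖x‖) P := IsGaussian.integrable_id.norm

lemma abs_le_of_lipschitzWith_one {φ : E → ℝ} (hφ : LipschitzWith 1 φ) (x : E) :
    |φ x| ≤ |φ 0| + ‖x‖ := by
  have h := hφ.dist_le_mul x 0
  rw [Real.dist_eq, dist_zero_right, NNReal.coe_one, one_mul] at h
  have := abs_sub_abs_le_abs_sub (φ x) (φ 0)
  linarith

lemma integrable_of_lipschitzWith_one (P : Measure E) [IsGaussian P] {φ : E → ℝ}
    (hφ : LipschitzWith 1 φ) (w : E) (a : ℝ) : Integrable (fun x => φ (w + a • x)) P := by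
  refine Integrable.mono' (g := fun x => |φ 0| + (‖w‖ + |a| * ‖x‖)) ?_ ?_ (ae_of_all _ fun x => ?_)
  · exact (integrable_const _).add
      ((integrable_const _).add ((integrable_norm_of_isGaussian P).const_mul _))
  · have : Continuous fun x => φ (w + a • x) := hφ.continuous.comp (by fun_prop)
    exact this.aestronglyMeasurable
  · refine (abs_le_of_lipschitzWith_one hφ _).trans ?_
    gcongr
    refine (norm_add_le _ _).trans ?_
    rw [norm_smul, Real.norm_eq_abs]

lemma smoothing_zero (P : Measure E) [IsGaussian P] (φ : E → ℝ) (w : E) :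
    smoothing P 0 φ w = φ w := by
  simp [smoothing]

lemma lipschitzWith_smoothing (P : Measure E) [IsGaussian P] {φ : E → ℝ}
    (hφ : LipschitzWith 1 φ) (a : ℝ) : LipschitzWith 1 (smoothing P a φ) := by
  refine LipschitzWith.of_le_add fun x y => ?_
  have h : ∫ z, (φ (y + a • z) + dist x y) ∂P = smoothing P a φ y + dist x y := by
    rw [integral_add (integrable_of_lipschitzWith_one P hφ y a) (integrable_const _)]
    simp [smoothing]
  rw [← h]
  refine integral_mono (integrable_of_lipschitzWith_one P hφ x a)
    ((integrable_of_lipschitzWith_one P hφ y a).add (integrable_const _)) fun z => ?_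
  have := hφ.dist_le_mul (x + a • z) (y + a • z)
  rw [Real.dist_eq, NNReal.coe_one, one_mul, dist_add_right] at this
  have := (le_abs_self _).trans this
  simp only
  linarith

lemma smoothing_le_add (P : Measure E) [IsGaussian P] {φ ψ : E → ℝ}
    (hφ : LipschitzWith 1 φ) (hψ : LipschitzWith 1 ψ) {c : ℝ} (h : ∀ x, φ x ≤ ψ x + c)
    (a : ℝ) (w : E) : smoothing P a φ w ≤ smoothing P a ψ w + c := by
  have h' : ∫ z, (ψ (w + a • z) + c) ∂P = smoothing P a ψ w + c := by
    rw [integral_add (integrable_of_lipschitzWith_one P hψ w a) (integrable_const _)]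
    simp [smoothing]
  rw [← h']
  exact integral_mono (integrable_of_lipschitzWith_one P hφ w a)
    ((integrable_of_lipschitzWith_one P hψ w a).add (integrable_const _)) fun z => h _

lemma integrable_prod_of_lipschitzWith_one (P Q : Measure E) [IsGaussian P] [IsGaussian Q]
    {φ : E → ℝ} (hφ : LipschitzWith 1 φ) (w : E) (a b : ℝ) :
    Integrable (fun z : E × E => φ (w + a • z.1 + b • z.2)) (P.prod Q) := by
  refine Integrable.mono' (g := fun z => |φ 0| + (‖w‖ + |a| * ‖z.1‖ + |b| * ‖z.2‖)) ?_ ?_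
    (ae_of_all _ fun x => ?_)
  · refine (integrable_const _).add (((integrable_const _).add ?_).add ?_)
    · exact ((integrable_norm_of_isGaussian P).comp_fst Q).const_mul _
    · exact ((integrable_norm_of_isGaussian Q).comp_snd P).const_mul _
  · have : Continuous fun z : E × E => φ (w + a • z.1 + b • z.2) :=
      hφ.continuous.comp (by fun_prop)
    exact this.aestronglyMeasurable
  · refine (abs_le_of_lipschitzWith_one hφ _).trans ?_
    gcongr
    refine (norm_add_le _ _).trans (add_le_add ((norm_add_le _ _).trans (add_le_add le_rfl ?_)) ?_)
      <;> rw [norm_smul, Real.norm_eq_abs]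

lemma smoothing_smoothing_eq_integral_prod (P Q : Measure E) [IsGaussian P] [IsGaussian Q]
    {φ : E → ℝ} (hφ : LipschitzWith 1 φ) (w : E) (a b : ℝ) :
    smoothing P a (smoothing Q b φ) w
      = ∫ z : E × E, φ (w + a • z.1 + b • z.2) ∂(P.prod Q) := by
  rw [integral_prod _ (integrable_prod_of_lipschitzWith_one P Q hφ w a b)]
  rfl

lemma smoothing_comm (P Q : Measure E) [IsGaussian P] [IsGaussian Q]
    {φ : E → ℝ} (hφ : LipschitzWith 1 φ) (w : E) (a b : ℝ) :
    smoothing P a (smoothing Q b φ) w = smoothing Q b (smoothing P a φ) w := by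
  rw [smoothing_smoothing_eq_integral_prod P Q hφ,
    integral_prod_symm _ (integrable_prod_of_lipschitzWith_one P Q hφ w a b)]
  simp only [smoothing, add_right_comm]

lemma smoothing_smoothing_self (P : Measure E) [IsGaussian P] (hP : ∫ x, x ∂P = 0)
    {φ : E → ℝ} (hφ : LipschitzWith 1 φ) (w : E) {a b r : ℝ} (hr : 0 < r)
    (hab : a ^ 2 + b ^ 2 = r ^ 2) :
    smoothing P a (smoothing P b φ) w = smoothing P r φ w := by
  rw [smoothing_smoothing_eq_integral_prod P P hφ]
  obtain ⟨θ, hθ1, hθ2⟩ : ∃ θ, a = r * Real.cos θ ∧ b = r * Real.sin θ := by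
    refine ⟨Complex.arg (⟨a, b⟩ : ℂ), ?_⟩
    have hn : ‖(⟨a, b⟩ : ℂ)‖ = r := by
      rw [Complex.norm_eq_sqrt_sq_add_sq, hab, Real.sqrt_sq hr.le]
    constructor
    · rw [← hn, Complex.norm_mul_cos_arg]
    · rw [← hn, Complex.norm_mul_sin_arg]
  have hrot := IsGaussian.map_rotation_eq_self (μ := P) (by simpa using hP) θ
  have h1 : smoothing P r φ w = ∫ z : E × E, φ (w + r • z.1) ∂(P.prod P) := by
    rw [integral_fun_fst (fun x => φ (w + r • x))]
    simp [smoothing]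
  rw [h1]
  conv_rhs => rw [← hrot]
  rw [integral_map (by fun_prop)]
  · refine integral_congr_ae (ae_of_all _ fun z => ?_)
    simp only [ContinuousLinearMap.rotation_apply, smul_add, smul_smul, hθ1, hθ2, add_assoc]
  · have : Continuous fun z : E × E => φ (w + r • z.1) := hφ.continuous.comp (by fun_prop)
    exact this.aestronglyMeasurable

end Smoothing

section Comparison

variable {ι : Type*} [Fintype ι] [Nonempty ι]

lemma integrable_norm_pow_three (P : Measure (ι → ℝ)) [IsGaussian P] :
    Integrable (fun x => ‖x‖ ^ 3) P := by
  have := (IsGaussian.memLp_id P 3 (by norm_num)).integrable_norm_pow (by norm_num)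
  simpa using this

lemma integrable_sub_sq (P : Measure (ι → ℝ)) [IsGaussian P] (i j : ι) :
    Integrable (fun x => (x i - x j) ^ 2) P := by
  have h := IsGaussian.memLp_dual P
    (ContinuousLinearMap.proj (R := ℝ) (φ := fun _ : ι => ℝ) i - ContinuousLinearMap.proj j) 2
    (by norm_num)
  exact h.integrable_sq

lemma abs_smoothing_lse_sub_le (w : ι → ℝ) :
    ∃ p : ι → ℝ, (∀ i, 0 ≤ p i) ∧ ∀ (P : Measure (ι → ℝ)) [IsGaussian P], (∫ x, x ∂P = 0) →
      ∀ h : ℝ, |smoothing P h lse w - lse w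
        - (∑ i, ∑ j, p i * p j * ∫ x, (x i - x j) ^ 2 ∂P) * (h ^ 2 / 4)|
        ≤ 36 * |h| ^ 3 * ∫ x, ‖x‖ ^ 3 ∂P := by
  obtain ⟨p, hp, hexp⟩ := exists_lse_expansion w
  refine ⟨p, hp, fun P _ hP h => ?_⟩
  have hi1 := integrable_of_lipschitzWith_one P (lipschitzWith_lse (ι := ι)) w h
  have hlin : Integrable (fun x : ι → ℝ => ∑ i, p i * (h * x i)) P :=
    integrable_finsetSum _ fun i _ => by
      have := IsGaussian.integrable_dual P (ContinuousLinearMap.proj (R := ℝ) (φ := fun _ : ι => ℝ) i)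
      exact (this.const_mul h).const_mul (p i)
  have hlin0 : ∫ x : ι → ℝ, ∑ i, p i * (h * x i) ∂P = 0 := by
    rw [integral_finsetSum]
    · refine Finset.sum_eq_zero fun i _ => ?_
      rw [integral_const_mul, integral_const_mul]
      have := IsGaussian.integral_dual (μ := P)
        (ContinuousLinearMap.proj (R := ℝ) (φ := fun _ : ι => ℝ) i)
      simp only [ContinuousLinearMap.proj_apply, hP] at this
      rw [this]
      simp
    · intro i _
      have := IsGaussian.integrable_dual P (ContinuousLinearMap.proj (R := ℝ) (φ := fun _ : ι => ℝ) i)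
      exact (this.const_mul h).const_mul (p i)
  have hq : Integrable (fun x : ι → ℝ => ∑ i, ∑ j, p i * p j * (x i - x j) ^ 2) P :=
    integrable_finsetSum _ fun i _ => integrable_finsetSum _ fun j _ =>
      (integrable_sub_sq P i j).const_mul _
  have hq0 : ∫ x : ι → ℝ, ∑ i, ∑ j, p i * p j * (x i - x j) ^ 2 ∂P
      = ∑ i, ∑ j, p i * p j * ∫ x, (x i - x j) ^ 2 ∂P := by
    rw [integral_finsetSum]
    · refine Finset.sum_congr rfl fun i _ => ?_
      rw [integral_finsetSum]
      · simp only [integral_const_mul]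
      · exact fun j _ => (integrable_sub_sq P i j).const_mul _
    · exact fun i _ => integrable_finsetSum _ fun j _ => (integrable_sub_sq P i j).const_mul _
  have key : smoothing P h lse w - lse w
        - (∑ i, ∑ j, p i * p j * ∫ x, (x i - x j) ^ 2 ∂P) * (h ^ 2 / 4)
      = ∫ x, (lse (w + h • x) - lse w - ∑ i, p i * (h * x i)
          - (∑ i, ∑ j, p i * p j * (x i - x j) ^ 2) * (h ^ 2 / 4)) ∂P := by
    have hi2 : Integrable (fun x => lse (w + h • x) - lse w) P := hi1.sub (integrable_const _)
    have hi3 : Integrable (fun x => lse (w + h • x) - lse w - ∑ i, p i * (h * x i)) P :=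
      hi2.sub hlin
    rw [integral_sub hi3 (hq.mul_const _), integral_sub hi2 hlin,
      integral_sub hi1 (integrable_const _), hlin0, integral_mul_const, hq0]
    simp [smoothing]
  rw [key, ← integral_const_mul]
  refine (abs_integral_le_integral_abs).trans (integral_mono ?_ ?_ fun x => ?_)
  · exact (((hi1.sub (integrable_const _)).sub hlin).sub (hq.mul_const _)).abs
  · exact (integrable_norm_pow_three P).const_mul _
  · have := hexp (h • x)
    rw [norm_smul, mul_pow, Real.norm_eq_abs, ← mul_assoc] at this
    refine le_trans (le_of_eq ?_) this
    congr 1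
    simp only [Pi.smul_apply, smul_eq_mul, ← mul_sub, mul_pow]
    rw [Finset.sum_mul, Finset.sum_div]
    congr 1
    refine Finset.sum_congr rfl fun i _ => ?_
    rw [Finset.sum_mul, Finset.sum_div]
    refine Finset.sum_congr rfl fun j _ => ?_
    ring

/-- **Sudakov–Fernique comparison** for the soft maximum. -/
lemma smoothing_lse_le_smoothing_lse (P Q : Measure (ι → ℝ)) [IsGaussian P] [IsGaussian Q]
    (hP : ∫ x, x ∂P = 0) (hQ : ∫ x, x ∂Q = 0)
    (hcmp : ∀ i j, ∫ x, (x i - x j) ^ 2 ∂Q ≤ ∫ x, (x i - x j) ^ 2 ∂P) {a : ℝ} (ha : 0 < a) :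
    smoothing Q a lse 0 ≤ smoothing P a lse 0 := by
  set B := 36 * (∫ x, ‖x‖ ^ 3 ∂P) + 36 * ∫ x, ‖x‖ ^ 3 ∂Q with hB
  have step (h : ℝ) (hh : 0 < h) (w : ι → ℝ) :
      smoothing Q h lse w ≤ smoothing P h lse w + B * h ^ 3 := by
    obtain ⟨p, hp, hexp⟩ := abs_smoothing_lse_sub_le w
    have h1 := abs_le.mp (hexp P hP h)
    have h2 := abs_le.mp (hexp Q hQ h)
    have h3 : (∑ i, ∑ j, p i * p j * ∫ x, (x i - x j) ^ 2 ∂Q) * (h ^ 2 / 4)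
        ≤ (∑ i, ∑ j, p i * p j * ∫ x, (x i - x j) ^ 2 ∂P) * (h ^ 2 / 4) := by
      refine mul_le_mul_of_nonneg_right (Finset.sum_le_sum fun i _ => Finset.sum_le_sum fun j _ =>
        mul_le_mul_of_nonneg_left (hcmp i j) (mul_nonneg (hp i) (hp j))) (by positivity)
    rw [abs_of_pos hh] at h1 h2
    rw [hB]
    linarith
  have iter (h : ℝ) (hh : 0 < h) (k : ℕ) : ∀ w : ι → ℝ,
      smoothing Q (√k * h) lse w ≤ smoothing P (√k * h) lse w + k * (B * h ^ 3) := by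
    have hl := lipschitzWith_lse (ι := ι)
    induction k with
    | zero => intro w; simp [smoothing_zero]
    | succ k ih =>
      intro w
      have hr : 0 < √((k + 1 : ℕ) : ℝ) * h := by positivity
      have hab : (√(k : ℝ) * h) ^ 2 + h ^ 2 = (√((k + 1 : ℕ) : ℝ) * h) ^ 2 := by
        rw [mul_pow, mul_pow, Real.sq_sqrt (by positivity), Real.sq_sqrt (by positivity)]
        push_cast; ring
      rw [← smoothing_smoothing_self Q hQ hl w hr hab,
        ← smoothing_smoothing_self P hP hl w hr ((add_comm _ _).trans hab)]
      have h1 := smoothing_le_add Q (lipschitzWith_smoothing Q hl h) (lipschitzWith_smoothing P hl h)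
        (step h hh) (√k * h) w
      rw [smoothing_comm Q P hl] at h1
      have h2 := smoothing_le_add P (lipschitzWith_smoothing Q hl (√k * h))
        (lipschitzWith_smoothing P hl (√k * h)) ih h w
      push_cast
      linarith
  have bound (N : ℕ) : smoothing Q a lse 0 ≤ smoothing P a lse 0 + B * a ^ 3 * (1 / √((N : ℝ) + 1)) := by
    have hN : (0 : ℝ) < √((N : ℝ) + 1) := by positivity
    have h := iter (a / √((N : ℝ) + 1)) (by positivity) (N + 1) 0
    push_cast at h
    rw [mul_div_cancel₀ _ hN.ne'] at h
    refine h.trans (le_of_eq ?_)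
    congr 1
    have hs : ((N : ℝ) + 1) = √((N : ℝ) + 1) ^ 2 := by rw [Real.sq_sqrt (by positivity)]
    generalize √((N : ℝ) + 1) = s at *
    rw [hs]
    field_simp
  have hlim : Filter.Tendsto (fun N : ℕ => smoothing P a lse 0 + B * a ^ 3 * (1 / √((N : ℝ) + 1)))
      Filter.atTop (nhds (smoothing P a lse 0 + B * a ^ 3 * 0)) := by
    refine (Filter.Tendsto.const_mul _ ?_).const_add _
    simp only [one_div]
    refine Filter.Tendsto.inv_tendsto_atTop (Real.tendsto_sqrt_atTop.comp ?_)
    exact Filter.tendsto_atTop_add_const_right _ _ tendsto_natCast_atTop_atTop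
  rw [mul_zero, add_zero] at hlim
  exact ge_of_tendsto' hlim bound

lemma lipschitzWith_iSup : LipschitzWith 1 (fun x : ι → ℝ => ⨆ i, x i) := by
  refine LipschitzWith.of_le_add fun x y => ciSup_le fun i => ?_
  have h1 := (le_abs_self _).trans (norm_le_pi_norm (x - y) i)
  have h2 := le_ciSup (Set.finite_range y).bddAbove i
  rw [dist_eq_norm]
  simp only [Pi.sub_apply] at h1
  linarith

lemma integrable_iSup (P : Measure (ι → ℝ)) [IsGaussian P] :
    Integrable (fun x : ι → ℝ => ⨆ i, x i) P := by
  simpa using integrable_of_lipschitzWith_one P (lipschitzWith_iSup (ι := ι)) 0 1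

/-- **Sudakov–Fernique inequality**. -/
lemma integral_iSup_le_integral_iSup (P Q : Measure (ι → ℝ)) [IsGaussian P] [IsGaussian Q]
    (hP : ∫ x, x ∂P = 0) (hQ : ∫ x, x ∂Q = 0)
    (hcmp : ∀ i j, ∫ x, (x i - x j) ^ 2 ∂Q ≤ ∫ x, (x i - x j) ^ 2 ∂P) :
    ∫ x, ⨆ i, x i ∂Q ≤ ∫ x, ⨆ i, x i ∂P := by
  refine le_of_forall_pos_le_add fun ε hε => ?_
  set L := Real.log (Fintype.card ι)
  have hL : 0 ≤ L := Real.log_natCast_nonneg _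
  set a := (L + 1) / ε
  have ha : 0 < a := by positivity
  have h := smoothing_lse_le_smoothing_lse P Q hP hQ hcmp ha
  have h1 : a * ∫ x, ⨆ i, x i ∂Q ≤ smoothing Q a lse 0 := by
    rw [← integral_const_mul]
    refine integral_mono ((integrable_iSup Q).const_mul a)
      (integrable_of_lipschitzWith_one Q lipschitzWith_lse 0 a) fun x => ?_
    simp only
    rw [← le_div_iff₀' ha]
    refine ciSup_le fun i => ?_
    rw [le_div_iff₀' ha]
    have := le_lse (0 + a • x) i
    simpa using this
  have h2 : smoothing P a lse 0 ≤ a * (∫ x, ⨆ i, x i ∂P) + L := by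
    have : a * (∫ x, ⨆ i, x i ∂P) + L = ∫ x, (a * (⨆ i, x i) + L) ∂P := by
      rw [integral_add ((integrable_iSup P).const_mul a) (integrable_const _), integral_const_mul]
      simp
    rw [this]
    refine integral_mono (integrable_of_lipschitzWith_one P lipschitzWith_lse 0 a)
      (((integrable_iSup P).const_mul a).add (integrable_const _)) fun x => ?_
    refine lse_le_of_forall_le fun i => ?_
    simp only [Pi.add_apply, Pi.zero_apply, zero_add, Pi.smul_apply, smul_eq_mul]
    gcongr
    exact le_ciSup (Set.finite_range x).bddAbove i
  have h3 : a * ε = L + 1 := by simp only [a]; field_simp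
  have h4 : a * (∫ x, ⨆ i, x i ∂Q) ≤ a * ((∫ x, ⨆ i, x i ∂P) + ε) := by
    rw [mul_add]; linarith
  exact le_of_mul_le_mul_left h4 ha

end Comparison

end

section

open MeasureTheory ProbabilityTheory

set_option linter.unusedSectionVars false

/-- The standard Gaussian measure on `κ → ℝ`. -/
def stdGauss (κ : Type*) [Fintype κ] : Measure (κ → ℝ) := Measure.pi fun _ => gaussianReal 0 1

lemma isGaussian_pi {κ : Type*} [Fintype κ] {E : κ → Type*} [∀ i, NormedAddCommGroup (E i)]
    [∀ i, NormedSpace ℝ (E i)] [∀ i, MeasurableSpace (E i)] [∀ i, BorelSpace (E i)]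
    [∀ i, SecondCountableTopology (E i)] [∀ i, CompleteSpace (E i)]
    (ρ : ∀ i, Measure (E i)) [∀ i, IsGaussian (ρ i)] : IsGaussian (Measure.pi ρ) := by
  have h1 : iIndepFun (fun i (ω : ∀ i, E i) => ω i) (Measure.pi ρ) :=
    iIndepFun_pi (X := fun _ => id) fun _ => aemeasurable_id
  have h2 : ∀ i, HasGaussianLaw (fun ω : ∀ i, E i => ω i) (Measure.pi ρ) := fun i =>
    ⟨by rw [(measurePreserving_eval ρ i).map_eq]; infer_instance⟩
  have h3 := (iIndepFun.hasGaussianLaw h2 h1).isGaussian_map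
  simpa using h3

instance (κ : Type*) [Fintype κ] : IsGaussian (stdGauss κ) :=
  isGaussian_pi fun _ => gaussianReal 0 1

lemma integral_pi_eq_zero {κ : Type*} [Fintype κ] {E : Type*} [NormedAddCommGroup E]
    [NormedSpace ℝ E] [MeasurableSpace E] [BorelSpace E]
    [SecondCountableTopology E] [CompleteSpace E]
    (ρ : Measure E) [IsGaussian ρ] (hρ : ∫ x, x ∂ρ = 0) :
    ∫ x : κ → E, x ∂(Measure.pi fun _ => ρ) = 0 := by
  have := isGaussian_pi fun _ : κ => ρ
  ext i
  have h := (ContinuousLinearMap.proj (R := ℝ) (φ := fun _ : κ => E) i).integral_comp_comm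
    (IsGaussian.integrable_id (μ := Measure.pi fun _ : κ => ρ))
  simp only [ContinuousLinearMap.proj_apply, id] at h
  rw [Pi.zero_apply, ← h]
  have h2 := (measurePreserving_eval (fun _ : κ => ρ) i).map_eq
  rw [← hρ]
  conv_rhs => rw [← h2]
  rw [integral_map (measurable_pi_apply i).aemeasurable (by rw [h2]; fun_prop)]

lemma integral_stdGauss (κ : Type*) [Fintype κ] : ∫ x, x ∂(stdGauss κ) = 0 :=
  integral_pi_eq_zero _ (by simp)

lemma memLp_dotProduct {κ : Type*} [Fintype κ] (a : κ → ℝ) :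
    MemLp (fun g : κ → ℝ => a ⬝ᵥ g) 2 (stdGauss κ) := by
  have h := IsGaussian.memLp_dual (stdGauss κ)
    (∑ i, a i • ContinuousLinearMap.proj (R := ℝ) (φ := fun _ : κ => ℝ) i) 2 (by norm_num)
  convert h using 1
  ext g
  simp [dotProduct]

lemma integrable_dotProduct {κ : Type*} [Fintype κ] (a : κ → ℝ) :
    Integrable (fun g : κ → ℝ => a ⬝ᵥ g) (stdGauss κ) :=
  (memLp_dotProduct a).integrable (by norm_num)

lemma integral_dotProduct {κ : Type*} [Fintype κ] (a : κ → ℝ) :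
    ∫ g : κ → ℝ, a ⬝ᵥ g ∂(stdGauss κ) = 0 := by
  have h := IsGaussian.integral_dual (μ := stdGauss κ)
    (∑ i, a i • ContinuousLinearMap.proj (R := ℝ) (φ := fun _ : κ => ℝ) i)
  rw [integral_stdGauss, map_zero] at h
  rw [← h]
  congr
  ext g
  simp [dotProduct]

lemma variance_dotProduct {κ : Type*} [Fintype κ] (a : κ → ℝ) :
    Var[fun g : κ → ℝ => a ⬝ᵥ g; stdGauss κ] = ∑ i, a i ^ 2 := by
  have h := variance_sum_pi (ι := κ) (Ω := fun _ => ℝ) (μ := fun _ => gaussianReal 0 1)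
    (X := fun i ω => a i * ω) fun i =>
      (memLp_id_gaussianReal (μ := 0) (v := 1) 2).const_mul (a i)
  have e : (∑ i, fun ω : κ → ℝ => a i * ω i) = fun g : κ → ℝ => a ⬝ᵥ g := by
    ext g; simp [dotProduct]
  rw [e] at h
  rw [stdGauss, h]
  refine Finset.sum_congr rfl fun i _ => ?_
  rw [variance_const_mul]
  have := variance_fun_id_gaussianReal (μ := 0) (v := 1)
  simp [this]

section LinearImage

variable {ι E F : Type*} [Fintype ι] [NormedAddCommGroup E] [NormedSpace ℝ E]
  [MeasurableSpace E] [BorelSpace E] [SecondCountableTopology E] [CompleteSpace E]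
  [NormedAddCommGroup F] [NormedSpace ℝ F] [MeasurableSpace F] [BorelSpace F]
  [SecondCountableTopology F] [CompleteSpace F]

lemma integral_map_eq_zero (ρ : Measure E) [IsGaussian ρ] (hρ : ∫ x, x ∂ρ = 0)
    (T : E →L[ℝ] (ι → ℝ)) : ∫ x, x ∂(ρ.map T) = 0 := by
  rw [integral_map (by fun_prop) (by fun_prop)]
  have := T.integral_comp_comm (IsGaussian.integrable_id (μ := ρ))
  simp only [id, hρ, map_zero] at this
  exact this

lemma integral_sub_sq_map (ρ : Measure E) [IsGaussian ρ] (hρ : ∫ x, x ∂ρ = 0)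
    (T : E →L[ℝ] (ι → ℝ)) (i j : ι) :
    ∫ x, (x i - x j) ^ 2 ∂(ρ.map T) = Var[fun x => T x i - T x j; ρ] := by
  rw [integral_map (by fun_prop) (by fun_prop), variance_of_integral_eq_zero (by fun_prop)]
  have h1 := IsGaussian.integral_dual (μ := ρ)
    ((ContinuousLinearMap.proj (R := ℝ) (φ := fun _ : ι => ℝ) i
      - ContinuousLinearMap.proj j).comp T)
  rw [hρ, map_zero] at h1
  exact h1

lemma integral_iSup_map [Nonempty ι] (ρ : Measure E) (T : E →L[ℝ] (ι → ℝ)) :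
    ∫ x, ⨆ i, x i ∂(ρ.map T) = ∫ x, ⨆ i, T x i ∂ρ := by
  rw [integral_map (by fun_prop) (lipschitzWith_iSup.continuous.aestronglyMeasurable)]

lemma integrable_iSup_map [Nonempty ι] (ρ : Measure E) [IsGaussian ρ] (T : E →L[ℝ] (ι → ℝ)) :
    Integrable (fun x => ⨆ i, T x i) ρ := by
  have h := integrable_iSup (ρ.map T)
  rwa [integrable_map_measure (lipschitzWith_iSup.continuous.aestronglyMeasurable)
    (by fun_prop)] at h

lemma integral_iSup_le_integral_iSup_of_variance_le [Nonempty ι]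
    (ρ : Measure E) (τ : Measure F) [IsGaussian ρ] [IsGaussian τ]
    (hρ : ∫ x, x ∂ρ = 0) (hτ : ∫ x, x ∂τ = 0) (T : E →L[ℝ] (ι → ℝ)) (T' : F →L[ℝ] (ι → ℝ))
    (h : ∀ i j, Var[fun y => T' y i - T' y j; τ] ≤ Var[fun x => T x i - T x j; ρ]) :
    ∫ y, ⨆ i, T' y i ∂τ ≤ ∫ x, ⨆ i, T x i ∂ρ := by
  rw [← integral_iSup_map, ← integral_iSup_map]
  refine integral_iSup_le_integral_iSup _ _ (integral_map_eq_zero ρ hρ T)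
    (integral_map_eq_zero τ hτ T') fun i j => ?_
  rw [integral_sub_sq_map τ hτ, integral_sub_sq_map ρ hρ]
  exact h i j

end LinearImage

end

section

open MeasureTheory ProbabilityTheory

/-- The Gaussian mean width of a finite set. -/
def gwid {n : ℕ} (A : Finset (Fin n → ℝ)) : ℝ :=
  ∫ g, ⨆ x : A, (x : Fin n → ℝ) ⬝ᵥ g ∂(stdGauss (Fin n))

/-- The linear map `g ↦ (aᵢ · g)ᵢ`. -/
def dotMap {n : ℕ} {ι : Type*} [Fintype ι] (a : ι → Fin n → ℝ) : (Fin n → ℝ) →L[ℝ] (ι → ℝ) :=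
  LinearMap.toContinuousLinearMap (Matrix.mulVecLin (Matrix.of a))

lemma dotMap_apply {n : ℕ} {ι : Type*} [Fintype ι] (a : ι → Fin n → ℝ) (g : Fin n → ℝ) (i : ι) :
    dotMap a g i = a i ⬝ᵥ g := by
  simp [dotMap, Matrix.mulVec]

lemma integrable_iSup_dotProduct {n : ℕ} {ι : Type*} [Fintype ι] [Nonempty ι]
    (a : ι → Fin n → ℝ) : Integrable (fun g => ⨆ i, a i ⬝ᵥ g) (stdGauss (Fin n)) := by
  simpa only [dotMap_apply] using integrable_iSup_map (stdGauss (Fin n)) (dotMap a)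

lemma gwid_mono {n : ℕ} {A B : Finset (Fin n → ℝ)} (hA : A.Nonempty) (hAB : A ⊆ B) :
    gwid A ≤ gwid B := by
  have : Nonempty A := hA.to_subtype
  have : Nonempty B := (hA.mono hAB).to_subtype
  refine integral_mono (integrable_iSup_dotProduct _) (integrable_iSup_dotProduct _) fun g => ?_
  refine ciSup_le fun x => ?_
  exact le_ciSup (f := fun x : B => (x : Fin n → ℝ) ⬝ᵥ g) (Set.finite_range _).bddAbove
    ⟨x, hAB x.2⟩

lemma gwid_nonneg {n : ℕ} {A : Finset (Fin n → ℝ)} (hA : A.Nonempty) : 0 ≤ gwid A := by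
  obtain ⟨x, hx⟩ := hA
  have : Nonempty A := ⟨⟨x, hx⟩⟩
  rw [← integral_dotProduct x]
  refine integral_mono (integrable_dotProduct x) (integrable_iSup_dotProduct _) fun g => ?_
  exact le_ciSup (f := fun x : A => (x : Fin n → ℝ) ⬝ᵥ g) (Set.finite_range _).bddAbove ⟨x, hx⟩

lemma gwid_eq_integral_sub {n : ℕ} {A : Finset (Fin n → ℝ)} (hA : A.Nonempty) (t : Fin n → ℝ) :
    ∫ g, ⨆ x : A, ((x : Fin n → ℝ) - t) ⬝ᵥ g ∂(stdGauss (Fin n)) = gwid A := by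
  have : Nonempty A := hA.to_subtype
  have h : ∀ g : Fin n → ℝ, ⨆ x : A, ((x : Fin n → ℝ) - t) ⬝ᵥ g
      = (⨆ x : A, (x : Fin n → ℝ) ⬝ᵥ g) - t ⬝ᵥ g := by
    intro g
    simp only [sub_dotProduct]
    rw [ciSup_sub (Set.finite_range _).bddAbove]
  simp only [h]
  rw [integral_sub (integrable_iSup_dotProduct _) (integrable_dotProduct t), integral_dotProduct,
    sub_zero, gwid]

/-- The mean absolute value of a standard Gaussian variable. -/
def gaussAbs : ℝ := ∫ x, |x| ∂(gaussianReal 0 1)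

lemma gaussAbs_pos : 0 < gaussAbs := by
  have hInt : Integrable (fun x : ℝ => |x|) (gaussianReal 0 1) :=
    ((memLp_id_gaussianReal (μ := 0) (v := 1) 1).integrable (by norm_num)).abs
  refine lt_of_le_of_ne (integral_nonneg fun x => abs_nonneg x) fun h => ?_
  have h0 := (integral_eq_zero_iff_of_nonneg (fun x => abs_nonneg x) hInt).mp h.symm
  have h1 : Var[id; gaussianReal 0 1] = 0 := by
    rw [variance_of_integral_eq_zero (by fun_prop) (by simp)]
    have : (fun x : ℝ => id x ^ 2) =ᵐ[gaussianReal 0 1] 0 := by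
      filter_upwards [h0] with x hx
      simpa using hx
    rw [integral_congr_ae this]
    simp
  rw [variance_id_gaussianReal] at h1
  simp at h1

lemma integral_abs_apply_stdGauss {d : ℕ} (r : Fin d) :
    ∫ ξ, |ξ r| ∂(stdGauss (Fin d)) = gaussAbs := by
  have h2 := (measurePreserving_eval (fun _ : Fin d => gaussianReal 0 1) r).map_eq
  rw [gaussAbs]
  conv_rhs => rw [← h2]
  rw [integral_map (measurable_pi_apply r).aemeasurable (by rw [h2]; fun_prop)]
  rfl

lemma integrable_abs_apply_stdGauss {d : ℕ} (r : Fin d) :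
    Integrable (fun ξ : Fin d → ℝ => |ξ r|) (stdGauss (Fin d)) := by
  have := integrable_dotProduct (κ := Fin d) (Pi.single r 1)
  simp only [single_dotProduct, one_mul] at this
  exact this.abs

lemma sum_norm2_single_sub_single_sq {n : ℕ} {L : Type*} [Fintype L] [DecidableEq L] (l l' : L)
    (u v : Fin n → ℝ) :
    ∑ k, norm2 ((Pi.single l u - Pi.single l' v : L → Fin n → ℝ) k) ^ 2
      = if l = l' then norm2 (u - v) ^ 2 else norm2 u ^ 2 + norm2 v ^ 2 := by
  split_ifs with h
  · subst h
    rw [Finset.sum_eq_single l]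
    · simp
    · intro k _ hk
      simp [Pi.single_eq_of_ne hk, norm2_zero]
    · simp
  · rw [← Finset.sum_subset (Finset.subset_univ {l, l'}), Finset.sum_pair h]
    · simp [Pi.single_eq_of_ne h, Pi.single_eq_of_ne (Ne.symm h), norm2_neg]
    · intro k _ hk
      simp only [Finset.mem_insert, Finset.mem_singleton, not_or] at hk
      simp [Pi.single_eq_of_ne hk.1, Pi.single_eq_of_ne hk.2, norm2_zero]

lemma variance_sum_dotProduct_pi {n : ℕ} {L : Type*} [Fintype L] (C : L → Fin n → ℝ) :
    Var[fun g : L → Fin n → ℝ => ∑ k, C k ⬝ᵥ g k; Measure.pi fun _ => stdGauss (Fin n)]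
      = ∑ k, norm2 (C k) ^ 2 := by
  have h := variance_sum_pi (ι := L) (Ω := fun _ => Fin n → ℝ) (μ := fun _ => stdGauss (Fin n))
    (X := fun k g => C k ⬝ᵥ g) fun k => memLp_dotProduct (C k)
  have e : (∑ k, fun ω : L → Fin n → ℝ => C k ⬝ᵥ ω k) = fun g => ∑ k, C k ⬝ᵥ g k := by
    ext g; simp
  rw [e] at h
  rw [h]
  simp only [variance_dotProduct, norm2_sq]

/-- Super-Sudakov minoration: a set containing small nonempty pieces around `2 ^ d` separated
points is wider than the narrowest piece by a multiple of `√d`. -/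
lemma gwid_growth {n d : ℕ} {L : Type*} [Fintype L] (b : L ≃ (Fin d → Bool))
    {S : Finset (Fin n → ℝ)} {e m : ℝ} (he : 0 ≤ e)
    (t : L → Fin n → ℝ) (A : L → Finset (Fin n → ℝ))
    (hA : ∀ l, (A l).Nonempty) (hAS : ∀ l, A l ⊆ S)
    (hAt : ∀ l, ∀ x ∈ A l, norm2 (x - t l) ≤ e / 8)
    (hsep : ∀ l l', l ≠ l' → e ≤ norm2 (t l - t l')) (hm : ∀ l, m ≤ gwid (A l)) :
    m + gaussAbs / 4 * (e * √d) ≤ gwid S := by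
  classical
  have hneA : ∀ l, Nonempty (A l) := fun l => (hA l).to_subtype
  let ι := Σ l : L, A l
  have hneι : Nonempty ι := ⟨⟨b.symm fun _ => true, Classical.choice (hneA _)⟩⟩
  let a : ι → Fin n → ℝ := fun i => i.2
  let u : ι → Fin n → ℝ := fun i => a i - t i.1
  let c : ℝ := e / (4 * √d)
  let P2 : Measure (L → Fin n → ℝ) := Measure.pi fun _ => stdGauss (Fin n)
  have hP2 : IsGaussian P2 := isGaussian_pi fun _ => stdGauss (Fin n)
  have hP2z : ∫ x, x ∂P2 = 0 := integral_pi_eq_zero _ (integral_stdGauss _)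
  let τ := (stdGauss (Fin d)).prod P2
  have hτ : ∫ x, x ∂τ = 0 := by
    refine Prod.ext ?_ ?_
    · rw [fst_integral (f := fun x => x) IsGaussian.integrable_id]
      have := integral_fun_fst (μ := stdGauss (Fin d)) (ν := P2) (fun x => x)
      simp only [τ, this, integral_stdGauss]
      simp
    · rw [snd_integral (f := fun x => x) IsGaussian.integrable_id]
      have := integral_fun_snd (μ := stdGauss (Fin d)) (ν := P2) (fun x => x)
      simp only [τ, this, hP2z]
      simp
  let s : ι → Fin d → ℝ := fun i r => c * rsign (b i.1 r)
  let T1 : (Fin d → ℝ) →L[ℝ] (ι → ℝ) := dotMap s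
  let T2 : (L → Fin n → ℝ) →L[ℝ] (ι → ℝ) := ContinuousLinearMap.pi fun i =>
    ((ContinuousLinearMap.proj i).comp (dotMap u)).comp
      (ContinuousLinearMap.proj (R := ℝ) (φ := fun _ : L => Fin n → ℝ) i.1)
  let T' : (Fin d → ℝ) × (L → Fin n → ℝ) →L[ℝ] (ι → ℝ) := T1.coprod T2
  have hT' : ∀ z i, T' z i = s i ⬝ᵥ z.1 + u i ⬝ᵥ z.2 i.1 := by
    intro z i
    simp [T', T1, T2, dotMap_apply]
  have hcmp : ∫ z, ⨆ i, T' z i ∂τ ≤ ∫ g, ⨆ i, dotMap a g i ∂(stdGauss (Fin n)) := by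
    refine integral_iSup_le_integral_iSup_of_variance_le _ _ (integral_stdGauss _) hτ _ _
      fun i j => ?_
    have hR : Var[fun g => dotMap a g i - dotMap a g j; stdGauss (Fin n)]
        = norm2 (a i - a j) ^ 2 := by
      simp only [dotMap_apply, ← sub_dotProduct]
      rw [variance_dotProduct, norm2_sq]
    have hL : Var[fun z => T' z i - T' z j; τ]
        = (∑ r, (s i - s j) r ^ 2)
          + ∑ k, norm2 ((Pi.single i.1 (u i) - Pi.single j.1 (u j) : L → Fin n → ℝ) k) ^ 2 := by
      rw [← variance_dotProduct, ← variance_sum_dotProduct_pi]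
      have hY : MemLp (fun g : L → Fin n → ℝ =>
          ∑ k, (Pi.single i.1 (u i) - Pi.single j.1 (u j) : L → Fin n → ℝ) k ⬝ᵥ g k) 2 P2 :=
        memLp_finsetSum _ fun k _ =>
          (memLp_dotProduct _).comp_measurePreserving (measurePreserving_eval _ k)
      rw [← variance_add_prod (memLp_dotProduct _) hY]
      congr 1
      ext z
      simp only [hT', sub_dotProduct, Pi.sub_apply, Finset.sum_sub_distrib]
      have hs (i : ι) : ∑ k, (Pi.single i.1 (u i) : L → Fin n → ℝ) k ⬝ᵥ z.2 k
          = u i ⬝ᵥ z.2 i.1 := by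
        rw [Finset.sum_eq_single i.1]
        · simp
        · intro k _ hk; simp [Pi.single_eq_of_ne hk]
        · simp
      rw [hs, hs]
      ring
    rw [hL, hR, sum_norm2_single_sub_single_sq]
    split_ifs with hij
    · have h1 : s i - s j = 0 := by ext r; simp [s, hij]
      have h2 : u i - u j = a i - a j := by simp [u, hij]
      rw [h1, h2]
      simp
    · have hc : (c ^ 2) * (4 * d) ≤ e ^ 2 / 4 := by
        rcases Nat.eq_zero_or_pos d with h0 | h0
        · subst h0; simp; positivity
        · have : (0 : ℝ) < d := by exact_mod_cast h0
          simp only [c, div_pow, mul_pow, Real.sq_sqrt this.le]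
          apply le_of_eq
          field_simp
      have h1 : ∑ r, (s i - s j) r ^ 2 ≤ c ^ 2 * (4 * d) := by
        calc ∑ r, (s i - s j) r ^ 2 ≤ ∑ _r : Fin d, c ^ 2 * 4 := by
              gcongr with r
              simp only [s, Pi.sub_apply, ← mul_sub, mul_pow]
              gcongr
              cases b i.1 r <;> cases b j.1 r <;> norm_num [rsign]
          _ = c ^ 2 * (4 * d) := by simp; ring
      have hu (i : ι) : norm2 (u i) ^ 2 ≤ (e / 8) ^ 2 :=
        pow_le_pow_left₀ (norm2_nonneg _) (hAt i.1 _ i.2.2) 2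
      have hfar : 3 / 4 * e ≤ norm2 (a i - a j) := by
        have h3 := hsep i.1 j.1 hij
        have h4 := norm2_triangle (t i.1) (a i) (t j.1)
        have h5 := norm2_triangle (a i) (a j) (t j.1)
        have h6 : norm2 (a i - t i.1) ≤ e / 8 := hAt i.1 _ i.2.2
        have h7 : norm2 (a j - t j.1) ≤ e / 8 := hAt j.1 _ j.2.2
        rw [norm2_sub_comm] at h6
        linarith
      have h8 : (3 / 4 * e) ^ 2 ≤ norm2 (a i - a j) ^ 2 := pow_le_pow_left₀ (by positivity) hfar 2
      have h9 := hu i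
      have h10 := hu j
      nlinarith [sq_nonneg e]
  have hright : ∫ g, ⨆ i, dotMap a g i ∂(stdGauss (Fin n)) ≤ gwid S := by
    have hS : Nonempty S := ((hA (b.symm fun _ => true)).mono (hAS _)).to_subtype
    simp only [dotMap_apply]
    refine integral_mono (integrable_iSup_dotProduct _) (integrable_iSup_dotProduct _) fun g => ?_
    refine ciSup_le fun i => ?_
    exact le_ciSup (f := fun x : S => (x : Fin n → ℝ) ⬝ᵥ g) (Set.finite_range _).bddAbove
      ⟨a i, hAS i.1 i.2.2⟩
  refine le_trans ?_ (hcmp.trans hright)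
  have hInt := integrable_iSup_map τ T'
  rw [integral_prod _ hInt]
  have hlow : ∀ᵐ ξ ∂(stdGauss (Fin d)), c * ∑ r, |ξ r| + m ≤ ∫ g, ⨆ i, T' (ξ, g) i ∂P2 := by
    filter_upwards [hInt.prod_right_ae] with ξ hξ
    let l : L := b.symm fun r => decide (0 ≤ ξ r)
    have hl : ∀ x : A l, s ⟨l, x⟩ ⬝ᵥ ξ = c * ∑ r, |ξ r| := by
      intro x
      simp only [s, dotProduct, Finset.mul_sum, mul_assoc]
      refine Finset.sum_congr rfl fun r _ => ?_
      congr 1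
      by_cases hr : 0 ≤ ξ r
      · simp [l, hr, rsign, abs_of_nonneg hr]
      · simp [l, hr, rsign, abs_of_neg (not_le.mp hr)]
    have hmp := measurePreserving_eval (fun _ : L => stdGauss (Fin n)) l
    have hsup : Integrable (fun g : Fin n → ℝ => ⨆ x : A l, ((x : Fin n → ℝ) - t l) ⬝ᵥ g)
        (stdGauss (Fin n)) := integrable_iSup_dotProduct _
    have hI : Integrable (fun g : L → Fin n → ℝ => ⨆ x : A l, ((x : Fin n → ℝ) - t l) ⬝ᵥ g l) P2 :=
      hmp.integrable_comp_of_integrable hsup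
    have hE : ∫ g : L → Fin n → ℝ, (⨆ x : A l, ((x : Fin n → ℝ) - t l) ⬝ᵥ g l) ∂P2 = gwid (A l) := by
      rw [← gwid_eq_integral_sub (hA l) (t l)]
      conv_rhs => rw [← hmp.map_eq]
      rw [integral_map (measurable_pi_apply l).aemeasurable
        (by rw [hmp.map_eq]; exact hsup.aestronglyMeasurable)]
    calc c * ∑ r, |ξ r| + m
        ≤ c * ∑ r, |ξ r|
          + ∫ g : L → Fin n → ℝ, (⨆ x : A l, ((x : Fin n → ℝ) - t l) ⬝ᵥ g l) ∂P2 := by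
          rw [hE]; linarith [hm l]
      _ = ∫ g : L → Fin n → ℝ, (c * ∑ r, |ξ r|
          + ⨆ x : A l, ((x : Fin n → ℝ) - t l) ⬝ᵥ g l) ∂P2 := by
          rw [integral_add (integrable_const _) hI]; simp
      _ ≤ _ := by
          refine integral_mono ((integrable_const _).add hI) hξ fun g => ?_
          simp only
          rw [← le_sub_iff_add_le']
          refine ciSup_le fun x => ?_
          rw [le_sub_iff_add_le']
          have := le_ciSup (f := fun i => T' (ξ, g) i) (Set.finite_range _).bddAbove ⟨l, x⟩
          refine le_trans (le_of_eq ?_) this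
          simp only [hT', hl]
          rfl
  have hI1 : Integrable (fun ξ : Fin d → ℝ => c * ∑ r, |ξ r| + m) (stdGauss (Fin d)) :=
    ((integrable_finsetSum _ fun r _ => integrable_abs_apply_stdGauss r).const_mul c).add
      (integrable_const _)
  refine le_trans (le_of_eq ?_) (integral_mono_ae hI1 hInt.integral_prod_left hlow)
  rw [integral_add ((integrable_finsetSum _ fun r _ =>
    integrable_abs_apply_stdGauss r).const_mul c) (integrable_const _), integral_const_mul,
    integral_finsetSum _ fun r _ => integrable_abs_apply_stdGauss r]
  simp only [integral_abs_apply_stdGauss, Finset.sum_const, Finset.card_univ, Fintype.card_fin,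
    integral_const, probReal_univ, nsmul_eq_mul, one_smul]
  rcases Nat.eq_zero_or_pos d with h0 | h0
  · subst h0; simp
  · have h1 : (0 : ℝ) < d := by exact_mod_cast h0
    have h2 : (d : ℝ) = √d * √d := (Real.mul_self_sqrt h1.le).symm
    have h3 : 0 < √(d : ℝ) := by positivity
    simp only [c]
    generalize √(d : ℝ) = q at *
    rw [h2]
    field_simp
    ring

end

lemma norm2_sub_le_gwid {n : ℕ} {S : Finset (Fin n → ℝ)} {x y : Fin n → ℝ} (hx : x ∈ S)
    (hy : y ∈ S) : gaussAbs / 4 * norm2 (x - y) ≤ gwid S := by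
  let b : Bool ≃ (Fin 1 → Bool) := (Equiv.funUnique (Fin 1) Bool).symm
  have h := gwid_growth (S := S) (m := 0) b (norm2_nonneg (x - y)) (fun l => cond l x y)
    (fun l => {cond l x y}) (fun l => Finset.singleton_nonempty _)
    (fun l => by cases l <;> simpa) (fun l z hz => by
      rw [Finset.mem_singleton] at hz
      rw [hz, sub_self, norm2_zero]
      have := norm2_nonneg (x - y)
      positivity)
    (fun l l' hl => by
      cases l <;> cases l' <;> simp_all [norm2_sub_comm])
    (fun l => gwid_nonneg (Finset.singleton_nonempty _))
  simpa using h

/-- The part of `S` in the ball of radius `ρ` around `x`. -/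
def localPart {n : ℕ} (S : Finset (Fin n → ℝ)) (x : Fin n → ℝ) (ρ : ℝ) : Finset (Fin n → ℝ) :=
  S.filter fun y => norm2 (y - x) ≤ ρ

lemma mem_localPart {n : ℕ} {S : Finset (Fin n → ℝ)} {x y : Fin n → ℝ} {ρ : ℝ} :
    y ∈ localPart S x ρ ↔ y ∈ S ∧ norm2 (y - x) ≤ ρ := by simp [localPart]

lemma localPart_nonempty {n : ℕ} {S : Finset (Fin n → ℝ)} {x : Fin n → ℝ} (hx : x ∈ S) {ρ : ℝ}
    (hρ : 0 ≤ ρ) : (localPart S x ρ).Nonempty :=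
  ⟨x, mem_localPart.mpr ⟨hx, by rwa [sub_self, norm2_zero]⟩⟩

lemma exists_gwid_localPart_growth {n d : ℕ} {S Z : Finset (Fin n → ℝ)} {e : ℝ} (he : 0 ≤ e)
    (hZS : Z ⊆ S) (hcard : 2 ^ d ≤ Z.card)
    (hsep : ∀ x ∈ Z, ∀ y ∈ Z, x ≠ y → e ≤ norm2 (x - y))
    (hclose : ∀ x ∈ Z, ∀ y ∈ Z, norm2 (x - y) ≤ 16 * e) :
    ∃ x ∈ Z, gwid (localPart S x (e / 8)) + gaussAbs / 4 * (e * √d)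
      ≤ gwid (localPart S x (32 * e)) := by
  obtain ⟨Z', hZ', hZc⟩ := Finset.exists_subset_card_eq hcard
  have hne : Z'.Nonempty := by
    rw [← Finset.card_pos, hZc]; positivity
  obtain ⟨x, hx, hmin⟩ := Finset.exists_min_image Z' (fun x => gwid (localPart S x (e / 8))) hne
  refine ⟨x, hZ' hx, ?_⟩
  have hc : Fintype.card Z' = Fintype.card (Fin d → Bool) := by simp [hZc]
  refine gwid_growth (Fintype.equivOfCardEq hc) he (fun z => z) (fun z => localPart S z (e / 8))
    (fun z => localPart_nonempty (hZS (hZ' z.2)) (by positivity)) (fun z y hy => ?_)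
    (fun z y hy => (mem_localPart.mp hy).2)
    (fun z z' hzz => hsep _ (hZ' z.2) _ (hZ' z'.2) fun h => hzz (Subtype.ext h))
    (fun z => hmin z z.2)
  rw [mem_localPart] at hy ⊢
  refine ⟨hy.1, ?_⟩
  have h1 := norm2_triangle y z x
  have h2 := hclose z (hZ' z.2) x (hZ' hx)
  linarith [hy.2]

lemma exists_index_of_separated_card_lt {n : ℕ} (A : Finset (Fin n → ℝ)) {ρ : ℝ} (hρ : 0 ≤ ρ)
    {N : ℕ} (hN : 0 < N)
    (h : ∀ Z ⊆ A, (∀ x ∈ Z, ∀ y ∈ Z, x ≠ y → ρ ≤ norm2 (x - y)) → Z.card < N) :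
    ∃ f : (Fin n → ℝ) → ℕ, (∀ x, f x < N) ∧
      ∀ x ∈ A, ∀ y ∈ A, f x = f y → norm2 (x - y) ≤ 2 * ρ := by
  classical
  let P := A.powerset.filter fun Z => ∀ x ∈ Z, ∀ y ∈ Z, x ≠ y → ρ ≤ norm2 (x - y)
  have hP : P.Nonempty := ⟨∅, by simp [P]⟩
  obtain ⟨Z, hZ, hmax⟩ := Finset.exists_max_image P Finset.card hP
  simp only [P, Finset.mem_filter, Finset.mem_powerset] at hZ hmax
  have hnear : ∀ x ∈ A, ∃ z ∈ Z, norm2 (x - z) ≤ ρ := by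
    intro x hx
    by_contra hcon
    push Not at hcon
    have hxZ : x ∉ Z := fun hxZ => by
      have := hcon x hxZ
      rw [sub_self, norm2_zero] at this
      linarith
    have := hmax (insert x Z) ⟨Finset.insert_subset hx hZ.1, ?_⟩
    · rw [Finset.card_insert_of_notMem hxZ] at this
      omega
    · intro y hy w hw hyw
      rw [Finset.mem_insert] at hy hw
      rcases hy with rfl | hy <;> rcases hw with rfl | hw
      · exact absurd rfl hyw
      · exact (hcon w hw).le
      · rw [norm2_sub_comm]; exact (hcon y hy).le
      · exact hZ.2 y hy w hw hyw
  choose! z hzZ hz using hnear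
  have hcard := h Z hZ.1 hZ.2
  refine ⟨fun x => if h : z x ∈ Z then Z.equivFin ⟨z x, h⟩ else 0, fun x => ?_,
    fun x hx y hy hxy => ?_⟩
  · by_cases hx : z x ∈ Z
    · simp only [hx, dif_pos]; exact (Fin.is_lt _).trans hcard
    · simpa [hx] using hN
  · simp only [hzZ x hx, hzZ y hy, dif_pos] at hxy
    have hxy : z x = z y := congrArg Subtype.val (Z.equivFin.injective (Fin.ext hxy))
    have h1 := norm2_triangle x (z x) y
    have h2 := hz x hx
    have h3 := hz y hy
    rw [norm2_sub_comm, ← hxy] at h3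
    linarith

lemma four_mul_sqrt_two_sub_one : 4 ≤ 3 * √2 := by
  have h : (4 / 3 : ℝ) ≤ √2 := Real.le_sqrt_of_sq_le (by norm_num)
  linarith

lemma sum_sqrt_two_pow_le (M : ℕ) : ∑ l ∈ Finset.range (M + 1), (√2 : ℝ) ^ l ≤ 4 * √2 ^ M := by
  induction M with
  | zero => norm_num
  | succ M ih =>
    rw [Finset.sum_range_succ, pow_succ]
    have h := four_mul_sqrt_two_sub_one
    have h2 : (0 : ℝ) ≤ √2 ^ M := by positivity
    nlinarith

lemma sum_sqrt_two_pow_filter_le {a t : ℝ} (ha : 0 ≤ a) (ht : 0 ≤ t) (M : ℕ) :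
    ∑ l ∈ (Finset.range M).filter (fun l => a * √2 ^ l ≤ t), a * √2 ^ l ≤ 4 * t := by
  induction M with
  | zero => simpa using ht
  | succ M ih =>
    by_cases h : a * √2 ^ M ≤ t
    · calc _ ≤ ∑ l ∈ Finset.range (M + 1), a * √2 ^ l :=
            Finset.sum_le_sum_of_subset_of_nonneg (Finset.filter_subset _ _)
              fun _ _ _ => by positivity
        _ ≤ a * (4 * √2 ^ M) := by
            rw [← Finset.mul_sum]
            exact mul_le_mul_of_nonneg_left (sum_sqrt_two_pow_le M) ha
        _ ≤ 4 * t := by linarith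
    · rwa [Finset.range_add_one, Finset.filter_insert, if_neg h]

lemma sum_sqrt_two_pow_div_le (M : ℕ) : ∑ l ∈ Finset.range M, √2 ^ l / (2 : ℝ) ^ l ≤ 4 := by
  have h : (√2 : ℝ) ≤ 3 / 2 := Real.sqrt_le_iff.mpr (by norm_num)
  have key : ∀ M : ℕ, ∑ l ∈ Finset.range M, √2 ^ l / (2 : ℝ) ^ l ≤ 4 - 4 * (√2 / 2) ^ M := by
    intro M
    induction M with
    | zero => norm_num
    | succ M ih =>
      rw [Finset.sum_range_succ, ← div_pow, pow_succ]
      have h2 : (0 : ℝ) ≤ (√2 / 2) ^ M := by positivity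
      nlinarith
  have := key M
  have h2 : (0 : ℝ) ≤ (√2 / 2) ^ M := by positivity
  linarith

/-- The increase of the local Gaussian width of `S` at `x` between the scales `e / 8`
and `32 * e`. -/
def localGrowth {n : ℕ} (S : Finset (Fin n → ℝ)) (e : ℝ) (x : Fin n → ℝ) : ℝ :=
  gwid (localPart S x (32 * e)) - gwid (localPart S x (e / 8))

lemma localGrowth_nonneg {n : ℕ} {S : Finset (Fin n → ℝ)} {e : ℝ} (he : 0 ≤ e) {x : Fin n → ℝ}
    (hx : x ∈ S) : 0 ≤ localGrowth S e x := by
  refine sub_nonneg.mpr (gwid_mono (localPart_nonempty hx (by positivity)) fun y hy => ?_)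
  rw [mem_localPart] at hy ⊢
  exact ⟨hy.1, by linarith [hy.2]⟩

lemma sum_localGrowth_le {n : ℕ} {S : Finset (Fin n → ℝ)} {D : ℝ} (hD : 0 ≤ D) {x : Fin n → ℝ}
    (hx : x ∈ S) (M : ℕ) :
    ∑ k ∈ Finset.range M, localGrowth S (D / 2 ^ k) x ≤ 8 * gwid S := by
  set ψ : ℕ → ℝ := fun k => gwid (localPart S x (32 * (D / 2 ^ k))) with hψ
  have hne : ∀ k : ℕ, (localPart S x (32 * (D / 2 ^ k))).Nonempty := fun k =>
    localPart_nonempty hx (by positivity)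
  have h0 : ∀ k, 0 ≤ ψ k := fun k => gwid_nonneg (hne k)
  have h1 : ∀ k, ψ k ≤ gwid S := fun k => gwid_mono (hne k) (Finset.filter_subset _ _)
  have hstep : ∀ k, localGrowth S (D / 2 ^ k) x = ψ k - ψ (8 + k) := by
    intro k
    simp only [localGrowth, hψ]
    congr 3
    rw [pow_add]
    field_simp
    ring
  have hsplit : ∑ k ∈ Finset.range (8 + M), ψ k
      = ∑ k ∈ Finset.range 8, ψ k + ∑ k ∈ Finset.range M, ψ (8 + k) :=
    Finset.sum_range_add ψ 8 M
  have hle : ∑ k ∈ Finset.range M, ψ k ≤ ∑ k ∈ Finset.range (8 + M), ψ k :=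
    Finset.sum_le_sum_of_subset_of_nonneg (Finset.range_mono (by omega)) fun k _ _ => h0 k
  have h8 : ∑ k ∈ Finset.range 8, ψ k ≤ 8 * gwid S := by
    calc _ ≤ ∑ k ∈ Finset.range 8, gwid S := Finset.sum_le_sum fun k _ => h1 k
      _ = _ := by simp
  rw [Finset.sum_congr rfl fun k _ => hstep k, Finset.sum_sub_distrib]
  linarith

open Classical in
/-- The least scale index `k ≤ l` at which `S` has large local growth around `x`. -/
def growthScale {n : ℕ} (S : Finset (Fin n → ℝ)) (D : ℝ) (l : ℕ) (x : Fin n → ℝ) : ℕ :=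
  Nat.find (p := fun k => l ≤ k ∨
    gaussAbs / 4 * (D / 2 ^ k) * √2 ^ l ≤ localGrowth S (D / 2 ^ k) x) ⟨l, Or.inl le_rfl⟩

lemma growthScale_le {n : ℕ} (S : Finset (Fin n → ℝ)) (D : ℝ) (l : ℕ) (x : Fin n → ℝ) :
    growthScale S D l x ≤ l := Nat.find_min' _ (Or.inl le_rfl)

lemma growthScale_spec {n : ℕ} (S : Finset (Fin n → ℝ)) (D : ℝ) (l : ℕ) (x : Fin n → ℝ) :
    l ≤ growthScale S D l x ∨ gaussAbs / 4 * (D / 2 ^ growthScale S D l x) * √2 ^ l ≤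
      localGrowth S (D / 2 ^ growthScale S D l x) x := by
  classical
  exact Nat.find_spec (p := fun k => l ≤ k ∨
    gaussAbs / 4 * (D / 2 ^ k) * √2 ^ l ≤ localGrowth S (D / 2 ^ k) x) ⟨l, Or.inl le_rfl⟩

lemma localGrowth_lt_of_lt_growthScale {n : ℕ} {S : Finset (Fin n → ℝ)} {D : ℝ} {l k : ℕ}
    {x : Fin n → ℝ} (hk : k < growthScale S D l x) :
    localGrowth S (D / 2 ^ k) x < gaussAbs / 4 * (D / 2 ^ k) * √2 ^ l := by
  classical
  have := Nat.find_min (p := fun k => l ≤ k ∨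
    gaussAbs / 4 * (D / 2 ^ k) * √2 ^ l ≤ localGrowth S (D / 2 ^ k) x) ⟨l, Or.inl le_rfl⟩ hk
  push Not at this
  exact this.2

lemma sum_growthScale_le {n : ℕ} {S : Finset (Fin n → ℝ)} {D : ℝ} (hD : 0 ≤ D) {x : Fin n → ℝ}
    (hx : x ∈ S) (M : ℕ) :
    gaussAbs / 4 * ∑ l ∈ Finset.range M, √2 ^ l * (D / 2 ^ growthScale S D l x)
      ≤ 32 * gwid S + gaussAbs / 4 * (4 * D) := by
  classical
  have hg := gaussAbs_pos
  set a : ℕ → ℝ := fun k => gaussAbs / 4 * (D / 2 ^ k) with ha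
  have ha0 : ∀ k, 0 ≤ a k := fun k => by simp only [ha]; positivity
  have hterm : ∀ l ∈ Finset.range M, gaussAbs / 4 * (√2 ^ l * (D / 2 ^ growthScale S D l x))
      ≤ gaussAbs / 4 * D * (√2 ^ l / 2 ^ l) + ∑ k ∈ Finset.range M,
        if a k * √2 ^ l ≤ localGrowth S (D / 2 ^ k) x then a k * √2 ^ l else 0 := by
    intro l hl
    have hnn : ∀ k ∈ Finset.range M,
        0 ≤ if a k * √2 ^ l ≤ localGrowth S (D / 2 ^ k) x then a k * √2 ^ l else 0 := by
      intro k _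
      have := ha0 k
      split_ifs <;> positivity
    have hfst : 0 ≤ gaussAbs / 4 * D * (√2 ^ l / 2 ^ l) := by positivity
    rcases growthScale_spec S D l x with h | h
    · rw [le_antisymm (growthScale_le S D l x) h]
      have := Finset.sum_nonneg hnn
      calc _ = gaussAbs / 4 * D * (√2 ^ l / 2 ^ l) := by ring
        _ ≤ _ := by linarith
    · have hmem : growthScale S D l x ∈ Finset.range M :=
        Finset.mem_range.mpr ((growthScale_le S D l x).trans_lt (Finset.mem_range.mp hl))
      have := Finset.single_le_sum hnn hmem
      simp only [ha] at this ⊢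
      rw [if_pos h] at this
      calc _ = gaussAbs / 4 * (D / 2 ^ growthScale S D l x) * √2 ^ l := by ring
        _ ≤ _ := by linarith
  have hcol : ∀ k ∈ Finset.range M, (∑ l ∈ Finset.range M,
      if a k * √2 ^ l ≤ localGrowth S (D / 2 ^ k) x then a k * √2 ^ l else 0)
      ≤ 4 * localGrowth S (D / 2 ^ k) x := by
    intro k _
    rw [← Finset.sum_filter]
    exact sum_sqrt_two_pow_filter_le (ha0 k) (localGrowth_nonneg (by positivity) hx) M
  rw [Finset.mul_sum]
  calc _ ≤ _ := Finset.sum_le_sum hterm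
    _ = gaussAbs / 4 * D * ∑ l ∈ Finset.range M, √2 ^ l / 2 ^ l + ∑ k ∈ Finset.range M,
        ∑ l ∈ Finset.range M,
          if a k * √2 ^ l ≤ localGrowth S (D / 2 ^ k) x then a k * √2 ^ l else 0 := by
        rw [Finset.sum_add_distrib, ← Finset.mul_sum, Finset.sum_comm]
    _ ≤ gaussAbs / 4 * D * 4 + 4 * (8 * gwid S) := by
        refine add_le_add (mul_le_mul_of_nonneg_left (sum_sqrt_two_pow_div_le M) (by positivity)) ?_
        refine (Finset.sum_le_sum hcol).trans ?_
        rw [← Finset.mul_sum]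
        exact mul_le_mul_of_nonneg_left (sum_localGrowth_le hD hx M) (by norm_num)
    _ = _ := by ring

lemma exists_index_of_growthScale_eq {n : ℕ} {S A : Finset (Fin n → ℝ)} (hAS : A ⊆ S) {D R : ℝ}
    (hD : ∀ x ∈ S, ∀ y ∈ S, norm2 (x - y) ≤ D) (hD0 : 0 ≤ D) (hR0 : 0 ≤ R) {l k : ℕ}
    (hR : ∀ x ∈ A, ∀ y ∈ A, norm2 (x - y) ≤ R) (hk : ∀ x ∈ A, growthScale S D l x = k) :
    ∃ f : (Fin n → ℝ) → ℕ, (∀ x, f x < 2 ^ 2 ^ l) ∧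
      ∀ x ∈ A, ∀ y ∈ A, f x = f y → norm2 (x - y) ≤ R / 4 + 4 * (D / 2 ^ k) := by
  by_cases htriv : k = 0 ∨ 16 * D < R
  · refine ⟨fun _ => 0, fun _ => by positivity, fun x hx y hy _ => ?_⟩
    refine (hD x (hAS hx) y (hAS hy)).trans ?_
    rcases htriv with rfl | h
    · simp only [pow_zero, div_one]; linarith
    · have : 0 ≤ D / 2 ^ k := by positivity
      linarith
  push Not at htriv
  obtain ⟨hk0, hRD⟩ := htriv
  classical
  set j := Nat.findGreatest (fun j => R ≤ 16 * (D / 2 ^ j)) (k - 1) with hj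
  have hjR : R ≤ 16 * (D / 2 ^ j) :=
    Nat.findGreatest_spec (P := fun j => R ≤ 16 * (D / 2 ^ j)) (Nat.zero_le (k - 1))
      (by simpa using hRD)
  have hjk : j ≤ k - 1 := Nat.findGreatest_le _
  have hρ : 2 * (D / 2 ^ j) ≤ R / 4 + 4 * (D / 2 ^ k) := by
    rcases hjk.eq_or_lt with h | h
    · have hk1 : k = j + 1 := by omega
      have : D / 2 ^ k = (D / 2 ^ j) / 2 := by rw [hk1, pow_succ]; field_simp
      rw [this]; linarith
    · have h1 := Nat.findGreatest_is_greatest (P := fun j => R ≤ 16 * (D / 2 ^ j))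
        (lt_add_one j) (by omega : j + 1 ≤ k - 1)
      have h2 : D / 2 ^ (j + 1) = (D / 2 ^ j) / 2 := by rw [pow_succ]; field_simp
      simp only [h2, not_le] at h1
      have : 0 ≤ D / 2 ^ k := by positivity
      linarith
  obtain ⟨f, hf, hfd⟩ := exists_index_of_separated_card_lt A (ρ := D / 2 ^ j) (by positivity)
    (N := 2 ^ 2 ^ l) (by positivity) (fun Z hZ hsep => by
      by_contra hcard
      obtain ⟨x, hx, hgr⟩ := exists_gwid_localPart_growth (d := 2 ^ l) (S := S) (e := D / 2 ^ j)
        (by positivity) (hZ.trans hAS) (not_lt.mp hcard) hsep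
        (fun x hx y hy => (hR x (hZ hx) y (hZ hy)).trans hjR)
      have hlt := localGrowth_lt_of_lt_growthScale (S := S) (D := D) (l := l) (k := j) (x := x)
        (by rw [hk x (hZ hx)]; omega)
      have hs : √((2 ^ l : ℕ) : ℝ) = √2 ^ l := by
        push_cast
        rw [show (2 : ℝ) ^ l = (√2 ^ l) ^ 2 by rw [← pow_mul, mul_comm, pow_mul]; norm_num,
          Real.sqrt_sq (by positivity)]
      rw [hs] at hgr
      unfold localGrowth at hlt
      nlinarith)
  exact ⟨f, hf, fun x hx y hy hxy => (hfd x hx y hy hxy).trans hρ⟩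

/-- `S` has labellings `c l` with at most `2 ^ 2 ^ l` labels whose classes have diameter at
most `r l`, with `∑ l < M, √2 ^ l * r l x ≤ Γ` on `S`. -/
def HasLabelling {n : ℕ} (S : Finset (Fin n → ℝ)) (M : ℕ) (Γ : ℝ) : Prop :=
  ∃ (c : ℕ → (Fin n → ℝ) → ℕ) (r : ℕ → (Fin n → ℝ) → ℝ),
    (∀ l, (S.image (c l)).card ≤ 2 ^ 2 ^ l) ∧ (∀ l, ∀ x ∈ S, 0 ≤ r l x) ∧
    (∀ l, ∀ x ∈ S, ∀ y ∈ S, c l x = c l y → r l x = r l y) ∧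
    (∀ l, ∀ x ∈ S, ∀ y ∈ S, c l x = c l y → norm2 (x - y) ≤ r l x) ∧
    ∀ x ∈ S, ∑ l ∈ Finset.range M, √2 ^ l * r l x ≤ Γ

lemma HasLabelling.mono {n : ℕ} {S : Finset (Fin n → ℝ)} {M : ℕ} {Γ Γ' : ℝ}
    (h : HasLabelling S M Γ) (hΓ : Γ ≤ Γ') : HasLabelling S M Γ' := by
  obtain ⟨c, r, h1, h2, h3, h4, h5⟩ := h
  exact ⟨c, r, h1, h2, h3, h4, fun x hx => (h5 x hx).trans hΓ⟩

lemma card_image_pair_le {α : Type*} [DecidableEq α] (S : Finset α) (c k f : α → ℕ) {l : ℕ}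
    (hc : (S.image c).card ≤ 2 ^ 2 ^ l) (hk : ∀ x, k x ≤ l) (hf : ∀ x, f x < 2 ^ 2 ^ l) :
    (S.image fun x => Nat.pair (c x) (Nat.pair (k x) (f x))).card ≤ 2 ^ 2 ^ (l + 2) := by
  have hsub : (S.image fun x => Nat.pair (c x) (Nat.pair (k x) (f x))) ⊆
      ((S.image c) ×ˢ (Finset.range (l + 1) ×ˢ Finset.range (2 ^ 2 ^ l))).image
        fun q => Nat.pair q.1 (Nat.pair q.2.1 q.2.2) := by
    intro z hz
    obtain ⟨x, hx, rfl⟩ := Finset.mem_image.mp hz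
    refine Finset.mem_image.mpr ⟨(c x, k x, f x), ?_, rfl⟩
    simp only [Finset.mem_product, Finset.mem_range]
    exact ⟨Finset.mem_image_of_mem c hx, Nat.lt_succ_of_le (hk x), hf x⟩
  refine (Finset.card_le_card hsub).trans (Finset.card_image_le.trans ?_)
  rw [Finset.card_product, Finset.card_product, Finset.card_range, Finset.card_range]
  have h1 : l + 1 ≤ 2 ^ l := Nat.lt_two_pow_self
  have h2 : 2 ^ l ≤ 2 ^ 2 ^ l := (Nat.lt_two_pow_self).le
  have h4 : 2 ^ 2 ^ (l + 2) = 2 ^ 2 ^ l * (2 ^ 2 ^ l * 2 ^ 2 ^ l) * 2 ^ 2 ^ l := by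
    rw [← pow_add, ← pow_add, ← pow_add]; congr 1; ring
  rw [h4]
  calc _ ≤ 2 ^ 2 ^ l * (2 ^ 2 ^ l * 2 ^ 2 ^ l) := by
        gcongr
        exact h1.trans h2
    _ ≤ _ := Nat.le_mul_of_pos_right _ (by positivity)

lemma HasLabelling.contract {n : ℕ} {S : Finset (Fin n → ℝ)} {D : ℝ}
    (hD : ∀ x ∈ S, ∀ y ∈ S, norm2 (x - y) ≤ D) (hD0 : 0 ≤ D) {M : ℕ} {Γ : ℝ}
    (h : HasLabelling S M Γ) :
    HasLabelling S M (Γ / 2 + (35 * D + 256 * gwid S / (gaussAbs / 4))) := by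
  classical
  obtain ⟨c, r, hcard, hr0, hrc, hdiam, hsum⟩ := h
  have hex : ∀ l a k, ∃ f : (Fin n → ℝ) → ℕ, (∀ x, f x < 2 ^ 2 ^ l) ∧
      ∀ x ∈ S, ∀ y ∈ S, c l x = a → c l y = a → growthScale S D l x = k →
        growthScale S D l y = k → f x = f y → norm2 (x - y) ≤ r l x / 4 + 4 * (D / 2 ^ k) := by
    intro l a k
    by_cases hne : ∃ x ∈ S, c l x = a
    · obtain ⟨x₀, hx₀, hcx₀⟩ := hne
      obtain ⟨f, hf, hfd⟩ := exists_index_of_growthScale_eq (S := S)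
        (A := S.filter fun x => c l x = a ∧ growthScale S D l x = k) (Finset.filter_subset _ _)
        hD hD0 (hr0 l x₀ hx₀) (l := l) (k := k) (fun x hx y hy => by
          rw [Finset.mem_filter] at hx hy
          rw [hrc l x₀ hx₀ x hx.1 (hcx₀.trans hx.2.1.symm)]
          exact hdiam l x hx.1 y hy.1 (hx.2.1.trans hy.2.1.symm))
        (fun x hx => (Finset.mem_filter.mp hx).2.2)
      refine ⟨f, hf, fun x hx y hy hxa hya hxk hyk hxy => ?_⟩
      rw [hrc l x hx x₀ hx₀ (hxa.trans hcx₀.symm)]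
      exact hfd x (Finset.mem_filter.mpr ⟨hx, hxa, hxk⟩) y (Finset.mem_filter.mpr ⟨hy, hya, hyk⟩) hxy
    · exact ⟨fun _ => 0, fun _ => by positivity,
        fun x hx y hy hxa => absurd ⟨x, hx, hxa⟩ hne⟩
  choose F hF hFd using hex
  let c' : ℕ → (Fin n → ℝ) → ℕ := fun l => match l with
    | 0 => fun _ => 0
    | 1 => fun _ => 0
    | l + 2 => fun x => Nat.pair (c l x) (Nat.pair (growthScale S D l x)
        (F l (c l x) (growthScale S D l x) x))
  let r' : ℕ → (Fin n → ℝ) → ℝ := fun l => match l with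
    | 0 => fun _ => D
    | 1 => fun _ => D
    | l + 2 => fun x => r l x / 4 + 4 * (D / 2 ^ growthScale S D l x)
  have hconst : (S.image fun _ => 0).card ≤ 1 :=
    (Finset.card_le_card (Finset.image_subset_iff.mpr fun x _ => Finset.mem_singleton_self 0)).trans
      (Finset.card_singleton 0).le
  refine ⟨c', r', fun l => ?_, fun l x hx => ?_, fun l x hx y hy hxy => ?_,
    fun l x hx y hy hxy => ?_, fun x hx => ?_⟩
  · match l with
    | 0 => exact hconst.trans (by norm_num)
    | 1 => exact hconst.trans (by norm_num)
    | l + 2 =>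
      exact card_image_pair_le S (c l) (growthScale S D l)
        (fun x => F l (c l x) (growthScale S D l x) x) (hcard l) (growthScale_le S D l)
        fun x => hF l _ _ x
  · match l with
    | 0 => exact hD0
    | 1 => exact hD0
    | l + 2 =>
      have := hr0 l x hx
      simp only [r']
      positivity
  · match l with
    | 0 => rfl
    | 1 => rfl
    | l + 2 =>
      simp only [c', Nat.pair_eq_pair] at hxy
      simp only [r', hrc l x hx y hy hxy.1, hxy.2.1]
  · match l with
    | 0 => exact hD x hx y hy
    | 1 => exact hD x hx y hy
    | l + 2 =>
      simp only [c', Nat.pair_eq_pair] at hxy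
      obtain ⟨h1, h2, h3⟩ := hxy
      rw [← h1, ← h2] at h3
      exact hFd l _ _ x hx y hy rfl h1.symm rfl h2.symm h3
  · have hnn : ∀ l, 0 ≤ √2 ^ l * r' l x := by
      intro l
      match l with
      | 0 => simp only [r']; positivity
      | 1 => simp only [r']; positivity
      | l + 2 =>
        have := hr0 l x hx
        simp only [r']
        positivity
    have hg := gaussAbs_pos
    have hsc := sum_growthScale_le hD0 hx M
    have hsc' : ∑ l ∈ Finset.range M, √2 ^ l * (D / 2 ^ growthScale S D l x)
        ≤ 32 * gwid S / (gaussAbs / 4) + 4 * D := by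
      rw [← sub_le_iff_le_add, le_div_iff₀ (by positivity)]
      linarith
    have h2 : (√2 : ℝ) ≤ 2 := Real.sqrt_le_iff.mpr (by norm_num)
    calc ∑ l ∈ Finset.range M, √2 ^ l * r' l x
        ≤ ∑ l ∈ Finset.range (M + 2), √2 ^ l * r' l x :=
          Finset.sum_le_sum_of_subset_of_nonneg (Finset.range_mono (by omega)) fun l _ _ => hnn l
      _ = (∑ l ∈ Finset.range M, √2 ^ (l + 2) * r' (l + 2) x) + √2 * D + D := by
          rw [Finset.sum_range_succ', Finset.sum_range_succ']
          simp [r']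
      _ = (∑ l ∈ Finset.range M, √2 ^ l * r l x) / 2
          + 8 * ∑ l ∈ Finset.range M, √2 ^ l * (D / 2 ^ growthScale S D l x) + √2 * D + D := by
          congr 2
          rw [Finset.sum_div, Finset.mul_sum, ← Finset.sum_add_distrib]
          refine Finset.sum_congr rfl fun l _ => ?_
          simp only [r', pow_add, Real.sq_sqrt (zero_le_two (α := ℝ))]
          ring
      _ ≤ _ := by
          have := hsum x hx
          have e : 256 * gwid S / (gaussAbs / 4) = 8 * (32 * gwid S / (gaussAbs / 4)) := by ring
          rw [e]
          nlinarith

lemma hasLabelling_of_gwid {n : ℕ} {S : Finset (Fin n → ℝ)} (hS : S.Nonempty) (M : ℕ) :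
    HasLabelling S M (583 * (gwid S / (gaussAbs / 4))) := by
  have hg := gaussAbs_pos
  have hG := gwid_nonneg hS
  set D := gwid S / (gaussAbs / 4) with hDdef
  have hD0 : 0 ≤ D := by positivity
  have hD : ∀ x ∈ S, ∀ y ∈ S, norm2 (x - y) ≤ D := fun x hx y hy => by
    rw [hDdef, le_div_iff₀ (by positivity), mul_comm]
    exact norm2_sub_le_gwid hx hy
  have hstart : HasLabelling S M (D * ∑ l ∈ Finset.range M, √2 ^ l) := by
    refine ⟨fun _ _ => 0, fun _ _ => D, fun l => ?_, fun _ _ _ => hD0, fun _ _ _ _ _ _ => rfl,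
      fun _ x hx y hy _ => hD x hx y hy, fun x _ => ?_⟩
    · exact ((Finset.card_le_card (Finset.image_subset_iff.mpr
        fun x _ => Finset.mem_singleton_self 0)).trans (Finset.card_singleton 0).le).trans
        Nat.one_le_two_pow
    · rw [← Finset.sum_mul, mul_comm]
  set s := ∑ l ∈ Finset.range M, (√2 : ℝ) ^ l
  have hiter : ∀ j : ℕ, HasLabelling S M (582 * D + D * s / 2 ^ j) := by
    intro j
    induction j with
    | zero => exact hstart.mono (by simp only [pow_zero, div_one]; linarith)
    | succ j ih =>
      refine (ih.contract hD hD0).mono (le_of_eq ?_)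
      rw [pow_succ, mul_div_assoc 256, ← hDdef]
      field_simp
      ring
  obtain ⟨j, hj⟩ := pow_unbounded_of_one_lt s (one_lt_two (α := ℝ))
  refine (hiter j).mono ?_
  have : D * s / 2 ^ j ≤ D := by
    rw [div_le_iff₀ (by positivity)]
    exact mul_le_mul_of_nonneg_left hj.le hD0
  linarith

/-- Chaining form of the majorizing measure theorem: a finite set containing the origin has an
admissible sequence of nets whose chains are controlled by the Gaussian width. -/
theorem exists_admissible_chain {n : ℕ} {S : Finset (Fin n → ℝ)} (h0 : 0 ∈ S) :
    ∃ (M : ℕ) (d : ℕ → (Fin n → ℝ) → Fin n → ℝ), (∀ x, d 0 x = 0) ∧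
      (∀ x ∈ S, d M x = x) ∧ (∀ l, ∀ x ∈ S, d l x ∈ S) ∧
      (∀ l, l ≤ M → (S.image (d l)).card ≤ 2 ^ 2 ^ l) ∧
      ∀ x ∈ S, ∑ l ∈ Finset.range M, √2 ^ l * norm2 (d (l + 1) x - d l x)
        ≤ 1168 * (gwid S / (gaussAbs / 4)) := by
  classical
  have hS : S.Nonempty := ⟨0, h0⟩
  have hg := gaussAbs_pos
  have hG := gwid_nonneg hS
  set M := S.card with hM
  have hM0 : 0 < M := Finset.card_pos.mpr hS
  obtain ⟨c, r, hcard, hr0, hrc, hdiam, hsum⟩ := hasLabelling_of_gwid hS M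
  have hrep : ∀ l a, ∃ z ∈ S, (∃ x ∈ S, c l x = a) → c l z = a := by
    intro l a
    by_cases h : ∃ x ∈ S, c l x = a
    · obtain ⟨x, hx, hxa⟩ := h
      exact ⟨x, hx, fun _ => hxa⟩
    · exact ⟨0, h0, fun h' => absurd h' h⟩
  choose z hzS hz using hrep
  let d : ℕ → (Fin n → ℝ) → Fin n → ℝ := fun l x =>
    if l = 0 then 0 else if l < M then z l (c l x) else x
  have hdS : ∀ l, ∀ x ∈ S, d l x ∈ S := by
    intro l x hx
    simp only [d]
    split_ifs
    exacts [h0, hzS _ _, hx]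
  have hdM : ∀ x, d M x = x := fun x => by simp [d, hM0.ne']
  refine ⟨M, d, fun x => by simp [d], fun x _ => hdM x, hdS, fun l hl => ?_, fun x hx => ?_⟩
  · by_cases hl0 : l = 0
    · refine (Finset.card_le_card (t := {0}) (Finset.image_subset_iff.mpr fun x _ => ?_)).trans ?_
      · simp [d, hl0]
      · simpa using Nat.one_le_two_pow
    · rcases hl.eq_or_lt with rfl | hlt
      · refine Finset.card_image_le.trans ?_
        exact (Nat.lt_two_pow_self).le.trans (Nat.lt_two_pow_self).le
      · have : S.image (d l) ⊆ (S.image (c l)).image (z l) := by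
          intro w hw
          obtain ⟨x, hx, rfl⟩ := Finset.mem_image.mp hw
          simp only [d, hl0, hlt, if_true, if_false]
          exact Finset.mem_image_of_mem _ (Finset.mem_image_of_mem _ hx)
        exact (Finset.card_le_card this).trans (Finset.card_image_le.trans (hcard l))
  · set D := gwid S / (gaussAbs / 4) with hDdef
    have hdist : ∀ l ∈ Finset.range M, √2 ^ l * norm2 (x - d l x)
        ≤ √2 ^ l * r l x + if l = 0 then D else 0 := by
      intro l hl
      have hrl := hr0 l x hx
      by_cases hl0 : l = 0
      · subst hl0
        have : norm2 (x - 0) ≤ D := by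
          rw [hDdef, le_div_iff₀ (by positivity), mul_comm]
          exact norm2_sub_le_gwid hx h0
        simp only [d, if_true, pow_zero, one_mul]
        linarith
      · rw [if_neg hl0, add_zero]
        refine mul_le_mul_of_nonneg_left ?_ (by positivity)
        simp only [d, hl0, if_false, Finset.mem_range.mp hl, if_true]
        exact hdiam l x hx _ (hzS _ _) (hz l (c l x) ⟨x, hx, rfl⟩).symm
    have hA : ∑ l ∈ Finset.range M, √2 ^ l * norm2 (x - d l x) ≤ 584 * D := by
      refine (Finset.sum_le_sum hdist).trans ?_
      rw [Finset.sum_add_distrib, Finset.sum_ite_eq' (Finset.range M) 0 fun _ => D,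
        if_pos (Finset.mem_range.mpr hM0)]
      linarith [hsum x hx]
    have hB : ∑ l ∈ Finset.range M, √2 ^ l * norm2 (x - d (l + 1) x)
        ≤ ∑ l ∈ Finset.range M, √2 ^ l * norm2 (x - d l x) := by
      have h1 : ∑ l ∈ Finset.range M, √2 ^ (l + 1) * norm2 (x - d (l + 1) x)
          ≤ ∑ l ∈ Finset.range (M + 1), √2 ^ l * norm2 (x - d l x) := by
        rw [Finset.sum_range_succ']
        have := norm2_nonneg (x - d 0 x)
        simp only [pow_zero, one_mul]
        linarith
      rw [Finset.sum_range_succ, hdM, sub_self, norm2_zero, mul_zero, add_zero] at h1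
      refine le_trans (Finset.sum_le_sum fun l _ => ?_) h1
      refine mul_le_mul_of_nonneg_right ?_ (norm2_nonneg _)
      exact pow_le_pow_right₀ (Real.one_le_sqrt.mpr one_le_two) (Nat.le_succ l)
    calc _ ≤ ∑ l ∈ Finset.range M, (√2 ^ l * norm2 (x - d (l + 1) x)
          + √2 ^ l * norm2 (x - d l x)) := by
          refine Finset.sum_le_sum fun l _ => ?_
          rw [← mul_add]
          refine mul_le_mul_of_nonneg_left ?_ (by positivity)
          have := norm2_triangle (d (l + 1) x) x (d l x)
          rwa [norm2_sub_comm (d (l + 1) x) x] at this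
      _ ≤ _ := by
          rw [Finset.sum_add_distrib]
          linarith

lemma exists_threshold {a : ℕ → ℝ} (ha : Monotone a) (M : ℕ) :
    ∃ L ≤ M, (∀ l < L, a l ≤ 1) ∧ ∀ l ∈ Finset.Ico L M, 1 ≤ a l := by
  classical
  by_cases h : ∃ l, 1 < a l
  · refine ⟨min (Nat.find h) M, min_le_right _ _, fun l hl => ?_, fun l hl => ?_⟩
    · exact not_lt.mp (Nat.find_min h (lt_of_lt_of_le hl (min_le_left _ _)))
    · rw [Finset.mem_Ico, min_le_iff] at hl
      rcases hl.1 with h1 | h1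
      · exact (Nat.find_spec h).le.trans (ha h1)
      · omega
  · push Not at h
    exact ⟨M, le_rfl, fun l _ => h l, fun l hl => by simp at hl⟩

/-- The defect of a matrix from being an isometry at `x`. -/
def isoDefect {p n : ℕ} (B : Matrix (Fin p) (Fin n) ℝ) (x : Fin n → ℝ) : ℝ :=
  norm2 (B *ᵥ x) ^ 2 - norm2 x ^ 2

/-- Chaining bound: increments at scales `a l ≤ 1` are controlled through the quadratic form, the
remaining ones through the norm of their image. -/
lemma abs_isoDefect_le_of_chain {p n : ℕ} (B : Matrix (Fin p) (Fin n) ℝ) {M : ℕ}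
    {u : ℕ → Fin n → ℝ} {a : ℕ → ℝ} {c r g α : ℝ} (ha : Monotone a) (ha0 : ∀ l, 0 ≤ a l)
    (hc : 1 ≤ c) (hr : 0 ≤ r) (hu0 : u 0 = 0) (hur : ∀ l, norm2 (u l) ≤ r)
    (hinc : ∀ l < M, |isoDefect B (u (l + 1)) - isoDefect B (u l)|
      ≤ 13 * (c * (a l + a l ^ 2)) * norm2 (u (l + 1) - u l) * (2 * r))
    (hdiff : ∀ l < M, |isoDefect B (u (l + 1) - u l)|
      ≤ 13 * (c * (a l + a l ^ 2)) * norm2 (u (l + 1) - u l) ^ 2)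
    (hg : ∑ l ∈ Finset.range M, a l * norm2 (u (l + 1) - u l) ≤ g)
    (hα : 189 * (c * g) ≤ α * r) (hα1 : α ≤ 1) :
    |isoDefect B (u M)| ≤ α * r ^ 2 := by
  obtain ⟨L, hLM, hlow, hhigh⟩ := exists_threshold ha M
  set w : ℕ → ℝ := fun l => a l * norm2 (u (l + 1) - u l) with hw
  have hw0 : ∀ l, 0 ≤ w l := fun l => mul_nonneg (ha0 l) (norm2_nonneg _)
  have hgL : ∑ l ∈ Finset.range L, w l ≤ g :=
    (Finset.sum_le_sum_of_subset_of_nonneg (Finset.range_mono hLM) fun l _ _ => hw0 l).trans hg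
  have hgH : ∑ l ∈ Finset.Ico L M, w l ≤ g := by
    refine (Finset.sum_le_sum_of_subset_of_nonneg (fun l hl => ?_) fun l _ _ => hw0 l).trans hg
    exact Finset.mem_range.mpr (Finset.mem_Ico.mp hl).2
  have hg0 : 0 ≤ g := (Finset.sum_nonneg fun l _ => hw0 l).trans hgL
  have hL : |isoDefect B (u L)| ≤ 52 * (c * g) * r := by
    have h0 : isoDefect B (u L) = ∑ l ∈ Finset.range L,
        (isoDefect B (u (l + 1)) - isoDefect B (u l)) := by
      rw [Finset.sum_range_sub (fun l => isoDefect B (u l)), hu0]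
      simp [isoDefect, norm2_zero]
    rw [h0]
    refine (Finset.abs_sum_le_sum_abs _ _).trans ?_
    have : ∀ l ∈ Finset.range L, |isoDefect B (u (l + 1)) - isoDefect B (u l)|
        ≤ 52 * c * r * w l := by
      intro l hl
      rw [Finset.mem_range] at hl
      refine (hinc l (hl.trans_le hLM)).trans ?_
      have h1 := hlow l hl
      have h2 := ha0 l
      have h3 : a l + a l ^ 2 ≤ 2 * a l := by nlinarith
      calc _ = 26 * c * norm2 (u (l + 1) - u l) * r * (a l + a l ^ 2) := by ring
        _ ≤ 26 * c * norm2 (u (l + 1) - u l) * r * (2 * a l) := by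
            refine mul_le_mul_of_nonneg_left h3 ?_
            positivity [norm2_nonneg (u (l + 1) - u l)]
        _ = _ := by simp only [hw]; ring
    refine (Finset.sum_le_sum this).trans ?_
    rw [← Finset.mul_sum]
    calc _ ≤ 52 * c * r * g := mul_le_mul_of_nonneg_left hgL (by positivity)
      _ = _ := by ring
  have hBd : ∀ l ∈ Finset.Ico L M, norm2 (B *ᵥ (u (l + 1) - u l)) ≤ 27 * c * w l := by
    intro l hl
    have h1 := hhigh l hl
    have h2 := (abs_le.mp (hdiff l (Finset.mem_Ico.mp hl).2)).2
    refine le_of_sq_le_sq ?_ (by positivity [hw0 l])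
    set z := norm2 (u (l + 1) - u l)
    have hz : 0 ≤ z := norm2_nonneg _
    have h3 : a l + a l ^ 2 ≤ 2 * a l ^ 2 := by nlinarith
    have h4 : norm2 (B *ᵥ (u (l + 1) - u l)) ^ 2 ≤ 13 * (c * (a l + a l ^ 2)) * z ^ 2 + z ^ 2 := by
      unfold isoDefect at h2; linarith
    have h5 : 13 * (c * (a l + a l ^ 2)) * z ^ 2 ≤ 13 * (c * (2 * a l ^ 2)) * z ^ 2 := by gcongr
    have h6 : z ^ 2 ≤ c * a l ^ 2 * z ^ 2 := by
      have : 1 ≤ c * a l ^ 2 := one_le_mul_of_one_le_of_one_le hc (one_le_pow₀ h1)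
      nlinarith [sq_nonneg z]
    have h7 : 27 * c * (a l ^ 2 * z ^ 2) ≤ (27 * c) ^ 2 * (a l ^ 2 * z ^ 2) := by
      refine mul_le_mul_of_nonneg_right ?_ (by positivity)
      nlinarith
    simp only [hw]
    calc _ ≤ 27 * c * (a l ^ 2 * z ^ 2) := by linarith
      _ ≤ _ := h7
      _ = _ := by ring
  have htel : ∑ l ∈ Finset.Ico L M, (u (l + 1) - u l) = u M - u L := Finset.sum_Ico_sub u hLM
  have hB : norm2 (B *ᵥ (u M - u L)) ≤ 27 * (c * g) := by
    rw [← htel, Matrix.mulVec_sum]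
    refine (norm2_sum_le _ _).trans ((Finset.sum_le_sum hBd).trans ?_)
    rw [← Finset.mul_sum, mul_assoc]
    gcongr
  have hd : norm2 (u M - u L) ≤ c * g := by
    rw [← htel]
    refine (norm2_sum_le _ _).trans ((Finset.sum_le_sum (g := w) fun l hl => ?_).trans ?_)
    · exact le_mul_of_one_le_left (norm2_nonneg _) (hhigh l hl)
    · exact hgH.trans (le_mul_of_one_le_left hg0 hc)
  have hBL : norm2 (B *ᵥ u L) ^ 2 ≤ 2 * r ^ 2 := by
    have h1 := (abs_le.mp hL).2
    unfold isoDefect at h1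
    have h2 : norm2 (u L) ^ 2 ≤ r ^ 2 := pow_le_pow_left₀ (norm2_nonneg _) (hur L) 2
    nlinarith
  have hBL' : norm2 (B *ᵥ u L) ≤ 2 * r :=
    le_of_sq_le_sq (by nlinarith) (by positivity)
  have hBM : norm2 (B *ᵥ u M) ≤ norm2 (B *ᵥ u L) + norm2 (B *ᵥ (u M - u L)) := by
    calc _ = norm2 (B *ᵥ u L + B *ᵥ (u M - u L)) := by rw [← Matrix.mulVec_add]; simp
      _ ≤ _ := norm2_add_le _ _
  have hBM' : norm2 (B *ᵥ u L) ≤ norm2 (B *ᵥ u M) + norm2 (B *ᵥ (u M - u L)) := by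
    calc _ = norm2 (B *ᵥ u M - B *ᵥ (u M - u L)) := by rw [← Matrix.mulVec_sub]; simp
      _ ≤ _ := norm2_sub_le _ _
  have hM1 : norm2 (u M) ≤ norm2 (u L) + norm2 (u M - u L) := by
    calc _ = norm2 (u L + (u M - u L)) := by simp
      _ ≤ _ := norm2_add_le _ _
  have hM2 : norm2 (u L) ≤ norm2 (u M) + norm2 (u M - u L) := by
    calc _ = norm2 (u M - (u M - u L)) := by simp
      _ ≤ _ := norm2_sub_le _ _
  have hrL := hur L
  have hrM := hur M
  set t := c * g with ht
  have ht0 : 0 ≤ t := by positivity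
  have n1 := norm2_nonneg (B *ᵥ u M)
  have n2 := norm2_nonneg (B *ᵥ u L)
  have n3 := norm2_nonneg (u M)
  have n4 := norm2_nonneg (u L)
  have e1 : |norm2 (B *ᵥ u M) ^ 2 - norm2 (B *ᵥ u L) ^ 2| ≤ 27 * t * (5 * r) := by
    rw [sq_sub_sq, abs_mul, mul_comm]
    have hr1 : 27 * t ≤ r := by nlinarith
    refine mul_le_mul (abs_le.mpr ⟨by linarith, by linarith⟩) ?_ (abs_nonneg _) (by positivity)
    rw [abs_of_nonneg (by positivity)]
    linarith
  have e2 : |norm2 (u M) ^ 2 - norm2 (u L) ^ 2| ≤ t * (2 * r) := by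
    rw [sq_sub_sq, abs_mul, mul_comm]
    refine mul_le_mul (abs_le.mpr ⟨by linarith, by linarith⟩) ?_ (abs_nonneg _) (by positivity)
    rw [abs_of_nonneg (by positivity)]
    linarith
  have hfin : |isoDefect B (u M)| ≤ 189 * t * r := by
    unfold isoDefect at hL ⊢
    rw [abs_le] at *
    constructor <;> linarith [hL.1, hL.2, e1.1, e1.2, e2.1, e2.2]
  calc _ ≤ 189 * t * r := hfin
    _ ≤ α * r * r := mul_le_mul_of_nonneg_right hα hr
    _ = _ := by ring

lemma isoDefect_eq {p n : ℕ} (B : Matrix (Fin p) (Fin n) ℝ) (z : Fin n → ℝ) :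
    isoDefect B z = z ⬝ᵥ (Bᵀ * B - 1) *ᵥ z := by
  rw [isoDefect, ← dotProduct_self_eq_norm2_sq, ← dotProduct_self_eq_norm2_sq, Matrix.sub_mulVec,
    Matrix.one_mulVec, dotProduct_sub, ← Matrix.mulVec_mulVec, Matrix.dotProduct_mulVec z,
    Matrix.vecMul_transpose]

/-- The random sign matrix. -/
def signDiag {n : ℕ} (ε : Fin n → Bool) : Matrix (Fin n) (Fin n) ℝ :=
  Matrix.diagonal fun t => rsign (ε t)

lemma signDiag_mulVec {n : ℕ} (ε : Fin n → Bool) (x : Fin n → ℝ) :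
    signDiag ε *ᵥ x = fun t => rsign (ε t) * x t := by
  ext t
  simp [signDiag, Matrix.mulVec_diagonal]

lemma norm2_signDiag_mulVec {n : ℕ} (ε : Fin n → Bool) (x : Fin n → ℝ) :
    norm2 (signDiag ε *ᵥ x) = norm2 x := by
  simp only [signDiag_mulVec, norm2, mul_pow, rsign_sq, one_mul]

lemma isoDefect_mul_signDiag {p n : ℕ} (B : Matrix (Fin p) (Fin n) ℝ) (ε : Fin n → Bool)
    (z : Fin n → ℝ) : isoDefect (B * signDiag ε) z = isoDefect B (signDiag ε *ᵥ z) := by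
  rw [isoDefect, isoDefect, norm2_signDiag_mulVec, Matrix.mulVec_mulVec]

lemma abs_isoDefect_sub_le {p n : ℕ} (B : Matrix (Fin p) (Fin n) ℝ) {h : ℝ} {v w : Fin n → ℝ}
    (h1 : |isoDefect B (norm2 (w + v) • (w - v) + norm2 (w - v) • (w + v))|
      ≤ h * norm2 (norm2 (w + v) • (w - v) + norm2 (w - v) • (w + v)) ^ 2)
    (h2 : |isoDefect B (norm2 (w + v) • (w - v) - norm2 (w - v) • (w + v))|
      ≤ h * norm2 (norm2 (w + v) • (w - v) - norm2 (w - v) • (w + v)) ^ 2) :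
    |isoDefect B w - isoDefect B v| ≤ h * norm2 (w - v) * norm2 (w + v) := by
  set a := w - v with ha
  set b := w + v with hb
  set N := Bᵀ * B - 1 with hN
  have hsymm : Nᵀ = N := by simp [hN, Matrix.transpose_sub, Matrix.transpose_mul]
  have hab : isoDefect B w - isoDefect B v = a ⬝ᵥ N *ᵥ b := by
    rw [isoDefect_eq, isoDefect_eq, ← hN, ha, hb, Matrix.mulVec_add, dotProduct_add,
      sub_dotProduct, sub_dotProduct, mulVec_dotProduct_symm hsymm w v]
    ring
  have hpol : isoDefect B (norm2 b • a + norm2 a • b) - isoDefect B (norm2 b • a - norm2 a • b)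
      = 4 * (norm2 a * norm2 b) * (a ⬝ᵥ N *ᵥ b) := by
    rw [isoDefect_eq, isoDefect_eq, ← hN]
    simp only [Matrix.mulVec_add, Matrix.mulVec_sub, Matrix.mulVec_smul, dotProduct_add,
      dotProduct_sub, add_dotProduct, sub_dotProduct, smul_dotProduct, dotProduct_smul, smul_eq_mul,
      mulVec_dotProduct_symm hsymm b a]
    ring
  have hpar := norm2_add_sq_add_norm2_sub_sq (norm2 b • a) (norm2 a • b)
  rw [norm2_smul, norm2_smul, abs_of_nonneg (norm2_nonneg a), abs_of_nonneg (norm2_nonneg b)] at hpar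
  have ha0 := norm2_nonneg a
  have hb0 := norm2_nonneg b
  rw [hab]
  rcases (mul_nonneg ha0 hb0).eq_or_lt with h0 | h0
  · rcases mul_eq_zero.mp h0.symm with hz | hz
    · rw [norm2_eq_zero.mp hz]; simp [norm2_zero]
    · rw [norm2_eq_zero.mp hz]; simp [norm2_zero]
  · have h3 := abs_sub (isoDefect B (norm2 b • a + norm2 a • b))
      (isoDefect B (norm2 b • a - norm2 a • b))
    rw [hpol, abs_mul, abs_of_pos (by linarith)] at h3
    have h4 : norm2 a * norm2 b * |a ⬝ᵥ N *ᵥ b|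
        ≤ norm2 a * norm2 b * (h * norm2 a * norm2 b) := by
      have e : h * norm2 (norm2 b • a + norm2 a • b) ^ 2
          + h * norm2 (norm2 b • a - norm2 a • b) ^ 2
          = 4 * (norm2 a * norm2 b * (h * norm2 a * norm2 b)) := by
        rw [← mul_add, hpar]; ring
      linarith
    exact le_of_mul_le_mul_left h4 h0

lemma chain_union_term_le {ν : ℝ} (hν : 0 < ν) {s₀ : ℕ} (hs₀ : 20 * (1 + ν) ≤ s₀) (l : ℕ) :
    (3 * (2 ^ 2 ^ l * 2 ^ 2 ^ (l + 1)) : ℝ) * (4 * Real.exp (-((s₀ * 2 ^ l : ℕ) : ℝ) / 2))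
      ≤ Real.exp (-ν) * (1 / 4) ^ (l + 1) := by
  have h2 : (2 : ℝ) ≤ Real.exp 1 := by linarith [Real.add_one_le_exp (1 : ℝ)]
  have hl : ((l + 1 : ℕ) : ℝ) ≤ 2 ^ l := by exact_mod_cast Nat.lt_two_pow_self
  have hl1 : (1 : ℝ) ≤ 2 ^ l := one_le_pow₀ one_le_two
  have e1 : (12 : ℝ) ≤ Real.exp 4 := by
    calc (12 : ℝ) ≤ 2 ^ 4 := by norm_num
      _ ≤ Real.exp 1 ^ 4 := by gcongr
      _ = Real.exp 4 := by rw [← Real.exp_nat_mul]; norm_num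
  have e2 : ∀ m : ℕ, (2 : ℝ) ^ m ≤ Real.exp m := fun m => by
    calc (2 : ℝ) ^ m ≤ Real.exp 1 ^ m := by gcongr
      _ = Real.exp m := by rw [← Real.exp_nat_mul, mul_one]
  have e3 : Real.exp (-(2 * ((l + 1 : ℕ) : ℝ))) ≤ (1 / 4) ^ (l + 1) := by
    have : (4 : ℝ) ^ (l + 1) ≤ Real.exp (2 * ((l + 1 : ℕ) : ℝ)) := by
      have := e2 (2 * (l + 1))
      rw [pow_mul] at this
      push_cast at this ⊢
      norm_num at this ⊢
      exact this
    rw [Real.exp_neg, one_div, inv_pow]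
    exact inv_anti₀ (by positivity) this
  calc _ = 12 * (2 ^ 2 ^ l * 2 ^ 2 ^ (l + 1)) * Real.exp (-((s₀ * 2 ^ l : ℕ) : ℝ) / 2) := by ring
    _ ≤ Real.exp 4 * (Real.exp ((2 ^ l : ℕ) : ℝ) * Real.exp ((2 ^ (l + 1) : ℕ) : ℝ))
        * Real.exp (-((s₀ * 2 ^ l : ℕ) : ℝ) / 2) := by
        gcongr
        · exact e2 _
        · exact e2 _
    _ ≤ Real.exp (-ν) * Real.exp (-(2 * ((l + 1 : ℕ) : ℝ))) := by
        rw [← Real.exp_add, ← Real.exp_add, ← Real.exp_add, ← Real.exp_add]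
        refine Real.exp_le_exp.mpr ?_
        push_cast at hl ⊢
        rw [pow_succ]
        nlinarith
    _ ≤ _ := by gcongr

lemma sum_quarter_pow_le (M : ℕ) : ∑ l ∈ Finset.range M, (1 / 4 : ℝ) ^ (l + 1) ≤ 1 / 2 := by
  have key : ∀ M : ℕ, ∑ l ∈ Finset.range M, (1 / 4 : ℝ) ^ (l + 1) ≤ 1 / 2 - (1 / 4) ^ M / 2 := by
    intro M
    induction M with
    | zero => norm_num
    | succ M ih =>
      rw [Finset.sum_range_succ, pow_succ]
      have h2 : (0 : ℝ) ≤ (1 / 4) ^ M := by positivity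
      linarith
  have := key M
  have h2 : (0 : ℝ) ≤ (1 / 4) ^ M := by positivity
  linarith

/-- Random column signs turn a sparse restricted isometry into a near isometry on a finite set,
at the scale of its Gaussian width. -/
theorem unifProb_isoDefect_gt_le {p n : ℕ} (B : Matrix (Fin p) (Fin n) ℝ)
    {S : Finset (Fin n → ℝ)} (h0 : 0 ∈ S) {δ ν r α c : ℝ} (hδ : 0 < δ) (hν : 0 < ν) (hc : 1 ≤ c)
    (hrip : ∀ s : ℕ, 0 < s → ∀ x y, IsSparse s x → IsSparse s y →
      |x ⬝ᵥ (Bᵀ * B - 1) *ᵥ y| ≤ c * (δ * √s + δ ^ 2 * s) * norm2 x * norm2 y)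
    (hr : ∀ x ∈ S, norm2 x ≤ r) {s₀ : ℕ} (hs₀ : 20 * (1 + ν) ≤ s₀)
    (hα : 189 * (c * (δ * √s₀ * (1168 * (gwid S / (gaussAbs / 4))))) ≤ α * r) (hα1 : α ≤ 1) :
    unifProb (fun ε : Fin n → Bool => ∃ x ∈ S, α * r ^ 2 < |isoDefect (B * signDiag ε) x|)
      ≤ Real.exp (-ν) / 2 := by
  classical
  obtain ⟨M, d, hd0, hdM, hdS, hcard, hsum⟩ := exists_admissible_chain h0
  have hs0 : 0 < s₀ := by
    have : (0 : ℝ) < s₀ := by linarith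
    exact_mod_cast this
  have hr0 : 0 ≤ r := by simpa [norm2_zero] using hr 0 h0
  set N := Bᵀ * B - 1 with hN
  have hsymm : Nᵀ = N := by simp [hN, Matrix.transpose_sub, Matrix.transpose_mul]
  set a : ℕ → ℝ := fun l => δ * √s₀ * √2 ^ l with ha
  have ha0 : ∀ l, 0 < a l := fun l => by simp only [ha]; positivity
  have hamono : Monotone a := fun k l hkl =>
    mul_le_mul_of_nonneg_left (pow_le_pow_right₀ (Real.one_le_sqrt.mpr one_le_two) hkl)
      (by positivity)
  have hsq : ∀ l : ℕ, (√2 ^ l) ^ 2 = (2 : ℝ) ^ l := fun l => by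
    rw [← pow_mul, mul_comm, pow_mul, Real.sq_sqrt zero_le_two]
  have haη : ∀ l, c * (a l + a l ^ 2)
      = c * (δ * √((s₀ * 2 ^ l : ℕ) : ℝ) + δ ^ 2 * ((s₀ * 2 ^ l : ℕ) : ℝ)) := by
    intro l
    have h1 : √((s₀ * 2 ^ l : ℕ) : ℝ) = √s₀ * √2 ^ l := by
      push_cast
      rw [Real.sqrt_mul (by positivity), ← hsq l, Real.sqrt_sq (by positivity)]
    rw [h1]
    simp only [ha, mul_pow, hsq, Real.sq_sqrt (Nat.cast_nonneg s₀)]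
    push_cast
    ring
  let P : ℕ → Finset ((Fin n → ℝ) × (Fin n → ℝ)) := fun l => S.image (d l) ×ˢ S.image (d (l + 1))
  let f₁ : (Fin n → ℝ) × (Fin n → ℝ) → Fin n → ℝ := fun q =>
    norm2 (q.2 + q.1) • (q.2 - q.1) + norm2 (q.2 - q.1) • (q.2 + q.1)
  let f₂ : (Fin n → ℝ) × (Fin n → ℝ) → Fin n → ℝ := fun q =>
    norm2 (q.2 + q.1) • (q.2 - q.1) - norm2 (q.2 - q.1) • (q.2 + q.1)
  let f₃ : (Fin n → ℝ) × (Fin n → ℝ) → Fin n → ℝ := fun q => q.2 - q.1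
  let Z : ℕ → Finset (Fin n → ℝ) := fun l => (P l).image f₁ ∪ ((P l).image f₂ ∪ (P l).image f₃)
  have hZ : ∀ l ∈ Finset.range M, ((Z l).card : ℝ) ≤ 3 * (2 ^ 2 ^ l * 2 ^ 2 ^ (l + 1)) := by
    intro l hl
    rw [Finset.mem_range] at hl
    have hP : (P l).card ≤ 2 ^ 2 ^ l * 2 ^ 2 ^ (l + 1) := by
      rw [Finset.card_product]
      exact Nat.mul_le_mul (hcard l hl.le) (hcard (l + 1) hl)
    have : (Z l).card ≤ 3 * (2 ^ 2 ^ l * 2 ^ 2 ^ (l + 1)) := by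
      have h1 := Finset.card_union_le ((P l).image f₁) ((P l).image f₂ ∪ (P l).image f₃)
      have h2 := Finset.card_union_le ((P l).image f₂) ((P l).image f₃)
      have g1 : ((P l).image f₁).card ≤ (P l).card := Finset.card_image_le
      have g2 : ((P l).image f₂).card ≤ (P l).card := Finset.card_image_le
      have g3 : ((P l).image f₃).card ≤ (P l).card := Finset.card_image_le
      simp only [Z]
      omega
    exact_mod_cast this
  have hbad : unifProb (fun ε : Fin n → Bool => ∃ l ∈ Finset.range M, ∃ z ∈ Z l,
      13 * (c * (a l + a l ^ 2) * norm2 z ^ 2) < |isoDefect (B * signDiag ε) z|)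
      ≤ Real.exp (-ν) / 2 := by
    refine (unifProb_exists_le _ _).trans ?_
    calc _ ≤ ∑ l ∈ Finset.range M, Real.exp (-ν) * (1 / 4) ^ (l + 1) := by
          refine Finset.sum_le_sum fun l hl => ?_
          refine ((unifProb_exists_le _ _).trans
            (Finset.sum_le_sum (g := fun _ => 4 * Real.exp (-((s₀ * 2 ^ l : ℕ) : ℝ) / 2))
              fun z _ => ?_)).trans ?_
          · simp only [isoDefect_mul_signDiag, isoDefect_eq B, signDiag_mulVec, ← hN]
            refine unifProb_signed_quadratic_le (by positivity) hsymm ?_ ?_ z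
            · have := ha0 l
              positivity
            · intro x y hx hy
              rw [haη]
              exact hrip _ (by positivity) x y hx hy
          · rw [Finset.sum_const, nsmul_eq_mul]
            exact (mul_le_mul_of_nonneg_right (hZ l hl) (by positivity)).trans
              (chain_union_term_le hν hs₀ l)
      _ ≤ Real.exp (-ν) * (1 / 2) := by
          rw [← Finset.mul_sum]
          exact mul_le_mul_of_nonneg_left (sum_quarter_pow_le M) (Real.exp_pos _).le
      _ = _ := by ring
  refine (unifProb_mono fun ε hε => ?_).trans hbad
  by_contra hgood
  push Not at hgood
  obtain ⟨x, hx, hlt⟩ := hε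
  refine absurd hlt (not_lt.mpr ?_)
  have hmemP : ∀ l, (d l x, d (l + 1) x) ∈ P l := fun l =>
    Finset.mem_product.mpr ⟨Finset.mem_image_of_mem _ hx, Finset.mem_image_of_mem _ hx⟩
  have hmain := abs_isoDefect_le_of_chain (B * signDiag ε) (M := M) (u := fun l => d l x) (a := a)
    (c := c) (r := r) (g := δ * √s₀ * (1168 * (gwid S / (gaussAbs / 4)))) (α := α) hamono
    (fun l => (ha0 l).le) hc hr0 (hd0 x) (fun l => hr _ (hdS l x hx)) (fun l hl => ?_)
    (fun l hl => ?_) ?_ hα hα1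
  · rwa [hdM x hx] at hmain
  · have g1 := hgood l (Finset.mem_range.mpr hl) (f₁ (d l x, d (l + 1) x))
      (Finset.mem_union_left _ (Finset.mem_image_of_mem _ (hmemP l)))
    have g2 := hgood l (Finset.mem_range.mpr hl) (f₂ (d l x, d (l + 1) x))
      (Finset.mem_union_right _ (Finset.mem_union_left _ (Finset.mem_image_of_mem _ (hmemP l))))
    rw [← mul_assoc] at g1 g2
    refine (abs_isoDefect_sub_le _ g1 g2).trans ?_
    have := ha0 l
    refine mul_le_mul_of_nonneg_left ?_ (by positivity [norm2_nonneg (d (l + 1) x - d l x)])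
    have := norm2_add_le (d (l + 1) x) (d l x)
    linarith [hr _ (hdS l x hx), hr _ (hdS (l + 1) x hx)]
  · have g3 := hgood l (Finset.mem_range.mpr hl) (f₃ (d l x, d (l + 1) x))
      (Finset.mem_union_right _ (Finset.mem_union_right _ (Finset.mem_image_of_mem _ (hmemP l))))
    rwa [← mul_assoc] at g3
  · simp only [ha, mul_assoc (δ * √s₀)]
    rw [← Finset.mul_sum]
    exact mul_le_mul_of_nonneg_left (hsum x hx) (by positivity)

lemma expect_mul_apply_of_ne {ι κ : Type*} [Fintype ι] [DecidableEq ι] [Fintype κ] {f : κ → ℝ}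
    (hf : 𝔼 k, f k = 0) {s s' : ι} (hs : s ≠ s') : 𝔼 o : ι → κ, f (o s) * f (o s') = 0 := by
  have h := expect_pi_prod fun (j : ι) (k : κ) =>
    (if j = s then f k else 1) * (if j = s' then f k else 1)
  have h1 : ∀ o : ι → κ, ∏ j, ((if j = s then f (o j) else 1) * (if j = s' then f (o j) else 1))
      = f (o s) * f (o s') := fun o => by
    rw [Finset.prod_mul_distrib]
    simp
  simp only [h1] at h
  rw [h]
  exact Finset.prod_eq_zero (Finset.mem_univ s) (by simpa [hs] using hf)

lemma expect_sq_apply {ι κ : Type*} [Fintype ι] [DecidableEq ι] [Fintype κ] [Nonempty κ]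
    (f : κ → ℝ) (s : ι) : 𝔼 o : ι → κ, f (o s) ^ 2 = 𝔼 k, f k ^ 2 := by
  have h := expect_pi_prod fun (j : ι) (k : κ) => if j = s then f k ^ 2 else 1
  have h1 : ∀ o : ι → κ, ∏ j, (if j = s then f (o j) ^ 2 else 1) = f (o s) ^ 2 := fun o => by simp
  simp only [h1] at h
  rw [h, Finset.prod_eq_single s]
  · simp
  · intro j _ hj
    simp [hj]
  · simp

lemma expect_sq_sum {ι κ : Type*} [Fintype ι] [DecidableEq ι] [Fintype κ] [Nonempty κ] {f : κ → ℝ}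
    (hf : 𝔼 k, f k = 0) (c : ι → ℝ) :
    𝔼 o : ι → κ, (∑ s, c s * f (o s)) ^ 2 = (∑ s, c s ^ 2) * 𝔼 k, f k ^ 2 := by
  have h : ∀ o : ι → κ, (∑ s, c s * f (o s)) ^ 2
      = ∑ s, ∑ s', c s * c s' * (f (o s) * f (o s')) := fun o => by
    rw [sq, Finset.sum_mul_sum]
    exact Finset.sum_congr rfl fun s _ => Finset.sum_congr rfl fun s' _ => by ring
  simp only [h, Finset.expect_sum_comm, ← Finset.mul_expect]
  rw [Finset.sum_mul]
  refine Finset.sum_congr rfl fun s _ => ?_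
  rw [Finset.sum_eq_single s]
  · simp only [← sq]
    rw [expect_sq_apply f s]
  · intro s' _ hs'
    rw [expect_mul_apply_of_ne hf hs'.symm, mul_zero]
  · simp

/-- The normalized combination of signed rows of `U` produced by one block of measurements. -/
def blockRow {n lam : ℕ} (U : Matrix (Fin n) (Fin n) ℝ) (v : Fin lam → ℝ)
    (o : Fin lam → Fin n × Bool) : Fin n → ℝ :=
  ∑ s, (v s / norm2 v) • (rsign (o s).2 • U (o s).1)

lemma blockRow_dotProduct {n lam : ℕ} (U : Matrix (Fin n) (Fin n) ℝ) (v : Fin lam → ℝ)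
    (o : Fin lam → Fin n × Bool) (x : Fin n → ℝ) :
    blockRow U v o ⬝ᵥ x = ∑ s, v s / norm2 v * (rsign (o s).2 * (U (o s).1 ⬝ᵥ x)) := by
  simp only [blockRow, sum_dotProduct, smul_dotProduct, smul_eq_mul]

lemma abs_blockRow_dotProduct_le {n lam : ℕ} {U : Matrix (Fin n) (Fin n) ℝ} {v : Fin lam → ℝ}
    (o : Fin lam → Fin n × Bool) (x : Fin n → ℝ) (e : ℝ) (h : ∀ i, |U i ⬝ᵥ x| ≤ e) :
    |blockRow U v o ⬝ᵥ x| ≤ norm1 v / norm2 v * e := by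
  rw [blockRow_dotProduct, norm1, Finset.sum_div, Finset.sum_mul]
  refine (Finset.abs_sum_le_sum_abs _ _).trans (Finset.sum_le_sum fun s _ => ?_)
  rw [abs_mul, abs_mul, abs_rsign, one_mul, abs_div, abs_of_nonneg (norm2_nonneg v)]
  exact mul_le_mul_of_nonneg_left (h _) (by positivity [norm2_nonneg v])

lemma sum_sq_row_dotProduct {n : ℕ} {U : Matrix (Fin n) (Fin n) ℝ}
    (hU : Uᵀ * U = (n : ℝ) • (1 : Matrix (Fin n) (Fin n) ℝ)) (x : Fin n → ℝ) :
    ∑ i, (U i ⬝ᵥ x) ^ 2 = n * norm2 x ^ 2 := by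
  have h : (U *ᵥ x) ⬝ᵥ (U *ᵥ x) = x ⬝ᵥ (Uᵀ * U) *ᵥ x := by
    rw [← Matrix.mulVec_mulVec, Matrix.dotProduct_mulVec x, Matrix.vecMul_transpose]
  rw [hU, Matrix.smul_mulVec, Matrix.one_mulVec, dotProduct_smul, smul_eq_mul,
    dotProduct_self_eq_norm2_sq x] at h
  rw [← h, dotProduct]
  exact Finset.sum_congr rfl fun i _ => by rw [sq]; rfl

lemma expect_sq_blockRow_dotProduct {n lam : ℕ} (hn : 0 < n) {U : Matrix (Fin n) (Fin n) ℝ}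
    (hU : Uᵀ * U = (n : ℝ) • (1 : Matrix (Fin n) (Fin n) ℝ)) {v : Fin lam → ℝ}
    (hv : 0 < norm2 v) (x : Fin n → ℝ) :
    𝔼 o, (blockRow U v o ⬝ᵥ x) ^ 2 = norm2 x ^ 2 := by
  have : NeZero n := ⟨hn.ne'⟩
  have hn' : (0 : ℝ) < n := by exact_mod_cast hn
  set f : Fin n × Bool → ℝ := fun q => rsign q.2 * (U q.1 ⬝ᵥ x) with hf
  have hf0 : 𝔼 q, f q = 0 := by
    rw [expect_prod_type]
    simp only [hf, ← Finset.expect_mul, expect_rsign, zero_mul, Finset.expect_const_zero]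
  have hf2 : 𝔼 q, f q ^ 2 = norm2 x ^ 2 := by
    rw [expect_prod_type]
    simp only [hf, mul_pow, rsign_sq, one_mul]
    have : ∀ i : Fin n, 𝔼 _b : Bool, (U i ⬝ᵥ x) ^ 2 = (U i ⬝ᵥ x) ^ 2 := fun i =>
      Fintype.expect_const _
    simp only [this]
    rw [Fintype.expect_eq_sum_div_card, sum_sq_row_dotProduct hU, Fintype.card_fin]
    field_simp
  simp only [blockRow_dotProduct]
  have h := expect_sq_sum hf0 fun s => v s / norm2 v
  simp only [hf] at h
  rw [h]
  simp only [hf] at hf2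
  rw [hf2]
  simp only [div_pow]
  rw [← Finset.sum_div, ← norm2_sq, div_self (by positivity), one_mul]

lemma norm2_le_of_forall_row {n : ℕ} (hn : 0 < n) {U : Matrix (Fin n) (Fin n) ℝ}
    (hU : Uᵀ * U = (n : ℝ) • (1 : Matrix (Fin n) (Fin n) ℝ)) (x : Fin n → ℝ) (e : ℝ)
    (h : ∀ i, |U i ⬝ᵥ x| ≤ e) : norm2 x ≤ e := by
  have hn' : (0 : ℝ) < n := by exact_mod_cast hn
  have he : 0 ≤ e := (abs_nonneg _).trans (h ⟨0, hn⟩)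
  refine le_of_sq_le_sq ?_ he
  refine le_of_mul_le_mul_left ?_ hn'
  rw [← sum_sq_row_dotProduct hU]
  calc _ ≤ ∑ _i : Fin n, e ^ 2 := Finset.sum_le_sum fun i _ => sq_le_sq' (abs_le.mp (h i)).1
        (abs_le.mp (h i)).2
    _ = _ := by simp

/-- The compressed measurement matrix with rows `blockRow / √p`. -/
def measMat {n p lam : ℕ} (U : Matrix (Fin n) (Fin n) ℝ) (v : Fin lam → ℝ)
    (o : Fin p → Fin lam → Fin n × Bool) : Matrix (Fin p) (Fin n) ℝ :=
  Matrix.of fun k t => blockRow U v (o k) t / √p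

lemma measMat_mulVec {n p lam : ℕ} (U : Matrix (Fin n) (Fin n) ℝ) (v : Fin lam → ℝ)
    (o : Fin p → Fin lam → Fin n × Bool) (x : Fin n → ℝ) (k : Fin p) :
    (measMat U v o *ᵥ x) k = (blockRow U v (o k) ⬝ᵥ x) / √p := by
  simp only [measMat, Matrix.mulVec, dotProduct, Matrix.of_apply, Finset.sum_div]
  exact Finset.sum_congr rfl fun t _ => by ring

lemma dotProduct_measMat {n p lam : ℕ} (U : Matrix (Fin n) (Fin n) ℝ) (v : Fin lam → ℝ)
    (o : Fin p → Fin lam → Fin n × Bool) (x y : Fin n → ℝ) :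
    x ⬝ᵥ ((measMat U v o)ᵀ * measMat U v o - 1) *ᵥ y
      = devBilin (fun k => blockRow U v (o k)) x y := by
  rw [Matrix.sub_mulVec, Matrix.one_mulVec, dotProduct_sub, ← Matrix.mulVec_mulVec,
    Matrix.dotProduct_mulVec x, Matrix.vecMul_transpose, devBilin]
  congr 1
  simp only [dotProduct, Finset.sum_div]
  refine Finset.sum_congr rfl fun k _ => ?_
  rw [measMat_mulVec, measMat_mulVec, div_mul_div_comm, Real.mul_self_sqrt (Nat.cast_nonneg p)]
  rfl

/-- The absolute constant in the restricted isometry bound. -/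
def ripConst : ℝ := 24 * 82944 ^ 2

theorem unifProb_measMat_isoDefect_gt_le {n p lam : ℕ} (hn : 2 ≤ n) (hp : 0 < p)
    {U : Matrix (Fin n) (Fin n) ℝ}
    (hU : Uᵀ * U = (n : ℝ) • (1 : Matrix (Fin n) (Fin n) ℝ)) (hU1 : ∀ i j, |U i j| ≤ 1)
    {v : Fin lam → ℝ} (hv : 0 < norm2 v) {S : Finset (Fin n → ℝ)} (h0 : 0 ∈ S)
    {δ ν r α : ℝ} (hν : 0 < ν)
    (hδ : δ = norm1 v / norm2 v * Real.log n ^ 2 * √(1 + ν) / √p) (hr : ∀ x ∈ S, norm2 x ≤ r)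
    {s₀ : ℕ} (hs₀ : 20 * (1 + ν) ≤ s₀)
    (hα : 189 * (ripConst * (δ * √s₀ * (1168 * (gwid S / (gaussAbs / 4))))) ≤ α * r)
    (hα1 : α ≤ 1) :
    unifProb (fun q : (Fin p → Fin lam → Fin n × Bool) × (Fin n → Bool) =>
      ∃ x ∈ S, α * r ^ 2 < |isoDefect (measMat U v q.1 * signDiag q.2) x|) ≤ Real.exp (-ν) := by
  have hn0 : 0 < n := by omega
  have : NeZero n := ⟨hn0.ne'⟩
  have hK : 0 < norm1 v / norm2 v := div_pos (hv.trans_le (norm2_le_norm1 v)) hv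
  have hlog : 0 < Real.log n := Real.log_pos (by exact_mod_cast hn)
  have hp' : (0 : ℝ) < √p := Real.sqrt_pos.mpr (by exact_mod_cast hp)
  have hδ0 : 0 < δ := by rw [hδ]; positivity
  have hripP := unifProb_not_rip_le (U := U) (b := blockRow U v) hn hp hK hU1
    abs_blockRow_dotProduct_le (expect_sq_blockRow_dotProduct hn0 hU hv)
    (norm2_le_of_forall_row hn0 hU) hν hδ
  set R : (Fin p → Fin lam → Fin n × Bool) → Prop := fun o => ∀ s : ℕ, 0 < s → ∀ x y,
    IsSparse s x → IsSparse s y → |devBilin (fun k => blockRow U v (o k)) x y| ≤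
        24 * 82944 ^ 2 * (δ * Real.sqrt s + δ ^ 2 * s) * norm2 x * norm2 y with hR
  refine (unifProb_mono (Q := fun q => ¬ R q.1 ∨ (R q.1 ∧
    ∃ x ∈ S, α * r ^ 2 < |isoDefect (measMat U v q.1 * signDiag q.2) x|)) fun q hq => ?_).trans
    ((unifProb_or_le _ _).trans ?_)
  · by_cases hRq : R q.1
    exacts [Or.inr ⟨hRq, hq⟩, Or.inl hRq]
  · rw [← add_halves (Real.exp (-ν))]
    refine add_le_add ?_ (unifProb_prod_le fun o => ?_)
    · rw [unifProb_fst fun o => ¬ R o]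
      exact hripP
    · by_cases hRo : R o
      · refine (unifProb_mono fun ε hε => hε.2).trans
          (unifProb_isoDefect_gt_le (measMat U v o) h0 hδ0 hν (c := ripConst)
            (by norm_num [ripConst]) (fun s hs x y hx hy => ?_) hr hs₀ hα hα1)
        rw [dotProduct_measMat]
        exact hRo s hs x y hx hy
      · refine (unifProb_mono (Q := fun _ => False) fun ε hε => hRo hε.1).trans ?_
        simp only [unifProb_eq_expect, if_false, Finset.expect_const_zero]
        positivity

section

open MeasureTheory ProbabilityTheory

lemma abs_dotProduct_le_norm1_mul_norm {n : ℕ} (x g : Fin n → ℝ) :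
    |x ⬝ᵥ g| ≤ norm1 x * ‖g‖ := by
  rw [norm1, Finset.sum_mul]
  refine (Finset.abs_sum_le_sum_abs _ _).trans (Finset.sum_le_sum fun t _ => ?_)
  rw [abs_mul]
  exact mul_le_mul_of_nonneg_left (norm_le_pi_norm g t) (abs_nonneg _)

lemma bddAbove_image_dotProduct {n : ℕ} {T : Set (Fin n → ℝ)} {c : ℝ} (hT : ∀ x ∈ T, norm1 x ≤ c)
    (g : Fin n → ℝ) : BddAbove ((fun w => ∑ t, w t * g t) '' T) := by
  refine ⟨c * ‖g‖, ?_⟩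
  rintro _ ⟨x, hx, rfl⟩
  exact (le_abs_self _).trans ((abs_dotProduct_le_norm1_mul_norm x g).trans
    (mul_le_mul_of_nonneg_right (hT x hx) (norm_nonneg g)))

lemma integrable_sSup_dotProduct {n : ℕ} {T : Set (Fin n → ℝ)} (hne : T.Nonempty) {c : ℝ}
    (hT : ∀ x ∈ T, norm1 x ≤ c) :
    Integrable (fun g => sSup ((fun w => ∑ t, w t * g t) '' T)) (stdGauss (Fin n)) := by
  obtain ⟨x₀, hx₀⟩ := hne
  have hc : 0 ≤ c := (Finset.sum_nonneg fun t _ => abs_nonneg (x₀ t)).trans (hT x₀ hx₀)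
  set h : (Fin n → ℝ) → ℝ := fun g => sSup ((fun w => ∑ t, w t * g t) '' T) with hh
  have hle : ∀ g g' : Fin n → ℝ, h g ≤ h g' + c * dist g g' := by
    intro g g'
    refine csSup_le ⟨_, x₀, hx₀, rfl⟩ ?_
    rintro _ ⟨x, hx, rfl⟩
    have h1 : ∑ t, x t * g' t ≤ h g' := le_csSup (bddAbove_image_dotProduct hT g') ⟨x, hx, rfl⟩
    have h2 : x ⬝ᵥ (g - g') ≤ c * dist g g' := by
      rw [dist_eq_norm]
      exact (le_abs_self _).trans ((abs_dotProduct_le_norm1_mul_norm x _).trans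
        (mul_le_mul_of_nonneg_right (hT x hx) (norm_nonneg _)))
    rw [dotProduct_sub] at h2
    simp only [dotProduct] at h2
    linarith
  have hlip : LipschitzWith c.toNNReal h := LipschitzWith.of_le_add_mul _ fun g g' => by
    rw [Real.coe_toNNReal c hc]
    exact hle g g'
  have hInt : Integrable (fun g : Fin n → ℝ => c * ‖g‖) (stdGauss (Fin n)) :=
    (IsGaussian.integrable_id (μ := stdGauss (Fin n))).norm.const_mul c
  refine hInt.mono' hlip.continuous.aestronglyMeasurable (Filter.Eventually.of_forall fun g => ?_)
  have h0 : h 0 = 0 := by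
    have : (fun w : Fin n → ℝ => ∑ t, w t * (0 : Fin n → ℝ) t) '' T = {0} := by
      ext y
      simp only [Pi.zero_apply, mul_zero, Finset.sum_const_zero, Set.mem_image,
        Set.mem_singleton_iff]
      exact ⟨fun ⟨_, _, h⟩ => h.symm, fun h => ⟨x₀, hx₀, h.symm⟩⟩
    simp only [hh, this, csSup_singleton]
  have h1 := hle g 0
  have h2 := hle 0 g
  rw [dist_comm] at h2
  rw [h0, dist_zero_right] at *
  rw [Real.norm_eq_abs, abs_le]
  constructor <;> linarith

lemma gwid_le_gaussWidth {n : ℕ} {T : Set (Fin n → ℝ)} {S : Finset (Fin n → ℝ)} (hS : S.Nonempty)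
    (hST : ∀ x ∈ S, x ∈ T) {c : ℝ} (hT : ∀ x ∈ T, norm1 x ≤ c) : gwid S ≤ gaussWidth T := by
  have : Nonempty S := hS.to_subtype
  obtain ⟨x₀, hx₀⟩ := hS
  refine integral_mono (integrable_iSup_dotProduct _)
    (integrable_sSup_dotProduct ⟨x₀, hST x₀ hx₀⟩ hT) fun g => ?_
  refine ciSup_le fun x => ?_
  exact le_csSup (bddAbove_image_dotProduct hT g) ⟨x, hST x x.2, rfl⟩

lemma norm1_sub_le {n : ℕ} (x y : Fin n → ℝ) : norm1 (x - y) ≤ norm1 x + norm1 y := by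
  rw [norm1, norm1, norm1, ← Finset.sum_add_distrib]
  exact Finset.sum_le_sum fun t _ => abs_sub (x t) (y t)

lemma norm1_le_two_of_mem_diffSet {n : ℕ} {T : Set (Fin n → ℝ)} (hT : ∀ x ∈ T, norm1 x ≤ 1) :
    ∀ d ∈ diffSet T, norm1 d ≤ 2 := by
  rintro _ ⟨x, hx, x', hx', rfl⟩
  linarith [norm1_sub_le x x', hT x hx, hT x' hx']

lemma norm2_le_srad {n : ℕ} {T : Set (Fin n → ℝ)} {c : ℝ} (hT : ∀ x ∈ T, norm1 x ≤ c)
    {x : Fin n → ℝ} (hx : x ∈ T) : norm2 x ≤ srad T := by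
  refine le_csSup ⟨c, ?_⟩ ⟨x, hx, rfl⟩
  rintro _ ⟨y, hy, rfl⟩
  exact (norm2_le_norm1 y).trans (hT y hy)

lemma abs_sub_le_sqrt_mul_of_abs_sq_sub_sq_le {a b α r : ℝ} (ha : 0 ≤ a) (hb : 0 ≤ b)
    (hα : 0 ≤ α) (hr : 0 ≤ r) (h : |a ^ 2 - b ^ 2| ≤ α * r ^ 2) : |a - b| ≤ √α * r := by
  refine abs_le_of_sq_le_sq ?_ (by positivity)
  rw [mul_pow, Real.sq_sqrt hα]
  refine le_trans ?_ h
  rw [sq_sub_sq, abs_mul, ← sq_abs, sq, abs_of_nonneg (add_nonneg ha hb)]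
  refine mul_le_mul_of_nonneg_right (abs_le.mpr ⟨?_, ?_⟩) (abs_nonneg _) <;> linarith

/-- Regrouping of the row indices and row signs of the measurement matrix into blocks. -/
def blockEquiv (n p lam : ℕ) :
    ((Fin (p * lam) → Fin n) × (Fin (p * lam) → Bool) × (Fin n → Bool)) ≃
      ((Fin p → Fin lam → Fin n × Bool) × (Fin n → Bool)) where
  toFun ω := (fun k s => (ω.1 (finProdFinEquiv (k, s)), ω.2.1 (finProdFinEquiv (k, s))), ω.2.2)
  invFun q := (fun j => (q.1 (finProdFinEquiv.symm j).1 (finProdFinEquiv.symm j).2).1,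
    fun j => (q.1 (finProdFinEquiv.symm j).1 (finProdFinEquiv.symm j).2).2, q.2)
  left_inv ω := by simp only [Prod.mk.eta, Equiv.apply_symm_apply]
  right_inv q := by simp

/-- The measurement matrix with randomly selected and signed rows of `U`. -/
def rowSample {n m : ℕ} (U : Matrix (Fin n) (Fin n) ℝ) (i : Fin m → Fin n) (σ : Fin m → Bool) :
    Matrix (Fin m) (Fin n) ℝ := Matrix.of fun j t => rsign (σ j) * U (i j) t

lemma rowSample_mulVec {n m : ℕ} (U : Matrix (Fin n) (Fin n) ℝ) (i : Fin m → Fin n)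
    (σ : Fin m → Bool) (x : Fin n → ℝ) (j : Fin m) :
    (rowSample U i σ *ᵥ x) j = rsign (σ j) * (U (i j) ⬝ᵥ x) := by
  simp only [rowSample, Matrix.mulVec, dotProduct, Matrix.of_apply, Finset.mul_sum, mul_assoc]

lemma abs_rowSample_mulVec_le {n m : ℕ} {U : Matrix (Fin n) (Fin n) ℝ}
    (hU1 : ∀ i j, |U i j| ≤ 1) (i : Fin m → Fin n) (σ : Fin m → Bool) (ε : Fin n → Bool)
    {x : Fin n → ℝ} (hx : norm1 x ≤ 1) (j : Fin m) :
    |8 / 9 * ((rowSample U i σ * signDiag ε) *ᵥ x) j| ≤ 8 / 9 := by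
  rw [← Matrix.mulVec_mulVec, rowSample_mulVec, abs_mul, abs_mul, abs_rsign, one_mul,
    abs_of_pos (by norm_num : (0 : ℝ) < 8 / 9)]
  have h1 := abs_dotProduct_le_norm1 (hU1 (i j)) (signDiag ε *ᵥ x)
  have h2 : norm1 (signDiag ε *ᵥ x) = norm1 x := by
    simp only [signDiag_mulVec, norm1, abs_mul, abs_rsign, one_mul]
  linarith

lemma kronRow_rowSample_mulVec {n p lam : ℕ} (U : Matrix (Fin n) (Fin n) ℝ) {v : Fin lam → ℝ}
    (ω : (Fin (p * lam) → Fin n) × (Fin (p * lam) → Bool) × (Fin n → Bool)) (x x' : Fin n → ℝ) :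
    ((9 / (8 * norm2 v * √p)) • kronRow p v) *ᵥ
      ((fun j => 8 / 9 * ((rowSample U ω.1 ω.2.1 * signDiag ω.2.2) *ᵥ x) j) -
        fun j => 8 / 9 * ((rowSample U ω.1 ω.2.1 * signDiag ω.2.2) *ᵥ x') j)
      = (measMat U v (blockEquiv n p lam ω).1 * signDiag (blockEquiv n p lam ω).2) *ᵥ (x - x') := by
  ext k
  rw [Matrix.smul_mulVec, Pi.smul_apply, kronRow_mulVec, ← Matrix.mulVec_mulVec (x - x'),
    measMat_mulVec, blockRow_dotProduct, smul_eq_mul, Finset.mul_sum, Finset.sum_div]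
  refine Finset.sum_congr rfl fun s _ => ?_
  simp only [Pi.sub_apply, ← Matrix.mulVec_mulVec, rowSample_mulVec, blockEquiv, Equiv.coe_fn_mk,
    Matrix.mulVec_sub, dotProduct_sub]
  ring

/-- The absolute constant of the chaining argument. -/
def chainConst : ℝ := 189 * ripConst * 1168 / (gaussAbs / 4)

lemma chain_budget {n p : ℕ} {γ ν α ω r δ G : ℝ} {s₀ : ℕ} (hp : 0 < p) (hγ : 0 < γ) (hν : 0 < ν)
    (hα : 0 < α) (hr : 0 < r) (hG : 0 ≤ G) (hGω : G ≤ ω)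
    (hδ : δ = γ * Real.log n ^ 2 * √(1 + ν) / √p) (hs₀ : (s₀ : ℝ) ≤ 21 * (1 + ν))
    (h : 21 * chainConst ^ 2 * γ ^ 2 * (1 + ν) ^ 2 * Real.log n ^ 4 * max 1 (ω ^ 2 / r ^ 2) / α ^ 2
      ≤ p) :
    189 * (ripConst * (δ * √s₀ * (1168 * (G / (gaussAbs / 4))))) ≤ α * r := by
  have hp' : (0 : ℝ) < p := by exact_mod_cast hp
  have e : 189 * (ripConst * (δ * √s₀ * (1168 * (G / (gaussAbs / 4)))))
      = chainConst * (δ * √s₀ * G) := by simp only [chainConst]; ring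
  rw [e]
  refine le_of_sq_le_sq ?_ (by positivity)
  have hδ2 : δ ^ 2 = γ ^ 2 * Real.log n ^ 4 * (1 + ν) / p := by
    rw [hδ, div_pow, mul_pow, mul_pow, Real.sq_sqrt (by positivity), Real.sq_sqrt hp'.le]
    ring
  have h1 : 21 * chainConst ^ 2 * γ ^ 2 * (1 + ν) ^ 2 * Real.log n ^ 4 * (ω ^ 2 / r ^ 2) / α ^ 2
      ≤ p := by
    refine le_trans ?_ h
    refine div_le_div_of_nonneg_right ?_ (by positivity)
    exact mul_le_mul_of_nonneg_left (le_max_right _ _) (by positivity)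
  have h2 : 21 * chainConst ^ 2 * γ ^ 2 * (1 + ν) ^ 2 * Real.log n ^ 4 * ω ^ 2
      ≤ p * (α ^ 2 * r ^ 2) := by
    rw [div_le_iff₀ (by positivity), mul_div_assoc', div_le_iff₀ (by positivity)] at h1
    linarith
  calc (chainConst * (δ * √s₀ * G)) ^ 2 = chainConst ^ 2 * δ ^ 2 * s₀ * G ^ 2 := by
        rw [mul_pow, mul_pow, mul_pow, Real.sq_sqrt (Nat.cast_nonneg s₀)]; ring
    _ ≤ chainConst ^ 2 * δ ^ 2 * (21 * (1 + ν)) * ω ^ 2 := by gcongr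
    _ = (21 * chainConst ^ 2 * γ ^ 2 * (1 + ν) ^ 2 * Real.log n ^ 4 * ω ^ 2) / p := by
        rw [hδ2]; ring
    _ ≤ α ^ 2 * r ^ 2 := by
        rw [div_le_iff₀ hp']; linarith
    _ = _ := by ring

end

/-- binary embedding of an arbitrary subset `𝒯 ⊂ B₁ⁿ` via distributed
noise-shaping quantization of sign-randomized bounded orthogonal measurements, with
distortion controlled by the Gaussian width and radius of `𝒯 − 𝒯`. -/
theorem stmt9 (β : ℝ) (hβ1 : 1 < β) (hβ2 : β ≤ 10 / 9) :
    ∃ C₁ C₂ : ℝ, 0 < C₁ ∧ 0 < C₂ ∧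
      ∀ (n p lam : ℕ) (U : Matrix (Fin n) (Fin n) ℝ) (T : Set (Fin n → ℝ))
        (α ν γ : ℝ),
        2 ≤ n → 0 < p → 0 < lam →
        Uᵀ * U = (n : ℝ) • (1 : Matrix (Fin n) (Fin n) ℝ) →
        (∀ i j, |U i j| ≤ 1) →
        (∀ x ∈ T, norm1 x ≤ 1) →
        0 < α → α < 1 → 0 < ν →
        γ = norm1 (betaVec β lam) / norm2 (betaVec β lam) →
        p ≤ p * lam →
        C₁ * γ ^ 2 * (1 + ν) ^ 2 * (Real.log n) ^ 4 *
            max 1 (gaussWidth (diffSet T) ^ 2 / srad (diffSet T) ^ 2) / α ^ 2 ≤ (p : ℝ) →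
        unifProb (fun ω : (Fin (p * lam) → Fin n) × (Fin (p * lam) → Bool) × (Fin n → Bool) =>
            let Φ : Matrix (Fin (p * lam)) (Fin n) ℝ :=
              Matrix.of fun j t => rsign (ω.2.1 j) * U (ω.1 j) t
            let Dd : Matrix (Fin n) (Fin n) ℝ := Matrix.diagonal fun t => rsign (ω.2.2 t)
            let f : (Fin n → ℝ) → (Fin (p * lam) → ℝ) :=
              fun x => Qbeta β p lam (fun j => (8 / 9) * (Φ * Dd).mulVec x j)
            let Vt : Matrix (Fin p) (Fin (p * lam)) ℝ :=
              (9 / (8 * norm2 (betaVec β lam) * Real.sqrt p)) • kronRow p (betaVec β lam)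
            ∀ x ∈ T, ∀ x' ∈ T,
              |norm2 (Vt.mulVec (f x - f x')) - norm2 (x - x')|
                ≤ max (Real.sqrt α) α * srad (diffSet T) + C₂ * β ^ (-(lam : ℤ) + 1))
          ≥ 1 - Real.exp (-ν) := by
  have hC : 0 < chainConst := by
    have := gaussAbs_pos
    simp only [chainConst, ripConst]
    positivity
  refine ⟨21 * chainConst ^ 2, 9 / 4, by positivity, by norm_num, ?_⟩
  intro n p lam U T α ν γ hn hp hl hU hU1 hT hα hα1 hν hγ _ hpbound
  have : NeZero n := ⟨by omega⟩
  have hβ0 : 0 < β := by linarith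
  set v := betaVec β lam with hvdef
  have hv : 0 < norm2 v := (inv_pos.mpr hβ0).trans_le (inv_le_norm2_betaVec hl)
  set r := srad (diffSet T) with hrdef
  have hT2 := norm1_le_two_of_mem_diffSet hT
  let Ω := (Fin (p * lam) → Fin n) × (Fin (p * lam) → Bool) × (Fin n → Bool)
  let B : Ω → Matrix (Fin p) (Fin n) ℝ := fun ω =>
    measMat U v (blockEquiv n p lam ω).1 * signDiag (blockEquiv n p lam ω).2
  let bad : Ω → Prop := fun ω => ∃ d ∈ diffSet T, α * r ^ 2 < |isoDefect (B ω) d|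
  have hbadP : unifProb bad ≤ Real.exp (-ν) := by
    classical
    by_cases hex : ∃ ω, bad ω
    · obtain ⟨ω₀, d₀, hd₀, hlt₀⟩ := hex
      have h0T : (0 : Fin n → ℝ) ∈ diffSet T := by
        obtain ⟨x, hx, _⟩ := hd₀
        exact ⟨x, hx, x, hx, (sub_self x).symm⟩
      have hsel : ∀ ω : Ω, ∃ d ∈ diffSet T, bad ω → α * r ^ 2 < |isoDefect (B ω) d| := by
        intro ω
        by_cases h : bad ω
        · obtain ⟨d, hd, hlt⟩ := h
          exact ⟨d, hd, fun _ => hlt⟩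
        · exact ⟨0, h0T, fun h' => absurd h' h⟩
      choose D hDT hD using hsel
      set S : Finset (Fin n → ℝ) := insert 0 (Finset.univ.image D) with hS
      have h0S : (0 : Fin n → ℝ) ∈ S := Finset.mem_insert_self _ _
      have hST : ∀ x ∈ S, x ∈ diffSet T := by
        intro x hx
        rw [hS, Finset.mem_insert, Finset.mem_image] at hx
        rcases hx with rfl | ⟨ω, _, rfl⟩
        exacts [h0T, hDT ω]
      have hrS : ∀ x ∈ S, norm2 x ≤ r := fun x hx => norm2_le_srad hT2 (hST x hx)
      have hr : 0 < r := by
        refine lt_of_lt_of_le ?_ (norm2_le_srad hT2 hd₀)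
        refine norm2_pos fun hd0 => ?_
        rw [hd0] at hlt₀
        simp only [isoDefect, Matrix.mulVec_zero, norm2_zero] at hlt₀
        norm_num at hlt₀
        nlinarith [mul_nonneg hα.le (sq_nonneg r)]
      have hγ0 : 0 < γ := by
        rw [hγ]
        exact div_pos (hv.trans_le (norm2_le_norm1 v)) hv
      have hs₀ : ((⌈20 * (1 + ν)⌉₊ : ℕ) : ℝ) ≤ 21 * (1 + ν) := by
        have := Nat.ceil_lt_add_one (by positivity : 0 ≤ 20 * (1 + ν))
        linarith
      have hmain := unifProb_measMat_isoDefect_gt_le (p := p) hn hp hU hU1 hv h0S hν rfl hrS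
        (Nat.le_ceil (20 * (1 + ν)))
        (chain_budget hp hγ0 hν hα hr (gwid_nonneg ⟨0, h0S⟩)
          (gwid_le_gaussWidth ⟨0, h0S⟩ hST hT2) (by rw [hγ]) hs₀ hpbound) hα1.le
      rw [← unifProb_equiv (blockEquiv n p lam)] at hmain
      refine (unifProb_mono fun ω hω => ?_).trans hmain
      exact ⟨D ω, Finset.mem_insert_of_mem (Finset.mem_image_of_mem D (Finset.mem_univ ω)), hD ω hω⟩
    · refine (unifProb_mono (Q := fun _ => False) fun ω hω => hex ⟨ω, hω⟩).trans ?_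
      simp only [unifProb_eq_expect, if_false, Finset.expect_const_zero]
      positivity
  rw [ge_iff_le, unifProb_not]
  refine sub_le_sub_left (le_trans (unifProb_mono fun ω hω => ?_) hbadP) 1
  by_contra hgood
  refine hω fun x hx x' hx' => ?_
  have hdT : x - x' ∈ diffSet T := ⟨x, hx, x', hx', rfl⟩
  have hiso : |isoDefect (B ω) (x - x')| ≤ α * r ^ 2 := by
    by_contra h
    exact hgood ⟨_, hdT, not_le.mp h⟩
  have hr0 : 0 ≤ r := (norm2_nonneg _).trans (norm2_le_srad hT2 hdT)
  have hq := abs_norm2_quantized_sub_le hβ1 hβ2 hp hl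
    (abs_rowSample_mulVec_le hU1 ω.1 ω.2.1 ω.2.2 (hT x hx))
    (abs_rowSample_mulVec_le hU1 ω.1 ω.2.1 ω.2.2 (hT x' hx'))
  rw [← hvdef, kronRow_rowSample_mulVec] at hq
  have hn2 := abs_sub_le_sqrt_mul_of_abs_sq_sub_sq_le (norm2_nonneg _) (norm2_nonneg _) hα.le hr0 hiso
  have hmax : √α * r ≤ max √α α * r := mul_le_mul_of_nonneg_right (le_max_left _ _) hr0
  refine (abs_sub_le _ (norm2 (B ω *ᵥ (x - x'))) _).trans ?_
  rw [add_comm]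
  exact add_le_add (hn2.trans hmax) hq
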